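/- Let G be a field of characteristic 0, Γ a finitely generated subgroup of the multiplicative group G*, and f a nonzero polynomial in G[X1, …, Xn]. Then the equation f(x1, …, xn) = 0 has only finitely many non-degenerate solutions (x1, …, xn) ∈ Γⁿ. -/

import Mathlib

/-- A solution `x ∈ Γⁿ` of `f(x1, …, xn) = 0` is degenerate if there are integers
`c1, …, cn`, not all zero, such that `f(x1·T^{c1}, …, xn·T^{cn})` vanishes identically
as a Laurent polynomial in `T`. -/
def IsDegenerate {G : Type*} [Field G] {n : ℕ} (f : MvPolynomial (Fin n) G)
    (x : Fin n → Gˣ) : Prop :=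
  ∃ c : Fin n → ℤ, c ≠ 0 ∧
    MvPolynomial.eval₂ (LaurentPolynomial.C (R := G))
      (fun i => LaurentPolynomial.C ((x i : G)) * LaurentPolynomial.T (c i)) f = 0

set_option linter.unusedSectionVars false
namespace MLT
open NumberField Polynomial

section places
variable {K : Type*} [Field K] [NumberField K]

/-- The places: all infinite ones and the finite ones in `S`. -/
abbrev Pl (S : Finset (FinitePlace K)) := InfinitePlace K ⊕ {v : FinitePlace K // v ∈ S}

/-- absolute value -/
def pa {S : Finset (FinitePlace K)} (p : Pl S) : AbsoluteValue K ℝ :=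
  Sum.elim (fun w => w.1) (fun v => v.1.1) p

/-- weight -/
noncomputable def pw {S : Finset (FinitePlace K)} (p : Pl S) : ℝ :=
  Sum.elim (fun w => (w.mult : ℝ)) (fun _ => 1) p

/-- S-integers -/
def IsSInt (S : Finset (FinitePlace K)) (y : K) : Prop := ∀ v : FinitePlace K, v ∉ S → v y ≤ 1

lemma pw_pos {S : Finset (FinitePlace K)} (p : Pl S) : 0 < pw p := by
  rcases p with w | v
  · simp [pw, InfinitePlace.mult_pos]
  · simp [pw]

lemma pa_inl {S : Finset (FinitePlace K)} (w : InfinitePlace K) (x : K) :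
    pa (S := S) (Sum.inl w) x = w x := rfl

lemma pa_inr {S : Finset (FinitePlace K)} (v : {v : FinitePlace K // v ∈ S}) (x : K) :
    pa (S := S) (Sum.inr v) x = v.1 x := rfl

lemma fin_nonarch (v : FinitePlace K) : IsNonarchimedean v.1 := fun x y => v.add_le x y

lemma fin_int_le_one (v : FinitePlace K) (n : ℤ) : v (n : K) ≤ 1 := by
  have := FinitePlace.norm_le_one (K := K) v.maximalIdeal (n : 𝓞 K)
  rw [FinitePlace.norm_embedding_eq] at this
  simpa using this

lemma fin_integer_le_one (v : FinitePlace K) (n : 𝓞 K) : v (n : K) ≤ 1 := by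
  have := FinitePlace.norm_le_one (K := K) v.maximalIdeal n
  rwa [FinitePlace.norm_embedding_eq] at this

lemma sum_inf_mult : (∑ w : InfinitePlace K, (w.mult : ℝ)) = Module.finrank ℚ K := by
  exact_mod_cast InfinitePlace.sum_mult_eq

/-- product formula inequality -/
theorem sum_log_nonneg (S : Finset (FinitePlace K)) {y : K} (hy : y ≠ 0) (h : IsSInt S y) :
    0 ≤ ∑ p : Pl S, pw p * Real.log (pa p y) := by
  have h1 := NumberField.prod_abs_eq_one hy
  have hfin : (∏ᶠ v : FinitePlace K, v y) ≤ ∏ v ∈ S, v y := by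
    have hs := FinitePlace.hasFiniteMulSupport hy
    classical
    rw [finprod_eq_prod_of_mulSupport_subset (s := hs.toFinset ∪ S) _ (by intro v hv; simp only [Finset.coe_union, Set.mem_union]; left; exact hs.mem_toFinset.2 hv)]
    rw [← Finset.prod_sdiff (s₁ := S) (s₂ := hs.toFinset ∪ S) Finset.subset_union_right]
    have : ∏ v ∈ (hs.toFinset ∪ S) \ S, v y ≤ 1 := by
      apply Finset.prod_le_one
      · intro v _; exact apply_nonneg v y
      · intro v hv; exact h v (Finset.mem_sdiff.1 hv).2
    have h2 : 0 ≤ ∏ v ∈ S, v y := Finset.prod_nonneg fun v _ => apply_nonneg v y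
    nlinarith
  have hinf : 0 < ∏ w : InfinitePlace K, w y ^ w.mult :=
    Finset.prod_pos fun w _ => pow_pos (w.pos_iff.2 hy) _
  have h3 : 1 ≤ (∏ w : InfinitePlace K, w y ^ w.mult) * ∏ v ∈ S, v y := by
    rw [← h1]; gcongr
  have h4 := Real.log_nonneg h3
  rw [Real.log_mul hinf.ne' (Finset.prod_ne_zero_iff.2 fun v _ => (FinitePlace.pos_iff.2 hy).ne'),
    Real.log_prod (fun w _ => (pow_pos (w.pos_iff.2 hy) _).ne'),
    Real.log_prod (fun v _ => (FinitePlace.pos_iff.2 hy).ne')] at h4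
  rw [Fintype.sum_sum_type]
  refine h4.trans_eq ?_
  congr 1
  · apply Finset.sum_congr rfl; intro w _; simp [pw, pa_inl]
  · rw [← Finset.sum_coe_sort]
    apply Finset.sum_congr rfl; intro v _; simp [pw, pa_inr]

/-- partial height -/
noncomputable def hS (S : Finset (FinitePlace K)) (ξ : K) : ℝ :=
  ∑ p : Pl S, pw p * Real.posLog (pa p ξ)

lemma gauss_step (v : FinitePlace K) (ξ : K) (e : ℕ) (Q : K[X]) (hQ : Q ≠ 0)
    (hW : ∀ i, v (((X - C ξ) ^ e * Q).coeff i) ≤ 1) :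
    e * Real.posLog (v ξ) + Real.log (v Q.leadingCoeff) ≤ 0 := by
  have hna := fin_nonarch v
  have hX : (max 1 (v ξ)) ≤ (X - C ξ).gaussNorm v.1 1 := by
    apply max_le
    · have := (X - C ξ).le_gaussNorm v.1 zero_le_one 1
      simpa using this
    · have := (X - C ξ).le_gaussNorm v.1 zero_le_one 0
      simp at this
      exact this
  have hQl : v Q.leadingCoeff ≤ Q.gaussNorm v.1 1 := by
    have := Q.le_gaussNorm v.1 zero_le_one Q.natDegree
    simp at this
    exact this
  have hpow : ∀ k : ℕ, (max 1 (v ξ))^k * v Q.leadingCoeff ≤ ((X - C ξ)^k * Q).gaussNorm v.1 1 := by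
    intro k
    induction k with
    | zero => simpa using hQl
    | succ k ih =>
      rw [pow_succ', pow_succ', mul_assoc, mul_assoc, Polynomial.gaussNorm_mul hna one_pos]
      have h0 : 0 ≤ v Q.leadingCoeff := apply_nonneg _ _
      gcongr
      exact Polynomial.gaussNorm_nonneg _ _ zero_le_one
  have h1 : ((X - C ξ)^e * Q).gaussNorm v.1 1 ≤ 1 := by
    obtain ⟨i, hi⟩ := Polynomial.exists_eq_gaussNorm v.1 1 ((X - C ξ)^e * Q)
    rw [hi, one_pow, mul_one]; exact hW i
  have h2 := (hpow e).trans h1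
  have hl : 0 < v Q.leadingCoeff := FinitePlace.pos_iff.2 (leadingCoeff_ne_zero.2 hQ)
  have hm : 0 < max 1 (v ξ) := by positivity
  have h3 := Real.log_nonpos (by positivity) h2
  rw [Real.log_mul (by positivity) hl.ne', Real.log_pow] at h3
  rwa [Real.posLog_eq_log_max_one (apply_nonneg _ _)]

lemma mahler_step (w : InfinitePlace K) (ξ : K) (e : ℕ) (Q : K[X]) (hQ : Q ≠ 0) (B : ℝ)
    (hB : (((X - C ξ) ^ e * Q).sum fun _ a => w a) ≤ B) :
    e * Real.posLog (w ξ) + Real.log (w Q.leadingCoeff) ≤ Real.log B := by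
  let φ := w.embedding
  have hφ : ∀ x, ‖φ x‖ = w x := fun x => w.norm_embedding_eq x
  have hinj : Function.Injective φ := φ.injective
  have h1 := Polynomial.mahlerMeasure_le_sum_norm_coeff (((X - C ξ) ^ e * Q).map φ)
  have h2 : ((((X - C ξ) ^ e * Q).map φ).sum fun _ a => ‖a‖) =
      (((X - C ξ) ^ e * Q).sum fun _ a => w a) := by
    rw [Polynomial.sum_def, Polynomial.sum_def, Polynomial.support_map_of_injective _ hinj]
    simp only [coeff_map, hφ]
  rw [h2] at h1
  have h3 : (((X - C ξ) ^ e * Q).map φ).mahlerMeasure =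
      (max 1 (w ξ))^e * (Q.map φ).mahlerMeasure := by
    rw [Polynomial.map_mul, Polynomial.map_pow, mahlerMeasure_mul]
    congr 1
    rw [← hφ]
    clear hB h1 h2
    induction e with
    | zero => simp
    | succ k ih =>
      rw [pow_succ, mahlerMeasure_mul, pow_succ, ih]
      simp [mahlerMeasure_X_sub_C]
  rw [h3] at h1
  have h4 := leadingCoeff_le_mahlerMeasure (Q.map φ)
  rw [leadingCoeff_map, hφ] at h4
  have hl : 0 < w Q.leadingCoeff := w.pos_iff.2 (leadingCoeff_ne_zero.2 hQ)
  have hm : 0 < max 1 (w ξ) := by positivity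
  have h5 : (max 1 (w ξ))^e * w Q.leadingCoeff ≤ B := by
    refine le_trans ?_ (h1.trans hB)
    gcongr
  have h6 := Real.log_le_log (by positivity) h5
  rw [Real.log_mul (by positivity) hl.ne', Real.log_pow] at h6
  rwa [Real.posLog_eq_log_max_one (apply_nonneg _ _)]

theorem HB (S : Finset (FinitePlace K)) (ξ : K) (W : ℤ[X]) (hW : W ≠ 0) (e : ℕ)
    (h : (X - C ξ) ^ e ∣ W.map (Int.castRingHom K)) :
    e * hS S ξ ≤ Module.finrank ℚ K * Real.log (W.sum fun _ a => |(a : ℝ)|) := by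
  obtain ⟨Q, hQ⟩ := h
  have hW0 : W.map (Int.castRingHom K) ≠ 0 := by
    rwa [Ne, Polynomial.map_eq_zero_iff (RingHom.injective_int _)]
  have hQ0 : Q ≠ 0 := by rintro rfl; simp at hQ; exact hW (by
    apply Polynomial.map_injective _ (RingHom.injective_int (Int.castRingHom K)); simpa using hQ)
  have hlead : Q.leadingCoeff = (W.leadingCoeff : K) := by
    have := congrArg leadingCoeff hQ
    rw [leadingCoeff_map_of_injective (RingHom.injective_int _)] at this
    simp [leadingCoeff_mul, leadingCoeff_pow] at this
    exact this.symm
  have hl0 : Q.leadingCoeff ≠ 0 := leadingCoeff_ne_zero.2 hQ0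
  have hintg : IsSInt S Q.leadingCoeff := by
    intro v _; rw [hlead]; exact fin_int_le_one v _
  have hsum := sum_log_nonneg S hl0 hintg
  have hInf : ∀ w : InfinitePlace K, e * Real.posLog (w ξ) + Real.log (w Q.leadingCoeff) ≤
      Real.log (W.sum fun _ a => |(a : ℝ)|) := by
    intro w
    apply mahler_step w ξ e Q hQ0
    rw [← hQ, Polynomial.sum_def, Polynomial.sum_def,
      Polynomial.support_map_of_injective _ (RingHom.injective_int _)]
    apply le_of_eq
    apply Finset.sum_congr rfl
    intro i _
    simp only [coeff_map, eq_intCast]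
    rw [← w.norm_embedding_eq, map_intCast]
    simp
  have hFin : ∀ v : FinitePlace K, e * Real.posLog (v ξ) + Real.log (v Q.leadingCoeff) ≤ 0 := by
    intro v
    apply gauss_step v ξ e Q hQ0
    intro i; rw [← hQ]; simp only [coeff_map, eq_intCast]; exact fin_int_le_one v _
  have key : e * hS S ξ + ∑ p : Pl S, pw p * Real.log (pa p Q.leadingCoeff) ≤
      Module.finrank ℚ K * Real.log (W.sum fun _ a => |(a : ℝ)|) := by
    rw [hS, Finset.mul_sum, ← Finset.sum_add_distrib, Fintype.sum_sum_type, ← sum_inf_mult,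
      Finset.sum_mul]
    have : ∑ v : {v // v ∈ S}, ((e:ℝ) * (pw (S := S) (Sum.inr v) * Real.posLog (pa (S := S) (Sum.inr v) ξ)) +
      pw (S := S) (Sum.inr v) * Real.log (pa (S := S) (Sum.inr v) Q.leadingCoeff)) ≤ 0 := by
      apply Finset.sum_nonpos
      intro v _
      have := hFin v.1
      simpa [pw, pa_inr] using this
    refine (add_le_add_right this _).trans ?_
    rw [add_zero]
    apply Finset.sum_le_sum
    intro w _
    have := hInf w
    simp only [pw, pa_inl, Sum.elim_inl]
    have hm : (0:ℝ) ≤ w.mult := by positivity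
    nlinarith
  linarith
end places
end MLT

set_option linter.unusedSectionVars false
namespace MLT
open MvPolynomial

section delta
variable {σ : Type*} [Fintype σ] {R : Type*} [CommRing R]

/-- multi binomial -/
def mchoose (α μ : σ →₀ ℕ) : ℕ := ∏ i, (α i).choose (μ i)

/-- diagonal operator -/
noncomputable def Dg (φ : (σ →₀ ℕ) → R) : MvPolynomial σ R →ₗ[R] MvPolynomial σ R :=
  (basisMonomials σ R).constr R (fun α => monomial α (φ α))

lemma Dg_monomial (φ : (σ →₀ ℕ) → R) (α : σ →₀ ℕ) (c : R) :
    Dg φ (monomial α c) = monomial α (φ α * c) := by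
  have h : monomial α c = c • (basisMonomials σ R) α := by simp [smul_monomial]
  rw [h, map_smul, Dg, Module.Basis.constr_basis, smul_monomial, smul_eq_mul, mul_comm]

lemma coeff_Dg (φ : (σ →₀ ℕ) → R) (p : MvPolynomial σ R) (β : σ →₀ ℕ) :
    coeff β (Dg φ p) = φ β * coeff β p := by
  classical
  induction p using MvPolynomial.induction_on' with
  | monomial u a =>
    rw [Dg_monomial, coeff_monomial, coeff_monomial]
    split_ifs with h
    · rw [h]
    · simp
  | add p q hp hq => rw [map_add, coeff_add, hp, hq, coeff_add, mul_add]

/-- Hasse derivative -/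
noncomputable def Del (μ : σ →₀ ℕ) : MvPolynomial σ R →ₗ[R] MvPolynomial σ R :=
  (basisMonomials σ R).constr R (fun α => monomial (α - μ) (mchoose α μ : R))

lemma Del_monomial (μ α : σ →₀ ℕ) (c : R) :
    Del μ (monomial α c) = monomial (α - μ) ((mchoose α μ : R) * c) := by
  have h : monomial α c = c • (basisMonomials σ R) α := by simp [smul_monomial]
  rw [h, map_smul, Del, Module.Basis.constr_basis, smul_monomial, smul_eq_mul, mul_comm]

lemma mchoose_eq_zero {α μ : σ →₀ ℕ} (h : ¬ μ ≤ α) : mchoose α μ = 0 := by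
  rw [Finsupp.le_def] at h
  push Not at h
  obtain ⟨i, hi⟩ := h
  exact Finset.prod_eq_zero (Finset.mem_univ i) (Nat.choose_eq_zero_of_lt hi)

lemma coeff_Del (μ : σ →₀ ℕ) (p : MvPolynomial σ R) (β : σ →₀ ℕ) :
    coeff β (Del μ p) = (mchoose (β + μ) μ : R) * coeff (β + μ) p := by
  classical
  induction p using MvPolynomial.induction_on' with
  | monomial u a =>
    rw [Del_monomial, coeff_monomial, coeff_monomial]
    by_cases h : μ ≤ u
    · by_cases h2 : u = β + μ
      · rw [if_pos (by rw [h2]; simp), if_pos h2, h2]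
      · rw [if_neg (by intro h3; apply h2; rw [← h3, tsub_add_cancel_of_le h]), if_neg h2]; simp
    · rw [mchoose_eq_zero h, if_neg (c := u = β + μ) (by rintro rfl; exact h (by simp))]; simp
  | add p q hp hq => rw [map_add, coeff_add, hp, hq, coeff_add, mul_add]

lemma X_mul_Del (μ : σ →₀ ℕ) (p : MvPolynomial σ R) :
    monomial μ 1 * Del μ p = Dg (fun α => (mchoose α μ : R)) p := by
  induction p using MvPolynomial.induction_on' with
  | monomial u a =>
    rw [Del_monomial, Dg_monomial, monomial_mul, one_mul]
    by_cases h : μ ≤ u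
    · rw [add_tsub_cancel_of_le h]
    · rw [mchoose_eq_zero h]; simp
  | add p q hp hq => rw [map_add, mul_add, hp, hq, map_add]

lemma Del_map {R' : Type*} [CommRing R'] (φ : R →+* R') (μ : σ →₀ ℕ) (p : MvPolynomial σ R) :
    Del μ (map φ p) = map φ (Del μ p) := by
  ext β; simp [coeff_Del, coeff_map]

lemma mchoose_succ [DecidableEq σ] (β μ : σ →₀ ℕ) (i : σ) :
    (β i + 1) * mchoose (β + Finsupp.single i 1 + μ) μ =
      (μ i + 1) * mchoose (β + (μ + Finsupp.single i 1)) (μ + Finsupp.single i 1) := by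
  unfold mchoose
  rw [← Finset.mul_prod_erase _ _ (Finset.mem_univ i), ← Finset.mul_prod_erase _ _ (Finset.mem_univ i),
    ← mul_assoc, ← mul_assoc]
  congr 1
  · simp only [Finsupp.add_apply, Finsupp.single_eq_same]
    have h1 : β i + 1 + μ i = (β i + μ i) + 1 := by ring
    have h2 : β i + (μ i + 1) = (β i + μ i) + 1 := by ring
    rw [h1, h2]
    have e1 := Nat.add_one_mul_choose_eq (β i + μ i) (μ i)
    have e2 := Nat.choose_mul_succ_eq (β i + μ i) (μ i)
    have h3 : β i + μ i + 1 - μ i = β i + 1 := by omega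
    rw [h3] at e2
    linarith
  · apply Finset.prod_congr rfl
    intro j hj
    have : i ≠ j := fun h => by simp [h] at hj
    simp [Finsupp.single_eq_of_ne this.symm]

lemma pderiv_Del [DecidableEq σ] (μ : σ →₀ ℕ) (i : σ) (p : MvPolynomial σ R) :
    pderiv i (Del μ p) = ((μ i + 1 : ℕ) : R) • Del (μ + Finsupp.single i 1) p := by
  ext β
  rw [coeff_pderiv, coeff_Del, coeff_smul, coeff_Del, smul_eq_mul, ← mul_assoc, ← Nat.cast_mul,
    ← mchoose_succ]
  push_cast
  rw [add_assoc β, add_comm (Finsupp.single i 1)]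
  ring

/-- translation -/
noncomputable def tr (ξ : σ → R) : MvPolynomial σ R →ₐ[R] MvPolynomial σ R :=
  aeval (fun i => X i + C (ξ i))

lemma pderiv_tr [DecidableEq σ] (ξ : σ → R) (i : σ) (p : MvPolynomial σ R) :
    pderiv i (tr ξ p) = tr ξ (pderiv i p) := by
  induction p using MvPolynomial.induction_on with
  | C a => simp [tr]
  | add p q hp hq => simp only [map_add, hp, hq]
  | mul_X p j hp =>
    rw [map_mul, Derivation.leibniz, Derivation.leibniz, hp, map_add]
    simp only [smul_eq_mul, map_mul]
    congr 2
    simp only [tr, aeval_X, map_add, pderiv_C, add_zero, pderiv_X, Pi.single_apply]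
    split_ifs <;> simp

lemma Del_tr [CharZero R] [IsDomain R] (ξ : σ → R) (μ : σ →₀ ℕ) (p : MvPolynomial σ R) :
    Del μ (tr ξ p) = tr ξ (Del μ p) := by
  classical
  suffices H : ∀ n : ℕ, ∀ μ : σ →₀ ℕ, μ.degree = n → Del μ (tr ξ p) = tr ξ (Del μ p) from
    H _ μ rfl
  intro n
  induction n with
  | zero =>
    intro μ hμ
    rw [Finsupp.degree_eq_zero_iff] at hμ
    subst hμ
    have : ∀ q : MvPolynomial σ R, Del 0 q = q := by
      intro q; ext β; simp [coeff_Del, mchoose]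
    rw [this, this]
  | succ n IH =>
    intro ν hν
    obtain ⟨i, hi⟩ : ∃ i, ν i ≠ 0 := by
      by_contra h
      push Not at h
      have : ν = 0 := Finsupp.ext h
      simp [this] at hν
    obtain ⟨μ, rfl⟩ : ∃ μ, ν = μ + Finsupp.single i 1 := by
      refine ⟨ν - Finsupp.single i 1, (tsub_add_cancel_of_le ?_).symm⟩
      rw [Finsupp.single_le_iff]; omega
    have ih := IH μ (by simpa using hν)
    have h1 := pderiv_Del μ i (tr ξ p)
    rw [ih, pderiv_tr, pderiv_Del, map_smul] at h1
    have h2 : ((μ i + 1 : ℕ) : R) ≠ 0 := Nat.cast_ne_zero.2 (Nat.succ_ne_zero _)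
    exact (smul_right_injective _ h2 h1).symm
end delta

end MLT

set_option linter.unusedSectionVars false
namespace MLT

section uni
open Polynomial
variable {F : Type*} [Field F] [CharZero F]
/-- Euler operator -/
noncomputable def th (g : F[X]) : F[X] := X * derivative g

lemma coeff_th_iter (a : ℕ) (g : F[X]) (n : ℕ) : (th^[a] g).coeff n = (n:F)^a * g.coeff n := by
  induction a generalizing g with
  | zero => simp
  | succ a ih =>
    rw [Function.iterate_succ_apply, ih, th]
    cases n with
    | zero => simp
    | succ n => rw [coeff_X_mul, coeff_derivative]; push_cast; ring

theorem wronsk_uni {k : ℕ} (g : Fin k → F[X]) (hg : LinearIndependent F g) :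
    (Matrix.of fun a l : Fin k => th^[(a:ℕ)] (g l)).det ≠ 0 := by
  intro hdet
  obtain ⟨c, hc0, hc⟩ := Matrix.exists_vecMul_eq_zero_iff.2 hdet
  have hrel : ∀ l, ∑ a : Fin k, c a * th^[(a:ℕ)] (g l) = 0 := fun l => congrFun hc l
  -- max degree of c
  obtain ⟨a0, ha0⟩ : ∃ a, c a ≠ 0 := Function.ne_iff.1 hc0
  obtain ⟨a1, -, ha1⟩ := Finset.exists_max_image Finset.univ (fun a => (c a).degree) ⟨a0, Finset.mem_univ _⟩
  have hca1 : c a1 ≠ 0 := by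
    intro h
    have := ha1 a0 (Finset.mem_univ _)
    rw [h, degree_zero, le_bot_iff, degree_eq_bot] at this
    exact ha0 this
  set D := (c a1).natDegree with hD
  have hdeg : ∀ a, (c a).natDegree ≤ D := fun a =>
    natDegree_le_natDegree (ha1 a (Finset.mem_univ _))
  let χ : F[X] := ∑ a : Fin k, C ((c a).coeff D) * X ^ (a:ℕ)
  have hχc : ∀ a : Fin k, χ.coeff a = (c a).coeff D := by
    intro a
    simp only [χ, finsetSum_coeff, coeff_C_mul, coeff_X_pow]
    rw [Finset.sum_eq_single a]
    · simp
    · intro b _ hb; rw [if_neg (fun h => hb (Fin.ext h.symm))]; simp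
    · simp
  have hχ : χ ≠ 0 := by
    intro h
    have := hχc a1
    rw [h, coeff_zero] at this
    exact hca1 (leadingCoeff_eq_zero.1 this.symm)
  have hχd : χ.natDegree < k := by
    have : χ.degree < k := by
      apply lt_of_le_of_lt (degree_sum_le _ _)
      rw [Finset.sup_lt_iff (by exact WithBot.bot_lt_coe k)]
      intro a _
      refine lt_of_le_of_lt (degree_C_mul_X_pow_le _ _) ?_
      exact_mod_cast a.2
    rwa [← natDegree_lt_iff_degree_lt hχ] at this
  -- any combination
  have hroot : ∀ b : Fin k → F, (∑ l, b l • g l) ≠ 0 →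
      χ.eval (((∑ l, b l • g l).natDegree : ℕ) : F) = 0 := by
    intro b hb
    set G := ∑ l, b l • g l with hG
    have hGrel : ∑ a : Fin k, c a * th^[(a:ℕ)] G = 0 := by
      have hlin : ∀ a : ℕ, th^[a] G = ∑ l, b l • th^[a] (g l) := by
        intro a; ext n; simp [coeff_th_iter, hG, finsetSum_coeff, Finset.mul_sum]
        apply Finset.sum_congr rfl; intro l _; ring
      simp_rw [hlin, Finset.mul_sum]
      rw [Finset.sum_comm]
      apply Finset.sum_eq_zero; intro l _
      simp_rw [mul_smul_comm]
      rw [← Finset.smul_sum, hrel, smul_zero]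
    have h1 := congrArg (fun q => q.coeff (D + G.natDegree)) hGrel
    simp only [finsetSum_coeff, coeff_zero] at h1
    have h2 : ∀ a : Fin k, (c a * th^[(a:ℕ)] G).coeff (D + G.natDegree) =
        (c a).coeff D * ((G.natDegree : F)^(a:ℕ) * G.coeff G.natDegree) := by
      intro a
      rw [coeff_mul_add_eq_of_natDegree_le (hdeg a), coeff_th_iter]
      rw [natDegree_le_iff_coeff_eq_zero]
      intro N hN
      rw [coeff_th_iter, coeff_eq_zero_of_natDegree_lt hN, mul_zero]
    simp_rw [h2, ← mul_assoc] at h1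
    rw [← Finset.sum_mul] at h1
    have h3 := (mul_eq_zero.1 h1).resolve_right (leadingCoeff_ne_zero.2 hb)
    simp only [χ, eval_finsetSum, eval_mul, eval_C, eval_pow, eval_X]
    exact h3
  -- dimension count
  classical
  let T : Finset ℕ := χ.roots.toFinset.preimage (Nat.cast : ℕ → F) (Nat.cast_injective.injOn)
  have hT : T.card < k := by
    refine lt_of_le_of_lt ?_ (lt_of_le_of_lt ((Multiset.toFinset_card_le _).trans (card_roots' χ)) hχd)
    rw [← Finset.card_image_of_injective T (Nat.cast_injective (R := F))]
    apply Finset.card_le_card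
    intro x hx
    obtain ⟨n, hn, rfl⟩ := Finset.mem_image.1 hx
    exact Finset.mem_preimage.1 hn
  let Φ : (Fin k → F) →ₗ[F] (T → F) :=
    LinearMap.pi fun t => (lcoeff F t.1) ∘ₗ (Fintype.linearCombination F g)
  have hΦ : Function.Injective Φ := by
    rw [← LinearMap.ker_eq_bot, LinearMap.ker_eq_bot']
    intro b hb
    by_contra hb0
    have hne : (∑ l, b l • g l) ≠ 0 := by
      intro h
      exact hb0 (funext (Fintype.linearIndependent_iff.1 hg b h))
    have hr := hroot b hne
    have hmem : (∑ l, b l • g l).natDegree ∈ T := by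
      simp only [T, Finset.mem_preimage, Multiset.mem_toFinset]
      exact (mem_roots hχ).2 hr
    have := congrFun hb ⟨_, hmem⟩
    simp only [Φ, LinearMap.pi_apply, LinearMap.comp_apply, Fintype.linearCombination_apply,
      lcoeff_apply, Pi.zero_apply] at this
    exact hne (leadingCoeff_eq_zero.1 this)
  have := LinearMap.finrank_le_finrank_of_injective hΦ
  simp at this
  omega
end uni

section multi
open MvPolynomial
variable {F : Type*} [Field F] [CharZero F]
lemma exists_weights {m : ℕ} (A : Finset (Fin m →₀ ℕ)) :
    ∃ D : Fin m → ℕ, Set.InjOn (fun α : Fin m →₀ ℕ => ∑ j, α j * D j) A := by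
  classical
  let q : (Fin m →₀ ℕ) × (Fin m →₀ ℕ) → Polynomial ℤ := fun x =>
    ∑ j : Fin m, Polynomial.C ((x.1 j : ℤ) - x.2 j) * Polynomial.X ^ (j:ℕ)
  have hq : ∀ x, x.1 ≠ x.2 → q x ≠ 0 := by
    intro x hx h
    apply hx
    ext j
    have := congrArg (fun r => r.coeff (j:ℕ)) h
    simp only [q, Polynomial.finsetSum_coeff, Polynomial.coeff_C_mul, Polynomial.coeff_X_pow,
      Polynomial.coeff_zero] at this
    rw [Finset.sum_eq_single j] at this
    · simp at this; omega
    · intro b _ hb; rw [if_neg (fun h => hb (Fin.ext h.symm))]; simp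
    · simp
  let Q : Polynomial ℤ := ∏ x ∈ (A ×ˢ A).filter (fun x => x.1 ≠ x.2), q x
  have hQ : Q ≠ 0 := Finset.prod_ne_zero_iff.2 fun x hx => hq x (Finset.mem_filter.1 hx).2
  obtain ⟨t, ht⟩ : ∃ t : ℕ, Q.eval (t:ℤ) ≠ 0 := by
    by_contra h
    push Not at h
    apply hQ
    apply Polynomial.eq_zero_of_infinite_isRoot
    apply Set.Infinite.mono (s := Set.range (fun t : ℕ => (t:ℤ)))
    · rintro _ ⟨t, rfl⟩; exact h t
    · exact Set.infinite_range_of_injective Nat.cast_injective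
  refine ⟨fun j => t ^ (j:ℕ), ?_⟩
  intro α hα β hβ hab
  by_contra hne
  apply ht
  simp only [Q]
  rw [Polynomial.eval_prod]
  apply Finset.prod_eq_zero (i := (α, β))
  · simp only [Finset.mem_filter, Finset.mem_product]
    exact ⟨⟨hα, hβ⟩, hne⟩
  · simp only [q, Polynomial.eval_finsetSum, Polynomial.eval_mul, Polynomial.eval_C,
      Polynomial.eval_pow, Polynomial.eval_X, sub_mul, Finset.sum_sub_distrib]
    have : (∑ j, (α j : ℤ) * (t:ℤ)^(j:ℕ)) = ∑ j, (β j : ℤ) * (t:ℤ)^(j:ℕ) := by exact_mod_cast hab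
    rw [this, sub_self]

lemma mul_mchoose {m : ℕ} (α μ : Fin m →₀ ℕ) (j : Fin m) :
    α j * mchoose α μ = (μ j + 1) * mchoose α (μ + Finsupp.single j 1) + μ j * mchoose α μ := by
  unfold mchoose
  rw [← Finset.mul_prod_erase _ _ (Finset.mem_univ j),
    ← Finset.mul_prod_erase _ (fun i => (α i).choose ((μ + Finsupp.single j 1 : Fin m →₀ ℕ) i)) (Finset.mem_univ j)]
  have : ∏ x ∈ Finset.univ.erase j, (α x).choose ((μ + Finsupp.single j 1 : Fin m →₀ ℕ) x) =
      ∏ x ∈ Finset.univ.erase j, (α x).choose (μ x) := by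
    apply Finset.prod_congr rfl
    intro i hi
    have : j ≠ i := fun h => by simp [h] at hi
    simp [Finsupp.single_eq_of_ne this.symm]
  rw [this]
  simp only [Finsupp.add_apply, Finsupp.single_eq_same]
  have h1 : (α j).choose (μ j + 1) * (μ j + 1) = (α j).choose (μ j) * (α j - μ j) :=
    Nat.choose_succ_right_eq _ _
  have h2 : α j * (α j).choose (μ j) = (μ j + 1) * (α j).choose (μ j + 1) + μ j * (α j).choose (μ j) := by
    by_cases h : μ j ≤ α j
    · obtain ⟨d, hd⟩ := Nat.exists_eq_add_of_le h
      have : α j - μ j = d := by omega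
      rw [this] at h1
      rw [mul_comm (μ j + 1), h1]
      have h5 : α j * (α j).choose (μ j) = (μ j + d) * (α j).choose (μ j) := by rw [← hd]
      rw [h5]; ring
    · rw [Nat.choose_eq_zero_of_lt (by omega), Nat.choose_eq_zero_of_lt (by omega)]; simp
  rw [← mul_assoc, h2]; ring

lemma wt_pow_mem (F : Type*) [Field F] [CharZero F] {m : ℕ} (D : Fin m → ℕ) (a : ℕ) :
    (fun α : Fin m →₀ ℕ => ((∑ j, α j * D j : ℕ) : F) ^ a) ∈
      Submodule.span F ((fun (μ α : Fin m →₀ ℕ) => (mchoose α μ : F)) '' {μ | μ.degree ≤ a}) := by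
  induction a with
  | zero =>
    apply Submodule.subset_span
    refine ⟨0, by simp, ?_⟩
    ext α; simp [mchoose]
  | succ a ih =>
    let Mw : ((Fin m →₀ ℕ) → F) →ₗ[F] ((Fin m →₀ ℕ) → F) :=
      LinearMap.mulLeft F (fun α : Fin m →₀ ℕ => ((∑ j, α j * D j : ℕ) : F))
    have key : Submodule.span F ((fun (μ α : Fin m →₀ ℕ) => (mchoose α μ : F)) '' {μ | μ.degree ≤ a}) ≤
      (Submodule.span F ((fun (μ α : Fin m →₀ ℕ) => (mchoose α μ : F)) '' {μ | μ.degree ≤ a+1})).comap Mw := by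
      rw [Submodule.span_le]
      rintro _ ⟨μ, hμ, rfl⟩
      simp only [Set.mem_setOf_eq] at hμ
      have : Mw (fun α => (mchoose α μ : F)) = ∑ j, ((D j : F) * (μ j + 1)) • (fun α : Fin m →₀ ℕ => (mchoose α (μ + Finsupp.single j 1) : F)) +
         ∑ j, ((D j : F) * (μ j)) • (fun α : Fin m →₀ ℕ => (mchoose α μ : F)) := by
        ext α
        simp only [Mw, LinearMap.mulLeft_apply, Pi.mul_apply, Pi.add_apply, Finset.sum_apply,
          Pi.smul_apply, smul_eq_mul]
        rw [← Finset.sum_add_distrib]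
        push_cast
        rw [Finset.sum_mul]
        apply Finset.sum_congr rfl
        intro j _
        have := congrArg (Nat.cast (R := F)) (mul_mchoose α μ j)
        push_cast at this
        linear_combination (D j : F) * this
      rw [SetLike.mem_coe, Submodule.mem_comap, this]
      apply Submodule.add_mem
      · apply Submodule.sum_mem; intro j _
        apply Submodule.smul_mem
        apply Submodule.subset_span
        exact ⟨_, by simpa using hμ, rfl⟩
      · apply Submodule.sum_mem; intro j _
        apply Submodule.smul_mem
        apply Submodule.subset_span
        exact ⟨μ, by simp only [Set.mem_setOf_eq]; omega, rfl⟩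
    have := key ih
    rw [Submodule.mem_comap] at this
    convert this using 1
    ext α
    simp only [Mw, LinearMap.mulLeft_apply, Pi.mul_apply]
    rw [pow_succ']

/-- Generalized Wronskian -/
theorem GW {m k : ℕ} (f : Fin k → MvPolynomial (Fin m) F) (hf : LinearIndependent F f) :
    ∃ μ : Fin k → (Fin m →₀ ℕ), (∀ a, (μ a).degree < k) ∧
      (Matrix.of fun a l => Del (μ a) (f l)).det ≠ 0 := by
  classical
  by_contra hcon
  push Not at hcon
  obtain ⟨D, hD⟩ := exists_weights (Finset.univ.biUnion fun l => (f l).support)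
  let κ : MvPolynomial (Fin m) F →ₐ[F] Polynomial F := aeval fun j => Polynomial.X ^ (D j)
  have hκm : ∀ α c, κ (monomial α c) = Polynomial.monomial (∑ j, α j * D j) c := by
    intro α c
    simp only [κ, aeval_monomial]
    rw [Finsupp.prod_fintype _ _ (by simp), ← Polynomial.C_mul_X_pow_eq_monomial]
    simp only [← pow_mul]
    rw [Finset.prod_pow_eq_pow_sum]
    simp_rw [mul_comm (D _)]
    rfl
  let wt : (Fin m →₀ ℕ) → F := fun α => ((∑ j, α j * D j : ℕ) : F)
  have hκD : ∀ (a : ℕ) (p : MvPolynomial (Fin m) F), κ (Dg (fun α => wt α ^ a) p) = th^[a] (κ p) := by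
    intro a p
    induction p using MvPolynomial.induction_on' with
    | monomial u c =>
      rw [Dg_monomial, hκm, hκm]
      ext n
      rw [coeff_th_iter, Polynomial.coeff_monomial, Polynomial.coeff_monomial]
      split_ifs with h
      · simp only [wt]; rw [h]
      · simp
    | add p q hp hq =>
      rw [map_add, map_add, hp, hq, map_add]
      ext n
      rw [Polynomial.coeff_add]
      simp only [coeff_th_iter, Polynomial.coeff_add]; ring
  have hind : LinearIndependent F (fun l => κ (f l)) := by
    rw [Fintype.linearIndependent_iff] at hf ⊢
    intro b hb
    apply hf
    have hb' : κ (∑ l, b l • f l) = 0 := by rw [map_sum, ← hb]; simp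
    set G := ∑ l, b l • f l with hG
    have hsupp : G.support ⊆ Finset.univ.biUnion fun l => (f l).support := by
      intro α hα
      rw [mem_support_iff] at hα
      rw [Finset.mem_biUnion]
      by_contra hn
      push Not at hn
      apply hα
      rw [hG, coeff_sum]
      apply Finset.sum_eq_zero; intro l _
      have := hn l (Finset.mem_univ _)
      rw [notMem_support_iff] at this
      simp [this]
    ext α
    rw [coeff_zero]
    by_contra hα
    have hαs : α ∈ G.support := mem_support_iff.2 hα
    have h2 : (κ G).coeff (∑ j, α j * D j) = coeff α G := by
      conv_lhs => rw [G.as_sum, map_sum]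
      simp_rw [hκm]
      rw [Polynomial.finsetSum_coeff, Finset.sum_eq_single α]
      · simp
      · intro β hβ hne
        rw [Polynomial.coeff_monomial, if_neg]
        intro h
        exact hne (hD (hsupp hβ) (hsupp hαs) h)
      · intro h; exact absurd hαs h
    rw [hb', Polynomial.coeff_zero] at h2
    exact hα h2.symm
  apply wronsk_uni _ hind
  have hdet : (Matrix.of fun a l : Fin k => th^[(a:ℕ)] (κ (f l))) =
      κ.toRingHom.mapMatrix (Matrix.of fun a l : Fin k => Dg (fun α => wt α ^ (a:ℕ)) (f l)) := by
    ext1 a l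
    simp [← hκD]
  rw [hdet, ← RingHom.map_det]
  suffices h : (Matrix.of fun a l : Fin k => Dg (fun α => wt α ^ (a:ℕ)) (f l)).det = 0 by
    rw [h, map_zero]
  -- finite index set
  have hfin : {μ : Fin m →₀ ℕ | μ.degree ≤ k - 1}.Finite := Finsupp.finite_of_degree_le _
  have hexp : ∀ a : Fin k, ∃ c : {μ // μ ∈ hfin.toFinset} → F,
      ∑ μ, c μ • (fun α => (mchoose α μ.1 : F)) = (fun α => wt α ^ (a:ℕ)) := by
    intro a
    have h1 := wt_pow_mem F D (a:ℕ)
    have h2 : (fun α => wt α ^ (a:ℕ)) ∈ Submodule.span F (Set.range fun (μ : {μ // μ ∈ hfin.toFinset}) =>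
        (fun α => (mchoose α μ.1 : F))) := by
      refine Submodule.span_mono ?_ h1
      rintro _ ⟨μ, hμ, rfl⟩
      refine ⟨⟨μ, ?_⟩, rfl⟩
      simp only [Set.mem_setOf_eq] at hμ
      simp only [Set.Finite.mem_toFinset, Set.mem_setOf_eq]
      have := a.2
      omega
    exact (Submodule.mem_span_range_iff_exists_fun F).1 h2
  choose c hc using hexp
  have hrow : (Matrix.of fun a l : Fin k => Dg (fun α => wt α ^ (a:ℕ)) (f l)) =
      fun a => ∑ μ : {μ // μ ∈ hfin.toFinset}, (C (c a μ) * monomial μ.1 1) • (fun l => Del μ.1 (f l)) := by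
    funext a l
    simp only [Matrix.of_apply, Finset.sum_apply, Pi.smul_apply, smul_eq_mul]
    simp_rw [mul_assoc, X_mul_Del]
    ext β
    rw [coeff_Dg, coeff_sum, show wt β ^ (a:ℕ) = (fun α => wt α ^ (a:ℕ)) β from rfl, ← hc]
    simp only [coeff_C_mul, coeff_Dg, Finset.sum_apply, Pi.smul_apply, smul_eq_mul]
    rw [Finset.sum_mul]
    apply Finset.sum_congr rfl; intro μ _; ring
  rw [hrow]
  change Matrix.detRowAlternating.toMultilinearMap _ = 0
  rw [MultilinearMap.map_sum]
  apply Finset.sum_eq_zero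
  intro r _
  rw [MultilinearMap.map_smul_univ]
  have := hcon (fun a => (r a).1) (by
    intro a
    have h1 := (r a).2
    simp only [Set.Finite.mem_toFinset, Set.mem_setOf_eq] at h1
    have := a.2
    omega)
  rw [show (Matrix.detRowAlternating.toMultilinearMap fun i l => Del (r i).1 (f l)) = 0 from this, smul_zero]
end multi
end MLT

set_option linter.unusedSectionVars false
namespace MLT
open MvPolynomial

section n1
variable {σ : Type*}

/-- l1 norm of an integral polynomial -/
noncomputable def n1 (p : MvPolynomial σ ℤ) : ℝ := ∑ α ∈ p.support, |((coeff α p : ℤ) : ℝ)|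

lemma n1_eq (p : MvPolynomial σ ℤ) (s : Finset (σ →₀ ℕ)) (h : p.support ⊆ s) :
    n1 p = ∑ α ∈ s, |((coeff α p : ℤ) : ℝ)| := by
  apply Finset.sum_subset h
  intro α _ hα
  rw [notMem_support_iff] at hα
  simp [hα]

lemma n1_nonneg (p : MvPolynomial σ ℤ) : 0 ≤ n1 p := Finset.sum_nonneg fun _ _ => abs_nonneg _

lemma n1_zero : n1 (0 : MvPolynomial σ ℤ) = 0 := by simp [n1]

lemma coeff_le_n1 (p : MvPolynomial σ ℤ) (α : σ →₀ ℕ) : |((coeff α p : ℤ) : ℝ)| ≤ n1 p := by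
  classical
  rw [n1_eq p (insert α p.support) (Finset.subset_insert _ _)]
  exact Finset.single_le_sum (f := fun α => |((coeff α p : ℤ) : ℝ)|) (fun _ _ => abs_nonneg _) (Finset.mem_insert_self _ _)

lemma one_le_n1 {p : MvPolynomial σ ℤ} (hp : p ≠ 0) : 1 ≤ n1 p := by
  obtain ⟨α, hα⟩ := ne_zero_iff.1 hp
  refine le_trans ?_ (coeff_le_n1 p α)
  exact_mod_cast Int.one_le_abs hα

lemma n1_add (p q : MvPolynomial σ ℤ) : n1 (p + q) ≤ n1 p + n1 q := by
  classical
  rw [n1_eq (p+q) (p.support ∪ q.support) support_add, n1_eq p (p.support ∪ q.support) Finset.subset_union_left,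
    n1_eq q (p.support ∪ q.support) Finset.subset_union_right, ← Finset.sum_add_distrib]
  apply Finset.sum_le_sum
  intro α _
  rw [coeff_add]; push_cast
  exact abs_add_le _ _

lemma n1_sum {ι : Type*} (s : Finset ι) (f : ι → MvPolynomial σ ℤ) :
    n1 (∑ i ∈ s, f i) ≤ ∑ i ∈ s, n1 (f i) := by
  classical
  induction s using Finset.induction_on with
  | empty => simp [n1_zero]
  | insert a s ha ih => rw [Finset.sum_insert ha, Finset.sum_insert ha]; exact (n1_add _ _).trans (by gcongr)

lemma n1_monomial (α : σ →₀ ℕ) (c : ℤ) : n1 (monomial α c) ≤ |(c:ℝ)| := by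
  classical
  rw [n1_eq _ {α} support_monomial_subset]
  simp

lemma n1_mul (p q : MvPolynomial σ ℤ) : n1 (p * q) ≤ n1 p * n1 q := by
  conv_lhs => rw [p.as_sum, q.as_sum, Finset.sum_mul_sum]
  refine (n1_sum _ _).trans ?_
  rw [n1, n1, Finset.sum_mul_sum]
  apply Finset.sum_le_sum; intro α _
  refine (n1_sum _ _).trans ?_
  apply Finset.sum_le_sum; intro β _
  rw [monomial_mul]
  refine (n1_monomial _ _).trans ?_
  rw [Int.cast_mul, abs_mul]

lemma n1_one : n1 (1 : MvPolynomial σ ℤ) ≤ 1 := by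
  have := n1_monomial (σ := σ) 0 1
  simpa using this

lemma n1_prod {ι : Type*} (s : Finset ι) (f : ι → MvPolynomial σ ℤ) :
    n1 (∏ i ∈ s, f i) ≤ ∏ i ∈ s, n1 (f i) := by
  classical
  induction s using Finset.induction_on with
  | empty => simpa using n1_one
  | insert a s ha ih =>
    rw [Finset.prod_insert ha, Finset.prod_insert ha]
    exact (n1_mul _ _).trans (by gcongr; exact n1_nonneg _)

lemma n1_neg (p : MvPolynomial σ ℤ) : n1 (-p) = n1 p := by
  simp [n1, support_neg]

lemma n1_det {k : ℕ} (M : Matrix (Fin k) (Fin k) (MvPolynomial σ ℤ)) (B : ℝ)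
    (h : ∀ i j, n1 (M i j) ≤ B) : n1 M.det ≤ k.factorial * B ^ k := by
  rw [Matrix.det_apply]
  refine (n1_sum _ _).trans ?_
  calc ∑ τ : Equiv.Perm (Fin k), n1 (Equiv.Perm.sign τ • ∏ i, M (τ i) i)
      ≤ ∑ τ : Equiv.Perm (Fin k), B ^ k := by
        apply Finset.sum_le_sum
        intro τ _
        have h1 : n1 (Equiv.Perm.sign τ • ∏ i, M (τ i) i) = n1 (∏ i, M (τ i) i) := by
          rcases Int.units_eq_one_or (Equiv.Perm.sign τ) with h | h <;> rw [h]
          · simp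
          · simp [n1_neg]
        rw [h1]
        refine (n1_prod _ _).trans ?_
        calc ∏ i, n1 (M (τ i) i) ≤ ∏ i : Fin k, B :=
              Finset.prod_le_prod (fun _ _ => n1_nonneg _) (fun i _ => h _ _)
          _ = B ^ k := by simp
    _ = k.factorial * B ^ k := by simp [Fintype.card_perm]

lemma n1_Del {m : ℕ} (μ : Fin m →₀ ℕ) (p : MvPolynomial (Fin m) ℤ) (N : ℕ)
    (h : ∀ α ∈ p.support, ∑ j, α j ≤ N) : n1 (Del μ p) ≤ 2 ^ N * n1 p := by
  conv_lhs => rw [p.as_sum, map_sum]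
  refine (n1_sum _ _).trans ?_
  rw [n1, Finset.mul_sum]
  apply Finset.sum_le_sum
  intro α hα
  rw [Del_monomial]
  refine (n1_monomial _ _).trans ?_
  rw [Int.cast_mul, abs_mul]
  gcongr
  have : mchoose α μ ≤ 2 ^ N := by
    calc mchoose α μ ≤ ∏ j, 2 ^ (α j) := Finset.prod_le_prod (fun _ _ => Nat.zero_le _) (fun j _ => Nat.choose_le_two_pow _ _)
      _ = 2 ^ (∑ j, α j) := by rw [Finset.prod_pow_eq_pow_sum]
      _ ≤ 2 ^ N := Nat.pow_le_pow_right (by norm_num) (h α hα)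
  push_cast
  rw [abs_of_nonneg (by positivity)]
  exact_mod_cast this
end n1

section index
variable {m : ℕ} {K : Type*} [CommRing K]

/-- weight of an exponent -/
def wsum (w : Fin m → ℝ) (I : Fin m →₀ ℕ) : ℝ := ∑ j, (I j : ℝ) * w j

lemma wsum_add (w : Fin m → ℝ) (I J : Fin m →₀ ℕ) : wsum w (I + J) = wsum w I + wsum w J := by
  simp [wsum, add_mul, Finset.sum_add_distrib]

lemma wsum_nonneg {w : Fin m → ℝ} (hw : ∀ j, 0 ≤ w j) (I : Fin m →₀ ℕ) : 0 ≤ wsum w I :=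
  Finset.sum_nonneg fun j _ => mul_nonneg (by positivity) (hw j)

/-- index at the origin at least `t` -/
def IndGe (w : Fin m → ℝ) (t : ℝ) (Q : MvPolynomial (Fin m) K) : Prop :=
  ∀ I, coeff I Q ≠ 0 → t ≤ wsum w I

lemma IndGe.mul {w : Fin m → ℝ} {s t : ℝ} {P Q : MvPolynomial (Fin m) K} (hP : IndGe w s P)
    (hQ : IndGe w t Q) : IndGe w (s + t) (P * Q) := by
  classical
  intro I hI
  rw [coeff_mul] at hI
  obtain ⟨x, hx, hx0⟩ := Finset.exists_ne_zero_of_sum_ne_zero hI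
  rw [Finset.HasAntidiagonal.mem_antidiagonal] at hx
  rw [← hx, wsum_add]
  exact add_le_add (hP _ (left_ne_zero_of_mul hx0)) (hQ _ (right_ne_zero_of_mul hx0))

lemma IndGe.one {w : Fin m → ℝ} : IndGe w 0 (1 : MvPolynomial (Fin m) K) := by
  classical
  intro I hI
  rw [coeff_one] at hI
  have : I = 0 := by by_contra h; exact hI (if_neg fun h' => h h'.symm)
  simp [this, wsum]

lemma IndGe.prod {w : Fin m → ℝ} {ι : Type*} (s : Finset ι) (t : ι → ℝ)
    (P : ι → MvPolynomial (Fin m) K) (hP : ∀ i, IndGe w (t i) (P i)) :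
    IndGe w (∑ i ∈ s, t i) (∏ i ∈ s, P i) := by
  classical
  induction s using Finset.induction_on with
  | empty => simpa using IndGe.one
  | insert a s ha ih => rw [Finset.prod_insert ha, Finset.sum_insert ha]; exact (hP a).mul ih

lemma IndGe.det {w : Fin m → ℝ} {k : ℕ} (t : Fin k → ℝ)
    (M : Matrix (Fin k) (Fin k) (MvPolynomial (Fin m) K)) (hM : ∀ a b, IndGe w (t b) (M a b)) :
    IndGe w (∑ b, t b) M.det := by
  intro I hI
  rw [Matrix.det_apply, coeff_sum] at hI
  obtain ⟨τ, -, hτ⟩ := Finset.exists_ne_zero_of_sum_ne_zero hI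
  apply IndGe.prod Finset.univ t (fun i => M (τ i) i) (fun i => hM _ _) I
  intro h0
  apply hτ
  rcases Int.units_eq_one_or (Equiv.Perm.sign τ) with h | h <;> rw [h]
  · simpa using h0
  · simpa using h0

lemma IndGe.mono {w : Fin m → ℝ} {s t : ℝ} (h : s ≤ t) {P : MvPolynomial (Fin m) K}
    (hP : IndGe w t P) : IndGe w s P := fun I hI => h.trans (hP I hI)

lemma IndGe.del {w : Fin m → ℝ} {t : ℝ} {P : MvPolynomial (Fin m) K}
    (hP : IndGe w t P) (μ : Fin m →₀ ℕ) : IndGe w (t - wsum w μ) (Del μ P) := by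
  intro I hI
  rw [coeff_Del] at hI
  have := hP _ (right_ne_zero_of_mul hI)
  rw [wsum_add] at this
  linarith
end index

section box
variable {m : ℕ} {R : Type*} [CommRing R]

/-- product in separated variables -/
noncomputable def bx (f : MvPolynomial (Fin m) R) (g : MvPolynomial (Fin 1) R) :
    MvPolynomial (Fin (m+1)) R :=
  rename Fin.succ f * rename (fun _ => 0) g

lemma bx_monomial (α : Fin m →₀ ℕ) (β : Fin 1 →₀ ℕ) (c d : R) :
    bx (monomial α c) (monomial β d) = monomial (Finsupp.cons (β 0) α) (c * d) := by
  rw [bx, rename_monomial, rename_monomial, monomial_mul]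
  congr 2
  ext j
  refine Fin.cases ?_ (fun i => ?_) j
  · rw [Finsupp.add_apply, Finsupp.cons_zero, Finsupp.mapDomain_notin_range _ _ (by simp)]
    have : β = Finsupp.single 0 (β 0) := Finsupp.ext fun i => by rw [Subsingleton.elim i 0]; simp
    rw [this, Finsupp.mapDomain_single]; simp
  · rw [Finsupp.add_apply, Finsupp.cons_succ, Finsupp.mapDomain_apply (Fin.succ_injective _),
      Finsupp.mapDomain_notin_range _ _ (by simp [Fin.succ_ne_zero]), add_zero]

lemma bx_add_left (f f' : MvPolynomial (Fin m) R) (g : MvPolynomial (Fin 1) R) :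
    bx (f + f') g = bx f g + bx f' g := by simp [bx, add_mul]
lemma bx_add_right (f : MvPolynomial (Fin m) R) (g g' : MvPolynomial (Fin 1) R) :
    bx f (g + g') = bx f g + bx f g' := by simp [bx, mul_add]

lemma coeff_bx (f : MvPolynomial (Fin m) R) (g : MvPolynomial (Fin 1) R) (b : ℕ) (β : Fin m →₀ ℕ) :
    coeff (Finsupp.cons b β) (bx f g) = coeff β f * coeff (Finsupp.single 0 b) g := by
  classical
  induction f using MvPolynomial.induction_on' with
  | add p q hp hq => rw [bx_add_left, coeff_add, hp, hq, coeff_add, add_mul]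
  | monomial u c =>
    induction g using MvPolynomial.induction_on' with
    | add p q hp hq => rw [bx_add_right, coeff_add, hp, hq, coeff_add, mul_add]
    | monomial v d =>
      rw [bx_monomial, coeff_monomial, coeff_monomial, coeff_monomial]
      have hv : v = Finsupp.single 0 (v 0) := Finsupp.ext fun i => by rw [Subsingleton.elim i 0]; simp
      by_cases h1 : u = β
      · by_cases h2 : v = Finsupp.single 0 b
        · rw [if_pos h1, if_pos h2, if_pos]; rw [h1, h2]; simp
        · rw [if_pos h1, if_neg h2, if_neg, mul_zero]
          intro h; apply h2; rw [hv]
          have := congrArg (fun x => x 0) h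
          simp only [Finsupp.cons_zero] at this
          rw [this]
      · rw [if_neg h1, if_neg, zero_mul]
        intro h; apply h1
        have := congrArg Finsupp.tail h
        simpa using this

lemma mchoose_cons (b c : ℕ) (α μ : Fin m →₀ ℕ) :
    mchoose (Finsupp.cons b α) (Finsupp.cons c μ) = b.choose c * mchoose α μ := by
  unfold mchoose
  rw [Fin.prod_univ_succ]; simp

lemma cons_add' (b c : ℕ) (α μ : Fin m →₀ ℕ) :
    Finsupp.cons b α + Finsupp.cons c μ = Finsupp.cons (b + c) (α + μ) := by
  ext j; refine Fin.cases ?_ (fun i => ?_) j <;> simp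

lemma bx_ext {p q : MvPolynomial (Fin (m+1)) R}
    (h : ∀ b β, coeff (Finsupp.cons b β) p = coeff (Finsupp.cons b β) q) : p = q := by
  ext I; rw [← Finsupp.cons_tail I]; exact h _ _

lemma Del_bx (f : MvPolynomial (Fin m) R) (g : MvPolynomial (Fin 1) R) (μ : Fin m →₀ ℕ) (c : ℕ) :
    Del (Finsupp.cons c μ) (bx f g) = bx (Del μ f) (Del (Finsupp.single 0 c) g) := by
  apply bx_ext; intro b β
  rw [coeff_Del, cons_add', coeff_bx, coeff_bx, coeff_Del, coeff_Del, mchoose_cons,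
    ← Finsupp.single_add]
  have : mchoose (Finsupp.single (0 : Fin 1) (b+c)) (Finsupp.single 0 c) = (b+c).choose c := by
    simp [mchoose]
  rw [this]; push_cast; ring

lemma tr_bx (ξ : Fin (m+1) → R) (f : MvPolynomial (Fin m) R) (g : MvPolynomial (Fin 1) R) :
    tr ξ (bx f g) = bx (tr (fun j => ξ j.succ) f) (tr (fun _ => ξ 0) g) := by
  have h1 : (tr ξ).comp (rename Fin.succ) = (rename Fin.succ).comp (tr (fun j : Fin m => ξ j.succ)) := by
    ext j; simp [tr]
  have h2 : (tr ξ).comp (rename (fun _ : Fin 1 => (0 : Fin (m+1)))) =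
      (rename (fun _ => 0)).comp (tr (fun _ => ξ 0)) := by
    ext j; simp [tr]
  rw [bx, map_mul]
  exact congrArg₂ (· * ·) (DFunLike.congr_fun h1 f) (DFunLike.congr_fun h2 g)

lemma det_bx {k : ℕ} (A : Matrix (Fin k) (Fin k) (MvPolynomial (Fin m) R))
    (B : Matrix (Fin k) (Fin k) (MvPolynomial (Fin 1) R)) :
    (Matrix.of fun a b => ∑ l, bx (A a l) (B b l)).det = bx A.det B.det := by
  have : (Matrix.of fun a b => ∑ l, bx (A a l) (B b l)) =
     ((rename Fin.succ).toRingHom.mapMatrix A) * ((rename (fun _ => (0 : Fin (m+1)))).toRingHom.mapMatrix B).transpose := by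
    ext1 a b
    simp [Matrix.mul_apply, bx]
  rw [this, Matrix.det_mul, Matrix.det_transpose, ← RingHom.map_det, ← RingHom.map_det]
  rfl
end box

section factor
variable {F M N P : Type*} [Field F] [AddCommGroup M] [AddCommGroup N] [AddCommGroup P]
  [Module F M] [Module F N] [Module F P]

lemma indep_of_min (B : M →ₗ[F] N →ₗ[F] P) (p : P) (k : ℕ) (f : Fin k → M) (g : Fin k → N)
    (hp : p = ∑ l, B (f l) (g l))
    (hmin : ∀ k' < k, ∀ (f : Fin k' → M) (g : Fin k' → N), p ≠ ∑ l, B (f l) (g l)) :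
    LinearIndependent F f := by
  by_contra hdep
  rw [Fintype.not_linearIndependent_iff] at hdep
  obtain ⟨b, hb, l0, hl0⟩ := hdep
  cases k with
  | zero => exact l0.elim0
  | succ k =>
    apply hmin k (Nat.lt_succ_self k) (fun i => f (l0.succAbove i))
      (fun i => g (l0.succAbove i) - (b (l0.succAbove i) / b l0) • g l0)
    rw [Fin.sum_univ_succAbove _ l0] at hb hp
    have hf : f l0 = - ∑ i, (b (l0.succAbove i) / b l0) • f (l0.succAbove i) := by
      have : b l0 • f l0 = - ∑ i, b (l0.succAbove i) • f (l0.succAbove i) := eq_neg_of_add_eq_zero_left hb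
      rw [← inv_smul_smul₀ hl0 (f l0), this, smul_neg, Finset.smul_sum]
      congr 1
      apply Finset.sum_congr rfl; intro i _
      rw [smul_smul]; congr 1; field_simp
    rw [hp, hf]
    simp only [map_neg, map_sum, map_sub, map_smul, LinearMap.neg_apply, LinearMap.sum_apply,
      LinearMap.smul_apply, Finset.sum_sub_distrib]
    abel

lemma exists_min_factor (B : M →ₗ[F] N →ₗ[F] P) (p : P) (k0 : ℕ) (f : Fin k0 → M) (g : Fin k0 → N)
    (hp : p = ∑ l, B (f l) (g l)) :
    ∃ k ≤ k0, ∃ (f : Fin k → M) (g : Fin k → N), p = ∑ l, B (f l) (g l) ∧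
      LinearIndependent F f ∧ LinearIndependent F g := by
  classical
  have hex : ∃ k, ∃ (f : Fin k → M) (g : Fin k → N), p = ∑ l, B (f l) (g l) := ⟨k0, f, g, hp⟩
  obtain ⟨f', g', h'⟩ := Nat.find_spec hex
  have hmin : ∀ k' < Nat.find hex, ∀ (f : Fin k' → M) (g : Fin k' → N), p ≠ ∑ l, B (f l) (g l) :=
    fun k' hk' f g h => Nat.find_min hex hk' ⟨f, g, h⟩
  refine ⟨Nat.find hex, Nat.find_min' hex ⟨f, g, hp⟩, f', g', h', ?_, ?_⟩
  · exact indep_of_min B p _ f' g' h' hmin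
  · exact indep_of_min B.flip p _ g' f' (by simpa using h') (fun k' hk' g f h => hmin k' hk' f g (by simpa using h))

/-- box as bilinear map -/
noncomputable def bxL (m : ℕ) : MvPolynomial (Fin m) F →ₗ[F] MvPolynomial (Fin 1) F →ₗ[F]
    MvPolynomial (Fin (m+1)) F :=
  LinearMap.mk₂ F bx bx_add_left (by intro c f g; simp [bx]) bx_add_right (by intro c f g; simp [bx])

theorem poly_factor {m : ℕ} (p : MvPolynomial (Fin (m+1)) F) (r : ℕ) (hr : degreeOf 0 p ≤ r) :
    ∃ k ≤ r + 1, ∃ (f : Fin k → MvPolynomial (Fin m) F) (g : Fin k → MvPolynomial (Fin 1) F),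
      p = ∑ l, bx (f l) (g l) ∧ LinearIndependent F f ∧ LinearIndependent F g := by
  classical
  have h0 : p = ∑ l : Fin (r+1), bx ((finSuccEquiv F m p).coeff l) (monomial (Finsupp.single 0 (l:ℕ)) 1) := by
    apply bx_ext; intro b β
    rw [coeff_sum]
    simp_rw [coeff_bx, finSuccEquiv_coeff_coeff, coeff_monomial]
    by_cases hb : b < r + 1
    · rw [Finset.sum_eq_single ⟨b, hb⟩]
      · simp
      · intro c _ hc
        rw [if_neg, mul_zero]
        intro h
        have := congrArg (fun x => x 0) h
        simp at this
        exact hc (Fin.ext this)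
      · simp
    · rw [Finset.sum_eq_zero]
      · by_contra hne
        have h1 := monomial_le_degreeOf 0 (mem_support_iff.2 hne)
        rw [Finsupp.cons_zero] at h1
        omega
      · intro c _
        rw [if_neg, mul_zero]
        intro h
        have := congrArg (fun x => x 0) h
        simp at this
        have := c.2
        omega
  exact exists_min_factor (bxL m) p (r+1) _ _ h0
end factor
end MLT

set_option linter.unusedSectionVars false
namespace MLT
open MvPolynomial

section slices
variable {σ τ : Type*}

lemma n1_slice (p : MvPolynomial σ ℤ) (q : MvPolynomial τ ℤ) (φ : (τ →₀ ℕ) → (σ →₀ ℕ))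
    (hφ : Function.Injective φ) (h : ∀ α, coeff α q = coeff (φ α) p) : n1 q ≤ n1 p := by
  classical
  have h1 : n1 q = ∑ α ∈ q.support.image φ, |((coeff α p : ℤ) : ℝ)| := by
    rw [Finset.sum_image (fun a _ b _ hab => hφ hab), n1]
    exact Finset.sum_congr rfl fun α _ => by rw [h]
  rw [h1, n1]
  apply Finset.sum_le_sum_of_subset_of_nonneg
  · intro α hα
    obtain ⟨β, hβ, rfl⟩ := Finset.mem_image.1 hα
    rw [mem_support_iff, h] at hβ
    exact mem_support_iff.2 hβ
  · intros; positivity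

lemma n1_slice_uni (p : MvPolynomial σ ℤ) (W : Polynomial ℤ) (φ : ℕ → (σ →₀ ℕ))
    (hφ : Function.Injective φ) (h : ∀ b, W.coeff b = coeff (φ b) p) :
    (W.sum fun _ a => |(a : ℝ)|) ≤ n1 p := by
  classical
  have h1 : (W.sum fun _ a => |(a : ℝ)|) = ∑ α ∈ W.support.image φ, |((coeff α p : ℤ) : ℝ)| := by
    rw [Finset.sum_image (fun a _ b _ hab => hφ hab), Polynomial.sum]
    exact Finset.sum_congr rfl fun α _ => by rw [h]
  rw [h1, n1]
  apply Finset.sum_le_sum_of_subset_of_nonneg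
  · intro α hα
    obtain ⟨β, hβ, rfl⟩ := Finset.mem_image.1 hα
    rw [Polynomial.mem_support_iff, h] at hβ
    exact mem_support_iff.2 hβ
  · intros; positivity

lemma exists_uni_slice {m : ℕ} (U : MvPolynomial (Fin (m+1)) ℤ) (β : Fin m →₀ ℕ) :
    ∃ W : Polynomial ℤ, ∀ b, W.coeff b = coeff (Finsupp.cons b β) U := by
  refine ⟨∑ b ∈ Finset.range (degreeOf 0 U + 1), Polynomial.monomial b (coeff (Finsupp.cons b β) U), ?_⟩
  intro b
  rw [Polynomial.finsetSum_coeff]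
  simp_rw [Polynomial.coeff_monomial]
  rw [Finset.sum_ite_eq']
  split_ifs with h
  · rfl
  · by_contra hne
    have h1 := monomial_le_degreeOf 0 (mem_support_iff.2 (Ne.symm hne))
    rw [Finsupp.cons_zero] at h1
    simp at h; omega

/-- to univariate -/
noncomputable def uni {K : Type*} [Field K] : MvPolynomial (Fin 1) K →ₐ[K] Polynomial K :=
  aeval (fun _ => Polynomial.X)

lemma coeff_uni {K : Type*} [Field K] (g : MvPolynomial (Fin 1) K) (b : ℕ) :
    (uni g).coeff b = coeff (Finsupp.single 0 b) g := by
  classical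
  induction g using MvPolynomial.induction_on' with
  | add p q hp hq => simp only [map_add, Polynomial.coeff_add, hp, hq, coeff_add]
  | monomial u c =>
    rw [uni, aeval_monomial, coeff_monomial]
    have hu : u = Finsupp.single 0 (u 0) := Finsupp.ext fun i => by rw [Subsingleton.elim i 0]; simp
    have h2 : (u.prod fun _ k => (Polynomial.X : Polynomial K) ^ k) = Polynomial.X ^ (u 0) := by
      conv_lhs => rw [hu]
      simp
    rw [h2, Polynomial.algebraMap_eq, Polynomial.coeff_C_mul_X_pow]
    by_cases h : b = u 0
    · rw [if_pos h, if_pos]; rw [h, ← hu]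
    · rw [if_neg h, if_neg]; intro h'; apply h; rw [h']; simp

lemma uni_tr {K : Type*} [Field K] (ξ : K) (g : MvPolynomial (Fin 1) K) :
    uni (tr (fun _ => ξ) g) = (uni g).comp (Polynomial.X + Polynomial.C ξ) := by
  have : (uni (K := K)).comp (tr (fun _ => ξ)) =
      (Polynomial.aeval (Polynomial.X + Polynomial.C ξ)).comp uni := by
    ext j : 1
    simp [uni, tr]
  have h2 := DFunLike.congr_fun this g
  simpa [Polynomial.comp, Polynomial.aeval_def] using h2

lemma exists_order {K : Type*} [Field K] (ξ : K) (g : MvPolynomial (Fin 1) K) (hg : g ≠ 0) :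
    ∃ e : ℕ, coeff (Finsupp.single 0 e) (tr (fun _ => ξ) g) ≠ 0 ∧
      (Polynomial.X - Polynomial.C ξ) ^ e ∣ uni g := by
  classical
  have hu : uni g ≠ 0 := by
    obtain ⟨u, hu⟩ := ne_zero_iff.1 hg
    intro h
    apply hu
    have hu' : u = Finsupp.single 0 (u 0) := Finsupp.ext fun i => by rw [Subsingleton.elim i 0]; simp
    rw [hu', ← coeff_uni, h]; simp
  have hc : (uni g).comp (Polynomial.X + Polynomial.C ξ) ≠ 0 := by
    rwa [Ne, Polynomial.comp_X_add_C_eq_zero_iff]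
  have hex : ∃ e, ((uni g).comp (Polynomial.X + Polynomial.C ξ)).coeff e ≠ 0 := by
    by_contra h; push Not at h; exact hc (Polynomial.ext (by simpa using h))
  refine ⟨Nat.find hex, ?_, ?_⟩
  · rw [← coeff_uni, uni_tr]; exact Nat.find_spec hex
  · rw [Polynomial.X_sub_C_pow_dvd_iff, Polynomial.X_pow_dvd_iff]
    intro d hd
    by_contra h
    exact Nat.find_min hex hd h
end slices

section core
variable {K : Type*} [Field K] [CharZero K]

lemma det_core {m : ℕ} (p : MvPolynomial (Fin (m+1)) ℤ) (hp : p ≠ 0) (r0 : ℕ) (hr : degreeOf 0 p ≤ r0) :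
    ∃ k : ℕ, 1 ≤ k ∧ k ≤ r0 + 1 ∧ ∃ (μ : Fin k → (Fin m →₀ ℕ)) (ν : Fin k → ℕ)
      (f : MvPolynomial (Fin m) K) (g : MvPolynomial (Fin 1) K),
      (∀ a, (μ a).degree < k) ∧ Function.Injective ν ∧ (∀ b, ν b < k) ∧ f ≠ 0 ∧ g ≠ 0 ∧
      map (Int.castRingHom K) (Matrix.of fun a b => Del (Finsupp.cons (ν b) (μ a)) p).det = bx f g := by
  set pK := map (Int.castRingHom K) p with hpK
  have hpK0 : pK ≠ 0 := by
    intro h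
    apply hp
    apply map_injective _ (RingHom.injective_int (Int.castRingHom K))
    rw [map_zero]; exact h
  have hd : degreeOf 0 pK ≤ r0 := by
    rw [degreeOf_le_iff] at hr ⊢
    intro α hα
    apply hr
    rw [mem_support_iff] at hα ⊢
    rw [hpK, coeff_map] at hα
    intro h; rw [h] at hα; simp at hα
  obtain ⟨k, hk, f, g, hfg, hf, hg⟩ := poly_factor pK r0 hd
  have hk1 : 1 ≤ k := by
    by_contra h
    have : k = 0 := by omega
    subst this
    apply hpK0; rw [hfg]; simp
  obtain ⟨μ, hμ, hA⟩ := GW f hf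
  obtain ⟨ν, hν, hB⟩ := GW g hg
  have hν0 : ∀ b, ν b = Finsupp.single 0 (ν b 0) := fun b =>
    Finsupp.ext fun i => by rw [Subsingleton.elim i 0]; simp
  refine ⟨k, hk1, hk, μ, fun b => ν b 0, _, _, hμ, ?_, ?_, hA, hB, ?_⟩
  · intro b b' hbb
    by_contra hne
    apply hB
    apply Matrix.det_zero_of_row_eq hne
    funext l
    simp only [Matrix.of_apply]
    rw [hν0 b, hν0 b']; simp only at hbb; rw [hbb]
  · intro b
    have := hν b
    rw [hν0 b, Finsupp.degree_single] at this
    exact this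
  · rw [← det_bx]
    rw [show map (Int.castRingHom K) (Matrix.of fun a b => Del (Finsupp.cons (ν b 0) (μ a)) p).det =
      (map (Int.castRingHom K)) (Matrix.of fun a b => Del (Finsupp.cons (ν b 0) (μ a)) p).det from rfl,
      RingHom.map_det]
    congr 1
    ext1 a b
    simp only [RingHom.mapMatrix_apply, Matrix.map_apply, Matrix.of_apply]
    rw [← Del_map, ← hpK, hfg, map_sum]
    apply Finset.sum_congr rfl; intro l _
    rw [Del_bx, ← hν0]
end core

lemma sum_max (k r0 : ℕ) (hr0 : 1 ≤ r0) (hk : k ≤ r0 + 1) (θ : ℝ) (h0 : 0 < θ) (h1 : θ ≤ 1) :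
    k * θ^2 / 4 ≤ ∑ i ∈ Finset.range k, max 0 (θ - i / r0) := by
  have hr : (1:ℝ) ≤ r0 := by exact_mod_cast hr0
  have key : ∀ j : ℕ, j ≤ k → ((j:ℝ) - 1) ≤ θ * r0 → j * θ / 2 ≤ ∑ i ∈ Finset.range k, max 0 (θ - i / r0) := by
    intro j hj hj1
    calc (j * θ / 2 : ℝ) ≤ ∑ i ∈ Finset.range j, (θ - i / r0) := by
          have hs : ∑ i ∈ Finset.range j, (i:ℝ) = j * (j - 1) / 2 := by
            clear hj hj1
            induction j with
            | zero => simp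
            | succ j ih => rw [Finset.sum_range_succ, ih]; push_cast; ring
          rw [Finset.sum_sub_distrib, ← Finset.sum_div, hs]
          simp only [Finset.sum_const, Finset.card_range, nsmul_eq_mul]
          have : (j * (j - 1) / 2 / r0 : ℝ) ≤ j * θ / 2 := by
            rw [div_le_iff₀ (by positivity)]
            nlinarith [(Nat.cast_nonneg j : (0:ℝ) ≤ j)]
          linarith
      _ ≤ ∑ i ∈ Finset.range j, max 0 (θ - i / r0) := Finset.sum_le_sum fun i _ => le_max_right _ _
      _ ≤ _ := Finset.sum_le_sum_of_subset_of_nonneg (Finset.range_subset_range.2 hj) (fun _ _ _ => le_max_left _ _)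
  have hk' : (k:ℝ) ≤ r0 + 1 := by exact_mod_cast hk
  by_cases hc : ((k:ℝ) - 1) ≤ θ * r0
  · refine le_trans ?_ (key k le_rfl hc)
    nlinarith [(Nat.cast_nonneg k : (0:ℝ) ≤ k), mul_nonneg (Nat.cast_nonneg k : (0:ℝ) ≤ k) (mul_nonneg h0.le (by linarith : (0:ℝ) ≤ 1 - θ)), mul_nonneg (Nat.cast_nonneg k : (0:ℝ) ≤ k) h0.le]
  · push Not at hc
    have hfl := Nat.floor_le (by positivity : 0 ≤ θ * r0)
    have hfl2 := Nat.lt_floor_add_one (θ * r0)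
    have hjk : ⌊θ * r0⌋₊ + 1 ≤ k := by
      have : ((⌊θ * r0⌋₊ : ℝ)) < k - 1 := by linarith
      have h3 : ((⌊θ * r0⌋₊ + 1 : ℕ) : ℝ) < k := by push_cast; linarith
      exact_mod_cast h3.le
    refine le_trans ?_ (key (⌊θ * r0⌋₊ + 1) hjk (by push_cast; linarith))
    push_cast
    nlinarith [mul_nonneg h0.le h0.le, mul_le_mul_of_nonneg_left hfl2.le h0.le]

lemma cons_inj_right {m : ℕ} (b : ℕ) : Function.Injective (fun β : Fin m →₀ ℕ => Finsupp.cons b β) := by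
  intro β β' h
  have := congrArg Finsupp.tail h
  simpa using this

lemma cons_inj_left {m : ℕ} (β : Fin m →₀ ℕ) : Function.Injective (fun b : ℕ => Finsupp.cons b β) := by
  intro b b' h
  have := congrArg (fun x => x 0) h
  simpa using this

lemma sum_inj_range (k : ℕ) (ν : Fin k → ℕ) (hν : Function.Injective ν) (hk : ∀ b, ν b < k) (F : ℕ → ℝ) :
    ∑ b, F (ν b) = ∑ i ∈ Finset.range k, F i := by
  classical
  rw [← Finset.sum_image (s := Finset.univ) (g := ν) (f := F) (fun a _ b _ h => hν h)]
  congr 1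
  apply Finset.eq_of_subset_of_card_le
  · intro x hx
    obtain ⟨b, -, rfl⟩ := Finset.mem_image.1 hx
    exact Finset.mem_range.2 (hk b)
  · rw [Finset.card_image_of_injective _ hν]; simp

section RL
open NumberField
variable {K : Type*} [Field K] [NumberField K]

lemma n1_core {m k : ℕ} (p : MvPolynomial (Fin (m+1)) ℤ) (r : Fin (m+1) → ℕ) (R L : ℝ)
    (hp : p ≠ 0) (hdeg : ∀ j, degreeOf j p ≤ r j) (hk1 : 1 ≤ k) (hk : k ≤ r 0 + 1)
    (hR : ∀ j, (r j : ℝ) ≤ R) (hL : Real.log (n1 p) ≤ L)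
    (e : Fin k → Fin k → (Fin (m+1) →₀ ℕ)) (hU : (Matrix.of fun a b => Del (e a b) p).det ≠ 0) :
    Real.log (n1 (Matrix.of fun a b => Del (e a b) p).det) ≤ k * ((m + 2) * R + L) := by
  have hn := one_le_n1 hp
  have hsum : ∀ α ∈ p.support, ∑ j, α j ≤ ∑ j, r j := fun α hα =>
    Finset.sum_le_sum fun j _ => (monomial_le_degreeOf j hα).trans (hdeg j)
  have h1 := n1_det (Matrix.of fun a b => Del (e a b) p) (2 ^ (∑ j, r j) * n1 p)
    (fun a b => n1_Del _ _ _ hsum)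
  have h2 : (k.factorial : ℝ) ≤ (k:ℝ) ^ k := by exact_mod_cast Nat.factorial_le_pow k
  have h3 : n1 (Matrix.of fun a b => Del (e a b) p).det ≤ ((k:ℝ) * (2 ^ (∑ j, r j) * n1 p)) ^ k := by
    rw [mul_pow]
    refine h1.trans ?_
    gcongr
  have hk0 : (0:ℝ) < k := by exact_mod_cast hk1
  have h4 := Real.log_le_log (by linarith [one_le_n1 hU]) h3
  rw [Real.log_pow, Real.log_mul hk0.ne' (by positivity), Real.log_mul (by positivity) (by positivity), Real.log_pow] at h4
  refine h4.trans (mul_le_mul_of_nonneg_left ?_ hk0.le)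
  have h5 : Real.log k ≤ k - 1 := Real.log_le_sub_one_of_pos hk0
  have h6 : (k : ℝ) ≤ r 0 + 1 := by exact_mod_cast hk
  have h7 : ((∑ j, r j : ℕ) : ℝ) ≤ (m+1) * R := by
    push_cast
    calc ∑ j, (r j : ℝ) ≤ ∑ j : Fin (m+1), R := Finset.sum_le_sum fun j _ => hR j
      _ = _ := by simp
  have h8 : Real.log 2 ≤ 1 := by linarith [Real.log_two_lt_d9]
  have h9 : 0 ≤ ((∑ j, r j : ℕ) : ℝ) := by positivity
  have := hR 0
  nlinarith

theorem RL (S : Finset (FinitePlace K)) : ∀ m : ℕ, ∀ θ : ℝ, 0 < θ → ∃ ω : ℝ, 0 < ω ∧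
    ∀ (r : Fin m → ℕ) (ξ : Fin m → K) (p : MvPolynomial (Fin m) ℤ) (R L : ℝ), p ≠ 0 →
      (∀ j, degreeOf j p ≤ r j) → (∀ j, 1 ≤ r j) → (∀ i j, i < j → (r i : ℝ) ≤ ω * r j) →
      (∀ j, (r j : ℝ) ≤ R) → Real.log (n1 p) ≤ L → (∀ j, L + R ≤ ω * r j * hS S (ξ j)) →
      ∃ I, coeff I (tr ξ (map (Int.castRingHom K) p)) ≠ 0 ∧ ∑ j, (I j : ℝ) / r j < θ := by
  intro m
  induction m with
  | zero =>
    intro θ hθ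
    refine ⟨1, one_pos, ?_⟩
    intro r ξ p R L hp _ _ _ _ _ _
    refine ⟨0, ?_, by simpa using hθ⟩
    have hp2 : p = C (coeff 0 p) := MvPolynomial.eq_C_of_isEmpty p
    have hp3 : coeff 0 p ≠ 0 := by
      intro h; rw [h] at hp2; exact hp (by simpa using hp2)
    rw [hp2]
    rw [map_C, tr, aeval_C, algebraMap_eq, coeff_zero_C]
    simpa using hp3
  | succ m ih =>
    intro θ0 hθ0
    obtain ⟨θ, hθ, hθ1, hθle⟩ : ∃ θ : ℝ, 0 < θ ∧ θ ≤ 1 ∧ θ ≤ θ0 :=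
      ⟨min θ0 1, lt_min hθ0 one_pos, min_le_right _ _, min_le_left _ _⟩
    obtain ⟨ω', hω', IH⟩ := ih (θ^2/32) (by positivity)
    have hd : (0:ℝ) < Module.finrank ℚ K := by exact_mod_cast Module.finrank_pos
    set d : ℝ := (Module.finrank ℚ K : ℝ) with hddef
    obtain ⟨ω, hω, hω1, hω2, hω3, hω4⟩ : ∃ ω : ℝ, 0 < ω ∧ ω ≤ θ/2 ∧ (m+3) * ω ≤ ω' ∧ ω ≤ ω' ∧ d * (m+2) * ω ≤ θ^2/64 := by
      refine ⟨min (θ/2) (min (ω'/(m+3)) (θ^2/64/(d*(m+2)))), by positivity, min_le_left _ _, ?_, ?_, ?_⟩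
      · calc (m+3) * min (θ/2) (min (ω'/(m+3)) (θ^2/64/(d*(m+2)))) ≤ (m+3) * (ω'/(m+3)) := by
              gcongr; exact (min_le_right _ _).trans (min_le_left _ _)
          _ = ω' := by field_simp
      · refine ((min_le_right _ _).trans (min_le_left _ _)).trans ?_
        apply div_le_self hω'.le
        have : (0:ℝ) ≤ m := by positivity
        linarith
      · calc d * (m+2) * min (θ/2) (min (ω'/(m+3)) (θ^2/64/(d*(m+2)))) ≤ d * (m+2) * (θ^2/64/(d*(m+2))) := by
              gcongr; exact (min_le_right _ _).trans (min_le_right _ _)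
          _ = _ := by field_simp
    refine ⟨ω, hω, ?_⟩
    intro r ξ p R L hp hdeg hr1 hrr hR hL hh
    by_contra hcon
    push Not at hcon
    have hr0 : ∀ j, (1:ℝ) ≤ r j := fun j => by exact_mod_cast hr1 j
    have hR1 : 1 ≤ R := (hr0 0).trans (hR 0)
    have hL0 : 0 ≤ L := le_trans (Real.log_nonneg (one_le_n1 hp)) hL
    obtain ⟨k, hk1, hk, μ, ν, f, g, hμ, hνi, hν, hf, hg, hU⟩ := det_core (K := K) p hp (r 0) (hdeg 0)
    have hk0 : (1:ℝ) ≤ k := by exact_mod_cast hk1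
    set U := (Matrix.of fun a b => Del (Finsupp.cons (ν b) (μ a)) p).det with hUdef
    obtain ⟨β0, hβ0⟩ := ne_zero_iff.1 hf
    obtain ⟨b0', hb0'⟩ := ne_zero_iff.1 hg
    obtain ⟨b0, hb0⟩ : ∃ b0, coeff (Finsupp.single 0 b0) g ≠ 0 := by
      refine ⟨b0' 0, ?_⟩
      rwa [show Finsupp.single 0 (b0' 0) = b0' from Finsupp.ext fun i => by rw [Subsingleton.elim i 0]; simp]
    have hcU : ∀ b β, ((coeff (Finsupp.cons b β) U : ℤ) : K) = coeff β f * coeff (Finsupp.single 0 b) g := by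
      intro b β
      rw [← coeff_bx, ← hU, coeff_map]; rfl
    have hU0 : U ≠ 0 := by
      intro h
      have := hcU b0 β0
      rw [h] at this
      simp at this
      tauto
    have hn : Real.log (n1 U) ≤ k * ((m + 2) * R + L) :=
      n1_core p r R L hp hdeg hk1 hk hR hL _ hU0
    have hnU := one_le_n1 hU0
    -- degree of U
    have hdegU : ∀ j, degreeOf j U ≤ k * r j := by
      intro j
      have h1 : IndGe (fun i => if i = j then (-1:ℝ) else 0) (∑ _b : Fin k, -(r j : ℝ)) U := by
        apply IndGe.det
        intro a b
        simp only [Matrix.of_apply]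
        have h2 : IndGe (fun i => if i = j then (-1:ℝ) else 0) (-(r j : ℝ)) p := by
          intro I hI
          simp only [wsum, mul_ite, mul_neg, mul_one, mul_zero, Finset.sum_ite_eq', Finset.mem_univ, if_true]
          have := (monomial_le_degreeOf j (mem_support_iff.2 hI)).trans (hdeg j)
          have : (I j : ℝ) ≤ r j := by exact_mod_cast this
          linarith
        refine (h2.del (Finsupp.cons (ν b) (μ a))).mono ?_
        simp only [wsum, mul_ite, mul_neg, mul_one, mul_zero, Finset.sum_ite_eq', Finset.mem_univ, if_true]
        have : (0:ℝ) ≤ (Finsupp.cons (ν b) (μ a) : Fin (m+1) →₀ ℕ) j := by positivity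
        linarith
      rw [degreeOf_le_iff]
      intro I hI
      have h3 := h1 I (mem_support_iff.1 hI)
      simp only [wsum, mul_ite, mul_neg, mul_one, mul_zero, Finset.sum_ite_eq', Finset.mem_univ, if_true,
        Finset.sum_const, Finset.card_univ, Fintype.card_fin, nsmul_eq_mul] at h3
      have : (I j : ℝ) ≤ k * r j := by linarith
      exact_mod_cast this
    -- index of U
    have hindU : IndGe (fun j => 1 / (r j : ℝ)) (k * (θ/2)^2/4) (tr ξ (map (Int.castRingHom K) U)) := by
      have hp1 : IndGe (fun j => 1 / (r j : ℝ)) θ (tr ξ (map (Int.castRingHom K) p)) := by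
        intro I hI
        have := hcon I hI
        refine hθle.trans (this.trans (le_of_eq ?_))
        simp [wsum, div_eq_mul_inv]
      have hmat : tr ξ (map (Int.castRingHom K) U) = (Matrix.of fun a b =>
          Del (Finsupp.cons (ν b) (μ a)) (tr ξ (map (Int.castRingHom K) p))).det := by
        rw [hUdef, RingHom.map_det, AlgHom.map_det]
        congr 1
        ext1 a b
        simp only [RingHom.mapMatrix_apply, AlgHom.mapMatrix_apply, Matrix.map_apply, Matrix.of_apply]
        rw [Del_tr, Del_map]
      rw [hmat]
      have h1 := IndGe.det (w := fun j => 1 / (r j : ℝ)) (fun b => max 0 (θ/2 - (ν b : ℝ) / r 0))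
        (Matrix.of fun a b => Del (Finsupp.cons (ν b) (μ a)) (tr ξ (map (Int.castRingHom K) p))) (by
          intro a b
          simp only [Matrix.of_apply]
          intro I hI
          apply max_le
          · exact wsum_nonneg (fun j => by positivity) _
          · refine le_trans ?_ (hp1.del _ I hI)
            have hw : wsum (fun j => 1 / (r j : ℝ)) (Finsupp.cons (ν b) (μ a)) ≤ (ν b : ℝ) / r 0 + θ/2 := by
              rw [wsum, Fin.sum_univ_succ]
              simp only [Finsupp.cons_zero, Finsupp.cons_succ]
              have h5 : ∑ i : Fin m, (μ a i : ℝ) * (1 / (r i.succ : ℝ)) ≤ ∑ i : Fin m, (μ a i : ℝ) * (ω / r 0) := by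
                apply Finset.sum_le_sum; intro i _
                apply mul_le_mul_of_nonneg_left _ (by positivity)
                rw [div_le_div_iff₀ (by linarith [hr0 i.succ]) (by linarith [hr0 0])]
                linarith [hrr 0 i.succ (Fin.succ_pos i)]
              have h6 : ∑ i : Fin m, (μ a i : ℝ) ≤ r 0 := by
                have := hμ a
                rw [Finsupp.degree_eq_sum] at this
                have : ∑ i : Fin m, μ a i ≤ r 0 := by omega
                exact_mod_cast this
              rw [← Finset.sum_mul] at h5
              have h7 : (∑ i : Fin m, (μ a i : ℝ)) * (ω / r 0) ≤ r 0 * (ω / r 0) := by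
                gcongr
              have h8 : (r 0 : ℝ) * (ω / r 0) = ω := by
                have := hr0 0
                field_simp
              rw [mul_one_div]
              linarith
            linarith)
      refine h1.mono ?_
      rw [sum_inj_range k ν hνi hν (fun i => max 0 (θ/2 - (i : ℝ) / r 0))]
      exact sum_max k (r 0) (hr1 0) hk (θ/2) (by positivity) (by linarith)
    -- f slice
    obtain ⟨J, hJ, hJw⟩ : ∃ J, coeff J (tr (fun j : Fin m => ξ j.succ) f) ≠ 0 ∧
        ∑ j, (J j : ℝ) / r j.succ < k * (θ^2/32) := by
      set F : MvPolynomial (Fin m) ℤ := (finSuccEquiv ℤ m U).coeff b0 with hF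
      have hFc : ∀ β, coeff β F = coeff (Finsupp.cons b0 β) U := fun β => finSuccEquiv_coeff_coeff _ _ _
      have hFK : map (Int.castRingHom K) F = C (coeff (Finsupp.single 0 b0) g) * f := by
        ext β
        rw [coeff_map, coeff_C_mul, hFc, mul_comm, ← hcU]; rfl
      have hF0 : F ≠ 0 := by
        intro h
        rw [h, map_zero] at hFK
        rcases mul_eq_zero.1 hFK.symm with h | h
        · exact hb0 (by simpa using h)
        · exact hf h
      have hFn : n1 F ≤ n1 U := n1_slice U F (fun β => Finsupp.cons b0 β) (cons_inj_right b0) hFc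
      obtain ⟨J, hJ, hJw⟩ := IH (fun j => k * r j.succ) (fun j => ξ j.succ) F (k * R) (k * ((m + 2) * R + L)) hF0
        (by
          intro j
          rw [degreeOf_le_iff]
          intro β hβ
          rw [mem_support_iff, hFc] at hβ
          have := (monomial_le_degreeOf j.succ (mem_support_iff.2 hβ)).trans (hdegU j.succ)
          simpa using this)
        (fun j => Nat.mul_pos hk1 (hr1 _))
        (by
          intro i j hij
          push_cast
          have h1 := hrr i.succ j.succ (Fin.succ_lt_succ_iff.2 hij)
          have h2 : ω * (r j.succ : ℝ) ≤ ω' * r j.succ := by gcongr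
          nlinarith)
        (by intro j; push_cast; gcongr; exact hR _)
        ((Real.log_le_log (by linarith [one_le_n1 hF0]) hFn).trans hn)
        (by
          intro j
          push_cast
          have h1 := hh j.succ
          have h2 : 0 ≤ (r j.succ : ℝ) * hS S (ξ j.succ) := by
            have : 0 ≤ ω * ((r j.succ : ℝ) * hS S (ξ j.succ)) := by linarith
            exact nonneg_of_mul_nonneg_right this hω
          have h3 : (m+3) * ω * ((r j.succ : ℝ) * hS S (ξ j.succ)) ≤ ω' * ((r j.succ : ℝ) * hS S (ξ j.succ)) := by gcongr
          have h4 : ((m:ℝ)+3) * (L + R) ≤ (m+3) * (ω * r j.succ * hS S (ξ j.succ)) := by gcongr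
          have h5 : ((m:ℝ)+2) * R + L + R ≤ (m+3) * (L+R) := by nlinarith [(Nat.cast_nonneg m : (0:ℝ) ≤ m)]
          have h6 : ((m:ℝ)+2) * R + L + R ≤ ω' * ((r j.succ : ℝ) * hS S (ξ j.succ)) := by linarith
          calc (k:ℝ) * ((m+2) * R + L) + k * R = k * (((m:ℝ)+2) * R + L + R) := by ring
            _ ≤ k * (ω' * ((r j.succ : ℝ) * hS S (ξ j.succ))) := by gcongr
            _ = _ := by ring)
      refine ⟨J, ?_, ?_⟩
      · rw [hFK, map_mul] at hJ
        rw [show tr (fun j : Fin m => ξ j.succ) (C (coeff (Finsupp.single 0 b0) g)) = C (coeff (Finsupp.single 0 b0) g) by simp [tr], coeff_C_mul] at hJ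
        exact right_ne_zero_of_mul hJ
      · have h1 : ∑ j, (J j : ℝ) / r j.succ = k * ∑ j, (J j : ℝ) / ((k * r j.succ : ℕ) : ℝ) := by
          rw [Finset.mul_sum]
          apply Finset.sum_congr rfl; intro j _
          have := hr0 j.succ
          push_cast
          field_simp
        rw [h1]
        gcongr
    -- g slice
    obtain ⟨e, he, hew⟩ : ∃ e, coeff (Finsupp.single 0 e) (tr (fun _ : Fin 1 => ξ 0) g) ≠ 0 ∧
        (e:ℝ) / r 0 < k * (θ^2/32) := by
      obtain ⟨e, he, hdvd⟩ := exists_order (ξ 0) g hg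
      refine ⟨e, he, ?_⟩
      obtain ⟨W, hW⟩ := exists_uni_slice U β0
      have hWK : W.map (Int.castRingHom K) = Polynomial.C (coeff β0 f) * uni g := by
        ext b
        rw [Polynomial.coeff_map, hW, Polynomial.coeff_C_mul, coeff_uni, ← hcU]; rfl
      have hW0 : W ≠ 0 := by
        intro h
        have h1 := hW b0
        have h2 := hcU b0 β0
        rw [← h1, h] at h2
        simp at h2; tauto
      have h1 := HB S (ξ 0) W hW0 e (hWK ▸ Dvd.dvd.mul_left hdvd _)
      have h2 := n1_slice_uni U W (fun b => Finsupp.cons b β0) (cons_inj_left β0) hW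
      have h3 : Real.log (W.sum fun _ a => |(a : ℝ)|) ≤ Real.log (n1 U) := by
        apply Real.log_le_log _ h2
        apply Finset.sum_pos
        · intro b hb
          have := Polynomial.mem_support_iff.1 hb
          positivity
        · rwa [Polynomial.support_nonempty]
      have h4 := hh 0
      have hpos : 0 < hS S (ξ 0) := by
        have h5 : 0 < ω * r 0 * hS S (ξ 0) := by linarith
        have h6 : 0 < ω * (r 0:ℝ) := mul_pos hω (by linarith [hr0 0])
        exact pos_of_mul_pos_right h5 h6.le
      have h5 : (e:ℝ) * hS S (ξ 0) ≤ (k * (θ^2/64) * r 0) * hS S (ξ 0) := by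
        calc (e:ℝ) * hS S (ξ 0) ≤ d * (k * ((m+2) * R + L)) :=
              h1.trans (by rw [← hddef]; gcongr; exact h3.trans hn)
          _ ≤ d * (k * ((m+2) * (L + R))) := by
              gcongr; nlinarith [(Nat.cast_nonneg m : (0:ℝ) ≤ m)]
          _ ≤ d * (k * ((m+2) * (ω * r 0 * hS S (ξ 0)))) := by gcongr
          _ = k * (d * (m+2) * ω) * r 0 * hS S (ξ 0) := by ring
          _ ≤ _ := by gcongr
      have h6 := le_of_mul_le_mul_right h5 hpos
      have h7 := hr0 0
      rw [div_lt_iff₀ (by linarith)]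
      have h8 : 0 < k * (θ^2/64) * r 0 := by positivity
      linarith
    have hfin := hindU (Finsupp.cons e J) (by
      rw [hU, tr_bx, coeff_bx]
      exact mul_ne_zero hJ he)
    rw [wsum, Fin.sum_univ_succ] at hfin
    simp only [Finsupp.cons_zero, Finsupp.cons_succ, mul_one_div] at hfin
    linarith
end RL
end MLT

set_option linter.unusedSectionVars false
namespace MLT
open MvPolynomial

section aux
variable {m n : ℕ}

/-- block weight -/
def bw (m n : ℕ) (x : Fin m × Fin n) : Fin m → ℕ := Pi.single x.1 1

lemma weight_bw (d : Fin m × Fin n →₀ ℕ) (j : Fin m) :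
    Finsupp.weight (bw m n) d j = ∑ i, d (j, i) := by
  classical
  rw [Finsupp.weight_apply, Finsupp.sum_fintype _ _ (by simp), Fintype.sum_prod_type, Finset.sum_apply]
  simp only [bw, Finset.sum_apply, Pi.smul_apply, smul_eq_mul]
  rw [Finset.sum_eq_single j]
  · simp
  · intro b _ hb
    apply Finset.sum_eq_zero; intro i _
    simp [hb.symm]
  · simp

/-- linear substitution in every block -/
noncomputable def lsub (M : Matrix (Fin n) (Fin n) ℤ) :
    MvPolynomial (Fin m × Fin n) ℤ →ₐ[ℤ] MvPolynomial (Fin m × Fin n) ℤ :=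
  aeval (fun x => ∑ i', C (M x.2 i') * X (x.1, i'))

lemma lsub_homog (M : Matrix (Fin n) (Fin n) ℤ) (P : MvPolynomial (Fin m × Fin n) ℤ) (r : Fin m → ℕ)
    (hP : IsWeightedHomogeneous (bw m n) P r) : IsWeightedHomogeneous (bw m n) (lsub M P) r := by
  rw [P.as_sum, map_sum]
  apply IsWeightedHomogeneous.sum
  intro α hα
  rw [lsub, aeval_monomial, algebraMap_eq]
  have h1 := hP (mem_support_iff.1 hα)
  apply IsWeightedHomogeneous.C_mul
  rw [← h1, Finsupp.weight_apply]
  apply IsWeightedHomogeneous.prod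
  intro x _
  apply IsWeightedHomogeneous.pow
  apply IsWeightedHomogeneous.sum
  intro i' _
  apply IsWeightedHomogeneous.C_mul
  exact isWeightedHomogeneous_X ℤ (bw m n) (x.1, i')

lemma n1_C (c : ℤ) {σ : Type*} : n1 (C c : MvPolynomial σ ℤ) ≤ |(c:ℝ)| := n1_monomial 0 c
lemma n1_X {σ : Type*} (i : σ) : n1 (X i : MvPolynomial σ ℤ) ≤ 1 := by
  have := n1_monomial (Finsupp.single i 1) 1
  simp only [Int.cast_one, abs_one] at this
  exact this
lemma n1_pow {σ : Type*} (p : MvPolynomial σ ℤ) (k : ℕ) : n1 (p ^ k) ≤ n1 p ^ k := by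
  have := n1_prod (Finset.range k) (fun _ => p)
  simpa using this

/-- total size of a matrix -/
noncomputable def msz (M : Matrix (Fin n) (Fin n) ℤ) : ℝ := 1 + ∑ i, ∑ i', |(M i i' : ℝ)|

lemma one_le_msz (M : Matrix (Fin n) (Fin n) ℤ) : 1 ≤ msz M := by
  unfold msz
  have : 0 ≤ ∑ i, ∑ i', |(M i i' : ℝ)| := Finset.sum_nonneg fun i _ => Finset.sum_nonneg fun i' _ => abs_nonneg _
  linarith

lemma row_le_msz (M : Matrix (Fin n) (Fin n) ℤ) (i : Fin n) : ∑ i', |(M i i' : ℝ)| ≤ msz M := by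
  unfold msz
  have := Finset.single_le_sum (f := fun i => ∑ i', |(M i i' : ℝ)|)
    (fun i _ => Finset.sum_nonneg fun i' _ => abs_nonneg _) (Finset.mem_univ i)
  linarith

lemma n1_lsub (M : Matrix (Fin n) (Fin n) ℤ) (P : MvPolynomial (Fin m × Fin n) ℤ) (r : Fin m → ℕ)
    (hP : IsWeightedHomogeneous (bw m n) P r) : n1 (lsub M P) ≤ msz M ^ (∑ j, r j) * n1 P := by
  conv_lhs => rw [P.as_sum, map_sum]
  refine (n1_sum _ _).trans ?_
  rw [n1, Finset.mul_sum]
  apply Finset.sum_le_sum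
  intro α hα
  rw [lsub, aeval_monomial, algebraMap_eq]
  refine (n1_mul _ _).trans ?_
  rw [mul_comm]
  refine mul_le_mul ?_ (n1_C _) (n1_nonneg _) (pow_nonneg (zero_le_one.trans (one_le_msz _)) _)
  · rw [Finsupp.prod]
    refine (n1_prod _ _).trans ?_
    have h1 := hP (mem_support_iff.1 hα)
    have h2 : ∑ j, r j = ∑ x ∈ α.support, α x := by
      rw [← h1]
      simp_rw [weight_bw]
      rw [← Fintype.sum_prod_type']
      exact (Finset.sum_subset (Finset.subset_univ _) (fun x _ hx => by simpa using hx)).symm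
    rw [h2, ← Finset.prod_pow_eq_pow_sum]
    apply Finset.prod_le_prod (fun _ _ => n1_nonneg _)
    intro x _
    refine (n1_pow _ _).trans ?_
    gcongr
    · exact n1_nonneg _
    refine (n1_sum _ _).trans (le_trans ?_ (row_le_msz M x.2))
    apply Finset.sum_le_sum; intro i' _
    refine (n1_mul _ _).trans ?_
    calc n1 (C (M x.2 i')) * n1 (X (x.1, i')) ≤ |(M x.2 i' : ℝ)| * 1 := by
          gcongr
          · exact n1_nonneg _
          · exact n1_C _
          · exact n1_X _
      _ = _ := mul_one _

/-- exponents of degree `r` -/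
def Ax (n r : ℕ) : Finset (Fin n → ℕ) :=
  (Fintype.piFinset fun _ : Fin n => Finset.range (r+1)).filter (fun α => ∑ i, α i = r)

lemma mem_Ax {n r : ℕ} (α : Fin n → ℕ) : α ∈ Ax n r ↔ ∑ i, α i = r := by
  simp only [Ax, Finset.mem_filter, Fintype.mem_piFinset, Finset.mem_range, and_iff_right_iff_imp]
  intro h i
  have := Finset.single_le_sum (f := α) (fun _ _ => Nat.zero_le _) (Finset.mem_univ i)
  omega

lemma card_Ax (n r : ℕ) : (Ax n r).card ≤ 2 ^ (n * r) := by
  refine (Finset.card_filter_le _ _).trans ?_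
  rw [Fintype.card_piFinset]
  simp only [Finset.card_range, Finset.prod_const, Finset.card_univ, Fintype.card_fin]
  rw [mul_comm, pow_mul]
  exact Nat.pow_le_pow_left (Nat.lt_two_pow_self) _

lemma sum_Ax (n r : ℕ) (i : Fin n) : (n:ℝ) * ∑ α ∈ Ax n r, (α i : ℝ) = r * (Ax n r).card := by
  have h1 : ∀ i', ∑ α ∈ Ax n r, (α i' : ℝ) = ∑ α ∈ Ax n r, (α i : ℝ) := by
    intro i'
    apply Finset.sum_bij (fun α _ => α ∘ Equiv.swap i i')
    · intro α hα
      rw [mem_Ax] at hα ⊢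
      rw [← hα]
      exact Equiv.sum_comp (Equiv.swap i i') α
    · intro α _ β _ h
      funext x
      have := congrFun h (Equiv.swap i i' x)
      simpa using this
    · intro β hβ
      refine ⟨β ∘ Equiv.swap i i', ?_, ?_⟩
      · rw [mem_Ax] at hβ ⊢
        rw [← hβ]
        exact Equiv.sum_comp (Equiv.swap i i') β
      · funext x; simp
    · intro α _; simp
  calc (n:ℝ) * ∑ α ∈ Ax n r, (α i : ℝ) = ∑ i' : Fin n, ∑ α ∈ Ax n r, (α i' : ℝ) := by
        simp_rw [h1]; simp
    _ = ∑ α ∈ Ax n r, (r:ℝ) := by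
        rw [Finset.sum_comm]
        apply Finset.sum_congr rfl; intro α hα
        rw [mem_Ax] at hα
        exact_mod_cast hα
    _ = _ := by simp [mul_comm]

lemma exp_moment (n r : ℕ) (hr : 1 ≤ r) (i : Fin n) (t : ℝ) (h0 : 0 ≤ t) (h1 : t ≤ 1) :
    ∑ α ∈ Ax n r, Real.exp (t * ((α i : ℝ) / r - 1 / n)) ≤ (Ax n r).card * Real.exp (t^2) := by
  have hn : (1:ℝ) ≤ n := by
    have : 1 ≤ n := Nat.one_le_of_lt (Nat.lt_of_le_of_lt (Nat.zero_le _) i.2)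
    exact_mod_cast this
  have hr' : (1:ℝ) ≤ r := by exact_mod_cast hr
  have hX : ∀ α ∈ Ax n r, |(α i : ℝ) / r - 1 / n| ≤ 1 := by
    intro α hα
    rw [mem_Ax] at hα
    have h2 : α i ≤ r := by
      have := Finset.single_le_sum (f := α) (fun _ _ => Nat.zero_le _) (Finset.mem_univ i); omega
    have h3 : (α i : ℝ) / r ≤ 1 := by
      rw [div_le_one (by linarith)]; exact_mod_cast h2
    have h4 : 0 ≤ (α i : ℝ) / r := by positivity
    have h5 : 1 / (n:ℝ) ≤ 1 := by rw [div_le_one (by linarith)]; exact hn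
    have h6 : 0 ≤ 1 / (n:ℝ) := by positivity
    rw [abs_le]; constructor <;> linarith
  have hs : ∑ α ∈ Ax n r, ((α i : ℝ) / r - 1 / n) = 0 := by
    rw [Finset.sum_sub_distrib, ← Finset.sum_div]
    have := sum_Ax n r i
    simp only [Finset.sum_const, nsmul_eq_mul]
    field_simp
    linarith
  calc ∑ α ∈ Ax n r, Real.exp (t * ((α i : ℝ) / r - 1 / n))
      ≤ ∑ α ∈ Ax n r, (1 + t * ((α i : ℝ) / r - 1 / n) + t^2) := by
        apply Finset.sum_le_sum; intro α hα
        have h2 := hX α hα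
        have h3 : |t * ((α i : ℝ) / r - 1 / n)| ≤ 1 := by
          rw [abs_mul, abs_of_nonneg h0]; nlinarith [abs_nonneg ((α i : ℝ) / r - 1 / n)]
        have h4 := Real.abs_exp_sub_one_sub_id_le h3
        have h5 := (abs_le.1 h4).2
        have h6 : (t * ((α i : ℝ) / r - 1 / n))^2 ≤ t^2 := by
          rw [mul_pow]
          have : ((α i : ℝ) / r - 1 / n)^2 ≤ 1 := by rw [← sq_abs]; nlinarith [abs_nonneg ((α i : ℝ) / r - 1 / n)]
          nlinarith [sq_nonneg t]
        linarith
    _ = (Ax n r).card * (1 + t^2) := by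
        rw [Finset.sum_add_distrib, Finset.sum_add_distrib, ← Finset.mul_sum, hs]
        simp; ring
    _ ≤ _ := by
        gcongr
        linarith [Real.add_one_le_exp (t^2)]

/-- all multi-exponents -/
def AA (n : ℕ) (r : Fin m → ℕ) : Finset (Fin m → Fin n → ℕ) := Fintype.piFinset fun j => Ax n (r j)

lemma count_bad (r : Fin m → ℕ) (hr : ∀ j, 1 ≤ r j) (i : Fin n) (ε : ℝ) (h0 : 0 < ε) (h1 : ε ≤ 1) :
    (((AA n r).filter (fun α => (m:ℝ) * (1/n + ε) < ∑ j, (α j i : ℝ) / r j)).card : ℝ) ≤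
      (AA n r).card * Real.exp (- (m * ε^2/4)) := by
  have h2 : ∑ α ∈ AA n r, Real.exp (ε/2 * ∑ j, ((α j i : ℝ) / r j - 1 / n)) ≤
      (AA n r).card * Real.exp (m * (ε/2)^2) := by
    calc ∑ α ∈ AA n r, Real.exp (ε/2 * ∑ j, ((α j i : ℝ) / r j - 1 / n))
        = ∑ α ∈ AA n r, ∏ j, Real.exp (ε/2 * ((α j i : ℝ) / r j - 1 / n)) := by
          apply Finset.sum_congr rfl; intro α _
          rw [Finset.mul_sum, Real.exp_sum]
      _ = ∏ j, ∑ a ∈ Ax n (r j), Real.exp (ε/2 * ((a i : ℝ) / r j - 1 / n)) := by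
          rw [AA, Finset.prod_univ_sum]
      _ ≤ ∏ j, ((Ax n (r j)).card * Real.exp ((ε/2)^2)) := by
          apply Finset.prod_le_prod
          · intros; exact Finset.sum_nonneg fun _ _ => (Real.exp_pos _).le
          · intro j _; exact exp_moment n (r j) (hr j) i (ε/2) (by linarith) (by linarith)
      _ = _ := by
          rw [Finset.prod_mul_distrib, AA, Fintype.card_piFinset]
          simp [← Real.exp_nat_mul]
  have h3 : (((AA n r).filter (fun α => (m:ℝ) * (1/n + ε) < ∑ j, (α j i : ℝ) / r j)).card : ℝ) *
      Real.exp (ε/2 * (m * ε)) ≤ ∑ α ∈ AA n r, Real.exp (ε/2 * ∑ j, ((α j i : ℝ) / r j - 1 / n)) := by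
    generalize hBd : (AA n r).filter (fun α => (m:ℝ) * (1/n + ε) < ∑ j, (α j i : ℝ) / r j) = Bd
    have hBs : Bd ⊆ AA n r := by rw [← hBd]; exact Finset.filter_subset _ _
    rw [← nsmul_eq_mul, ← Finset.sum_const]
    refine le_trans (Finset.sum_le_sum ?_) (Finset.sum_le_sum_of_subset_of_nonneg hBs (fun _ _ _ => (Real.exp_pos _).le))
    intro α hα
    rw [← hBd] at hα
    have := (Finset.mem_filter.1 hα).2
    apply Real.exp_le_exp.2
    apply mul_le_mul_of_nonneg_left _ (by linarith)
    rw [Finset.sum_sub_distrib]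
    simp only [Finset.sum_const, Finset.card_univ, Fintype.card_fin, nsmul_eq_mul]
    linarith
  have h4 := h3.trans h2
  rw [← le_div_iff₀ (Real.exp_pos _), mul_div_assoc, ← Real.exp_sub] at h4
  refine h4.trans (le_of_eq ?_)
  congr 2; ring

/-- exponent from blocks -/
noncomputable def tox (α : Fin m → Fin n → ℕ) : Fin m × Fin n →₀ ℕ :=
  Finsupp.equivFunOnFinite.symm (fun x => α x.1 x.2)

lemma tox_apply (α : Fin m → Fin n → ℕ) (x) : tox α x = α x.1 x.2 := rfl
lemma tox_inj : Function.Injective (tox (m := m) (n := n)) := by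
  intro α β h
  funext j i
  exact DFunLike.congr_fun h (j, i)

lemma tox_weight (r : Fin m → ℕ) (α : Fin m → Fin n → ℕ) (h : α ∈ AA n r) :
    Finsupp.weight (bw m n) (tox α) = r := by
  funext j
  rw [weight_bw]
  rw [AA, Fintype.mem_piFinset] at h
  exact (mem_Ax _).1 (h j)

theorem aux_poly (n : ℕ) (hn : 1 ≤ n) {Θ : Type*} [Fintype Θ] (M : Θ → Matrix (Fin n) (Fin n) ℤ) (ε : ℝ)
    (h0 : 0 < ε) (h1 : ε ≤ 1) : ∃ m : ℕ, 1 ≤ m ∧ ∃ Cc : ℝ, 1 ≤ Cc ∧ ∀ r : Fin m → ℕ, (∀ j, 1 ≤ r j) →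
      ∃ P : MvPolynomial (Fin m × Fin n) ℤ, P ≠ 0 ∧ IsWeightedHomogeneous (bw m n) P r ∧
        n1 P ≤ Cc ^ (∑ j, r j) ∧
        ∀ θ, ∀ α, coeff α (lsub (M θ) P) ≠ 0 → ∀ i, ∑ j, (α (j, i) : ℝ) / r j ≤ m * (1/n + ε) := by
  classical
  obtain ⟨m, hm1, hm⟩ : ∃ m : ℕ, 1 ≤ m ∧ Fintype.card Θ * n * Real.exp (-(m * ε^2/4)) ≤ 1/2 := by
    have h2 : Filter.Tendsto (fun m : ℕ => Fintype.card Θ * n * Real.exp (-(m * ε^2/4))) Filter.atTop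
        (nhds (Fintype.card Θ * n * 0)) := by
      apply Filter.Tendsto.const_mul
      apply Real.tendsto_exp_neg_atTop_nhds_zero.comp
      have : (fun m : ℕ => (m * ε^2/4 : ℝ)) = fun m : ℕ => (m:ℝ) * (ε^2/4) := by funext m; ring
      rw [this]
      exact tendsto_natCast_atTop_atTop.atTop_mul_const (by positivity)
    rw [mul_zero] at h2
    have h3 := h2.eventually (gt_mem_nhds (by norm_num : (0:ℝ) < 1/2))
    obtain ⟨m, hm, hm1⟩ := (h3.and (Filter.eventually_ge_atTop 1)).exists
    exact ⟨m, hm1, hm.le⟩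
  obtain ⟨C1, hC1, hMC⟩ : ∃ C1 : ℝ, 1 ≤ C1 ∧ ∀ θ, msz (M θ) ≤ C1 := by
    refine ⟨1 + ∑ θ, msz (M θ), ?_, ?_⟩
    · have : 0 ≤ ∑ θ, msz (M θ) := Finset.sum_nonneg fun θ _ => zero_le_one.trans (one_le_msz _)
      linarith
    · intro θ
      have := Finset.single_le_sum (f := fun θ => msz (M θ)) (fun θ _ => zero_le_one.trans (one_le_msz _)) (Finset.mem_univ θ)
      linarith
  refine ⟨m, hm1, (2^n)^2 * C1, ?_, ?_⟩
  · have : (1:ℝ) ≤ (2^n)^2 := one_le_pow₀ (one_le_pow₀ (by norm_num))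
    nlinarith
  intro r hr
  set A := AA n r with hA
  have hcardA : (A.card : ℝ) ≤ (2^n) ^ (∑ j, r j) := by
    have : A.card ≤ (2^n) ^ (∑ j, r j) := by
      rw [hA, AA, Fintype.card_piFinset, ← Finset.prod_pow_eq_pow_sum]
      apply Finset.prod_le_prod (fun _ _ => Nat.zero_le _)
      intro j _
      rw [← pow_mul]; exact card_Ax _ _
    exact_mod_cast this
  have hAne : A.Nonempty := by
    refine ⟨fun j i => if i = ⟨0, hn⟩ then r j else 0, ?_⟩
    rw [hA, AA, Fintype.mem_piFinset]
    intro j; rw [mem_Ax]; simp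
  have hA1 : (1:ℝ) ≤ A.card := by exact_mod_cast hAne.card_pos
  set Bad := A.filter (fun α => ∃ i, (m:ℝ) * (1/n + ε) < ∑ j, (α j i : ℝ) / r j) with hBad
  have hBadcard : (Bad.card : ℝ) ≤ n * (A.card * Real.exp (-(m * ε^2/4))) := by
    have h2 : Bad ⊆ Finset.univ.biUnion (fun i => A.filter (fun α => (m:ℝ) * (1/n + ε) < ∑ j, (α j i : ℝ) / r j)) := by
      intro α hα
      obtain ⟨h3, i, h4⟩ := Finset.mem_filter.1 hα
      exact Finset.mem_biUnion.2 ⟨i, Finset.mem_univ _, Finset.mem_filter.2 ⟨h3, h4⟩⟩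
    have h3 := (Finset.card_le_card h2).trans Finset.card_biUnion_le
    calc (Bad.card : ℝ) ≤ ∑ i : Fin n, (((A.filter (fun α => (m:ℝ) * (1/n + ε) < ∑ j, (α j i : ℝ) / r j)).card : ℕ) : ℝ) := by exact_mod_cast h3
      _ ≤ ∑ i : Fin n, (A.card * Real.exp (-(m * ε^2/4))) := Finset.sum_le_sum fun i _ => count_bad r hr i ε h0 h1
      _ = _ := by simp
  have hhom : ∀ t : A → ℤ, IsWeightedHomogeneous (bw m n) (∑ β : A, monomial (tox β.1) (t β)) r := by
    intro t
    apply IsWeightedHomogeneous.sum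
    intro β _
    exact isWeightedHomogeneous_monomial _ _ _ (tox_weight r _ β.2)
  have hmain : ∃ t : A → ℤ, t ≠ 0 ∧ (∀ β, |(t β : ℝ)| ≤ A.card * C1 ^ (∑ j, r j)) ∧
      ∀ θ, ∀ α ∈ Bad, coeff (tox α) (lsub (M θ) (∑ β : A, monomial (tox β.1) (t β))) = 0 := by
    by_cases hemp : IsEmpty (Θ × Bad)
    · refine ⟨fun _ => 1, ?_, ?_, ?_⟩
      · obtain ⟨a, ha⟩ := hAne
        intro h; have := congrFun h ⟨a, ha⟩; simp at this
      · intro β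
        have : (1:ℝ) ≤ C1 ^ (∑ j, r j) := one_le_pow₀ hC1
        simp only [Int.cast_one, abs_one]
        nlinarith
      · intro θ α hα
        exact (hemp.false (θ, ⟨α, hα⟩)).elim
    · rw [not_isEmpty_iff] at hemp
      let Mx : Matrix (Θ × Bad) A ℤ := fun x β => coeff (tox x.2.1) (lsub (M x.1) (monomial (tox β.1) 1))
      have hcc : 2 * (Fintype.card (Θ × Bad) : ℝ) ≤ Fintype.card A := by
        rw [Fintype.card_prod, Fintype.card_coe, Fintype.card_coe]
        push_cast
        have h2 : (Fintype.card Θ : ℝ) * Bad.card ≤ Fintype.card Θ * (n * (A.card * Real.exp (-(m * ε^2/4)))) := by gcongr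
        nlinarith
      have hc0 : 0 < Fintype.card (Θ × Bad) := Fintype.card_pos
      have hc0' : (0:ℝ) < Fintype.card (Θ × Bad) := by exact_mod_cast hc0
      have hclt : Fintype.card (Θ × Bad) < Fintype.card A := by
        have : (Fintype.card (Θ × Bad) : ℝ) < Fintype.card A := by linarith
        exact_mod_cast this
      obtain ⟨t, ht0, htA, htn⟩ := Int.Matrix.exists_ne_zero_int_vec_norm_le Mx hclt hc0
      refine ⟨t, ht0, ?_, ?_⟩
      · intro β
        have h2 : |(t β : ℝ)| ≤ ‖t‖ := by
          have := norm_le_pi_norm t β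
          rwa [Int.norm_eq_abs] at this
        have hC1p : (1:ℝ) ≤ C1 ^ (∑ j, r j) := one_le_pow₀ hC1
        have h3 : max 1 (@norm (Matrix (Θ × Bad) A ℤ) (Matrix.seminormedAddCommGroup).toNorm Mx) ≤ C1 ^ (∑ j, r j) := by
          apply max_le hC1p
          rw [Matrix.norm_le_iff (by linarith)]
          intro x β
          rw [Int.norm_eq_abs]
          refine (coeff_le_n1 _ _).trans ((n1_lsub _ _ r (isWeightedHomogeneous_monomial _ _ _ (tox_weight r _ β.2))).trans ?_)
          have h4 := n1_monomial (tox β.1) 1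
          simp only [Int.cast_one, abs_one] at h4
          have h5 : msz (M x.1) ^ (∑ j, r j) ≤ C1 ^ (∑ j, r j) :=
            pow_le_pow_left₀ (zero_le_one.trans (one_le_msz _)) (hMC _) _
          calc _ ≤ C1 ^ (∑ j, r j) * 1 := by gcongr; exact n1_nonneg _
            _ = _ := mul_one _
        refine h2.trans (htn.trans ?_)
        rw [Fintype.card_coe] at hcc ⊢
        have hb : 1 ≤ (A.card : ℝ) * max 1 (@norm (Matrix (Θ × Bad) A ℤ) (Matrix.seminormedAddCommGroup).toNorm Mx) := by
          nlinarith [le_max_left 1 (@norm (Matrix (Θ × Bad) A ℤ) (Matrix.seminormedAddCommGroup).toNorm Mx)]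
        refine (Real.rpow_le_rpow_of_exponent_le hb (y := (_:ℝ)) (z := 1) ?_).trans ?_
        · rw [div_le_one (by linarith)]; linarith
        · rw [Real.rpow_one]; gcongr
      · intro θ α hα
        have := congrFun htA (θ, ⟨α, hα⟩)
        simp only [Matrix.mulVec, dotProduct, Mx, Pi.zero_apply] at this
        rw [map_sum, coeff_sum, ← this]
        apply Finset.sum_congr rfl; intro β _
        have h2 : (monomial (tox β.1) (t β) : MvPolynomial (Fin m × Fin n) ℤ) = (t β) • monomial (tox β.1) 1 := by
          rw [smul_monomial]; simp
        rw [h2, map_smul, coeff_smul, smul_eq_mul, mul_comm]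
  obtain ⟨t, ht0, htn, htB⟩ := hmain
  refine ⟨∑ β : A, monomial (tox β.1) (t β), ?_, hhom t, ?_, ?_⟩
  · intro h
    apply ht0
    funext β
    have h2 := congrArg (coeff (tox β.1)) h
    rw [coeff_sum, Finset.sum_eq_single β] at h2
    · simpa using h2
    · intro b _ hb
      rw [coeff_monomial, if_neg]
      intro h3; exact hb (Subtype.ext (tox_inj h3))
    · simp
  · refine (n1_sum _ _).trans ?_
    calc ∑ β : A, n1 (monomial (tox β.1) (t β)) ≤ ∑ β : A, (A.card * C1 ^ (∑ j, r j)) :=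
          Finset.sum_le_sum fun β _ => (n1_monomial _ _).trans (htn β)
      _ = A.card * A.card * C1 ^ (∑ j, r j) := by simp; ring
      _ ≤ (2^n) ^ (∑ j, r j) * (2^n) ^ (∑ j, r j) * C1 ^ (∑ j, r j) := by gcongr
      _ = _ := by rw [← mul_pow, ← mul_pow, sq]
  · intro θ α hα
    by_contra hbad
    push Not at hbad
    have h2 := lsub_homog (M θ) _ r (hhom t) hα
    have hαt : α = tox (fun j i => α (j, i)) := by ext x; rfl
    apply hα
    rw [hαt]
    apply htB
    rw [hBad, Finset.mem_filter]
    refine ⟨?_, hbad⟩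
    rw [hA, AA, Fintype.mem_piFinset]
    intro j
    rw [mem_Ax, ← weight_bw, h2]
end aux
end MLT

set_option linter.unusedSectionVars false
namespace MLT
open MvPolynomial

section wn
variable {R : Type*} [CommRing R] {σ : Type*}

/-- submultiplicative seminorm -/
structure IsSN (N : R → ℝ) : Prop where
  nonneg : ∀ a, 0 ≤ N a
  zero : N 0 = 0
  one : N 1 ≤ 1
  add : ∀ a b, N (a + b) ≤ N a + N b
  mul : ∀ a b, N (a * b) ≤ N a * N b

lemma IsSN.sum {N : R → ℝ} (h : IsSN N) {ι : Type*} (s : Finset ι) (f : ι → R) :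
    N (∑ i ∈ s, f i) ≤ ∑ i ∈ s, N (f i) := by
  classical
  induction s using Finset.induction_on with
  | empty => simp [h.zero]
  | insert a s ha ih =>
    rw [Finset.sum_insert ha, Finset.sum_insert ha]; exact (h.add _ _).trans (by gcongr)

lemma IsSN.prod {N : R → ℝ} (h : IsSN N) {ι : Type*} (s : Finset ι) (f : ι → R) :
    N (∏ i ∈ s, f i) ≤ ∏ i ∈ s, N (f i) := by
  classical
  induction s using Finset.induction_on with
  | empty => simpa using h.one
  | insert a s ha ih =>
    rw [Finset.prod_insert ha, Finset.prod_insert ha]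
    exact (h.mul _ _).trans (mul_le_mul_of_nonneg_left ih (h.nonneg _))

lemma IsSN.pow {N : R → ℝ} (h : IsSN N) (a : R) (k : ℕ) : N (a ^ k) ≤ N a ^ k := by
  simpa using h.prod (Finset.range k) (fun _ => a)

lemma isSN_abv {K : Type*} [Field K] (v : AbsoluteValue K ℝ) : IsSN (fun x => v x) :=
  ⟨fun a => v.nonneg a, v.map_zero, v.map_one.le, fun a b => v.add_le a b, fun a b => (v.map_mul a b).le⟩

/-- weighted norm -/
noncomputable def wn (N : R → ℝ) (t : σ → ℝ) (p : MvPolynomial σ R) : ℝ :=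
  ∑ α ∈ p.support, N (coeff α p) * α.prod fun i k => t i ^ k

variable {N : R → ℝ} (h : IsSN N) {t : σ → ℝ} (ht : ∀ i, 0 ≤ t i)

lemma wt_nonneg (ht : ∀ i, 0 ≤ t i) (α : σ →₀ ℕ) : 0 ≤ α.prod fun i k => t i ^ k :=
  Finset.prod_nonneg fun i _ => pow_nonneg (ht i) _

lemma wt_add (t : σ → ℝ) (α β : σ →₀ ℕ) : ((α + β).prod fun i k => t i ^ k) =
    (α.prod fun i k => t i ^ k) * (β.prod fun i k => t i ^ k) := by
  classical
  exact Finsupp.prod_add_index' (by simp) (fun i a b => pow_add _ _ _)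

lemma wn_eq (h : IsSN N) (t : σ → ℝ) (p : MvPolynomial σ R) (s : Finset (σ →₀ ℕ)) (hs : p.support ⊆ s) :
    wn N t p = ∑ α ∈ s, N (coeff α p) * α.prod fun i k => t i ^ k := by
  apply Finset.sum_subset hs
  intro α _ hα
  rw [notMem_support_iff] at hα
  rw [hα, h.zero, zero_mul]

lemma wn_nonneg (h : IsSN N) (ht : ∀ i, 0 ≤ t i) (p : MvPolynomial σ R) : 0 ≤ wn N t p :=
  Finset.sum_nonneg fun α _ => mul_nonneg (h.nonneg _) (wt_nonneg ht α)

lemma coeff_le_wn (h : IsSN N) (ht : ∀ i, 0 ≤ t i) (p : MvPolynomial σ R) (α : σ →₀ ℕ) :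
    N (coeff α p) * (α.prod fun i k => t i ^ k) ≤ wn N t p := by
  classical
  rw [wn_eq h t p (insert α p.support) (Finset.subset_insert _ _)]
  exact Finset.single_le_sum (f := fun α => N (coeff α p) * α.prod fun i k => t i ^ k)
    (fun α _ => mul_nonneg (h.nonneg _) (wt_nonneg ht α)) (Finset.mem_insert_self _ _)

lemma wn_add (h : IsSN N) (ht : ∀ i, 0 ≤ t i) (p q : MvPolynomial σ R) :
    wn N t (p + q) ≤ wn N t p + wn N t q := by
  classical
  rw [wn_eq h t (p+q) (p.support ∪ q.support) support_add, wn_eq h t p (p.support ∪ q.support) Finset.subset_union_left,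
    wn_eq h t q (p.support ∪ q.support) Finset.subset_union_right, ← Finset.sum_add_distrib]
  apply Finset.sum_le_sum
  intro α _
  rw [coeff_add, ← add_mul]
  exact mul_le_mul_of_nonneg_right (h.add _ _) (wt_nonneg ht α)

lemma wn_sum (h : IsSN N) (ht : ∀ i, 0 ≤ t i) {ι : Type*} (s : Finset ι) (f : ι → MvPolynomial σ R) :
    wn N t (∑ i ∈ s, f i) ≤ ∑ i ∈ s, wn N t (f i) := by
  classical
  induction s using Finset.induction_on with
  | empty => simp [wn]
  | insert a s ha ih =>
    rw [Finset.sum_insert ha, Finset.sum_insert ha]; exact (wn_add h ht _ _).trans (by gcongr)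

lemma wn_monomial (h : IsSN N) (t : σ → ℝ) (α : σ →₀ ℕ) (c : R) :
    wn N t (monomial α c) = N c * α.prod fun i k => t i ^ k := by
  classical
  rw [wn_eq h t _ {α} support_monomial_subset]
  simp

lemma wn_isSN (h : IsSN N) (ht : ∀ i, 0 ≤ t i) : IsSN (wn N t) := by
  refine ⟨wn_nonneg h ht, by simp [wn], ?_, wn_add h ht, ?_⟩
  · have := wn_monomial h t 0 1
    simp only [Finsupp.prod_zero_index, mul_one] at this
    rw [show (1 : MvPolynomial σ R) = monomial 0 1 from rfl, this]
    exact h.one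
  · intro p q
    conv_lhs => rw [p.as_sum, q.as_sum, Finset.sum_mul_sum]
    refine (wn_sum h ht _ _).trans ?_
    rw [wn, wn, Finset.sum_mul_sum]
    apply Finset.sum_le_sum; intro α _
    refine (wn_sum h ht _ _).trans ?_
    apply Finset.sum_le_sum; intro β _
    rw [monomial_mul, wn_monomial h, wt_add]
    calc N (coeff α p * coeff β q) * ((α.prod fun i k => t i ^ k) * (β.prod fun i k => t i ^ k))
        ≤ (N (coeff α p) * N (coeff β q)) * ((α.prod fun i k => t i ^ k) * (β.prod fun i k => t i ^ k)) :=
          mul_le_mul_of_nonneg_right (h.mul _ _) (mul_nonneg (wt_nonneg ht _) (wt_nonneg ht _))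
      _ = _ := by ring

lemma wn_C (h : IsSN N) (t : σ → ℝ) (c : R) : wn N t (C c) = N c := by
  rw [show (C c : MvPolynomial σ R) = monomial 0 c from rfl, wn_monomial h]; simp

lemma wn_X (h : IsSN N) (ht : ∀ i, 0 ≤ t i) (i : σ) : wn N t (X i) ≤ t i := by
  rw [show (X i : MvPolynomial σ R) = monomial (Finsupp.single i 1) 1 from rfl, wn_monomial h]
  rw [Finsupp.prod_single_index (by simp), pow_one]
  calc N 1 * t i ≤ 1 * t i := mul_le_mul_of_nonneg_right h.one (ht i)
    _ = _ := one_mul _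

lemma SN_eval (h : IsSN N) (hintg : ∀ c : ℤ, N (c : R) ≤ |(c:ℝ)|) {τ : Type*} (l : τ → R) (Q : MvPolynomial τ ℤ)
    (B : ℝ) (hB0 : 0 ≤ B) (hB : ∀ α ∈ Q.support, (α.prod fun x k => N (l x) ^ k) ≤ B) :
    N (eval₂Hom (Int.castRingHom R) l Q) ≤ n1 Q * B := by
  conv_lhs => rw [Q.as_sum, map_sum]
  refine (h.sum _ _).trans ?_
  rw [n1, Finset.sum_mul]
  apply Finset.sum_le_sum
  intro α hα
  rw [eval₂Hom_monomial]
  refine (h.mul _ _).trans ?_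
  refine mul_le_mul (hintg _) ?_ (h.nonneg _) (abs_nonneg _)
  refine le_trans ?_ (hB α hα)
  rw [Finsupp.prod, Finsupp.prod]
  refine (h.prod _ _).trans ?_
  exact Finset.prod_le_prod (fun _ _ => h.nonneg _) (fun x _ => h.pow _ _)

lemma abv_int_le {K : Type*} [Field K] (v : AbsoluteValue K ℝ) (c : ℤ) : v (c : K) ≤ |(c:ℝ)| := by
  have hn : ∀ k : ℕ, v (k : K) ≤ k := by
    intro k
    induction k with
    | zero => simp
    | succ k ih =>
      push_cast
      exact (v.add_le _ _).trans (by rw [v.map_one]; linarith)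
  obtain ⟨k, rfl | rfl⟩ := Int.eq_nat_or_neg c
  · simpa using hn k
  · simpa using hn k
end wn

section red
variable {m n : ℕ} {K : Type*} [Field K]

/-- ideal of polynomials of large index -/
def idl (w : Fin m → ℝ) (hw : ∀ j, 0 ≤ w j) (t : ℝ) : Ideal (MvPolynomial (Fin m) K) where
  carrier := {Q | IndGe w t Q}
  zero_mem' := by intro I hI; simp at hI
  add_mem' := by
    intro a b ha hb I hI
    rw [coeff_add] at hI
    by_cases h : coeff I a = 0
    · rw [h, zero_add] at hI; exact hb I hI
    · exact ha I h
  smul_mem' := by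
    intro c x hx
    have h0 : IndGe w 0 c := fun I _ => wsum_nonneg hw I
    have := h0.mul hx
    rw [zero_add] at this
    exact this

lemma mem_idl (w : Fin m → ℝ) (hw : ∀ j, 0 ≤ w j) (t : ℝ) (Q : MvPolynomial (Fin m) K) :
    Q ∈ idl w hw t ↔ IndGe w t Q := Iff.rfl

lemma map_idl_hom {σ τ A : Type*} [CommRing A] (J : Ideal A) (φ : MvPolynomial σ A →ₐ[A] MvPolynomial τ A)
    (F : MvPolynomial σ A) (hF : F ∈ J.map (C : A →+* MvPolynomial σ A)) :
    φ F ∈ J.map (C : A →+* MvPolynomial τ A) := by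
  have h1 := Ideal.mem_map_of_mem φ.toRingHom hF
  rw [Ideal.map_map] at h1
  have h2 : φ.toRingHom.comp (C : A →+* MvPolynomial σ A) = C := by
    ext1 a
    exact φ.commutes a
  rwa [h2] at h1

/-- the substitution after reduction -/
noncomputable def ysub (i0 k : Fin n) (ρ : Fin m → Fin n → K) (x : Fin m × Fin n) :
    MvPolynomial (Fin m × Fin n) (MvPolynomial (Fin m) K) :=
  if x.2 = i0 then C (X x.1) + ∑ l ∈ Finset.univ.erase i0, C (C (ρ x.1 l)) * (if l = k then 1 else X (x.1, l))
  else (if x.2 = k then 1 else X x)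

/-- restriction of exponents -/
noncomputable def resx (i0 k : Fin n) (α : Fin m × Fin n →₀ ℕ) : Fin m × Fin n →₀ ℕ :=
  α.filter (fun x => x.2 ≠ i0 ∧ x.2 ≠ k)

/-- the `i0` part -/
noncomputable def i0x (i0 : Fin n) (α : Fin m × Fin n →₀ ℕ) : Fin m →₀ ℕ :=
  Finsupp.equivFunOnFinite.symm (fun j => α (j, i0))

lemma ysub_monomial (i0 k : Fin n) (hk : k ≠ i0) (ρ : Fin m → Fin n → K) (α : Fin m × Fin n →₀ ℕ) :
    (α.prod fun x e => ysub i0 k ρ x ^ e) =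
      monomial (resx i0 k α) 1 * ∏ j, ysub i0 k ρ (j, i0) ^ (α (j, i0)) := by
  classical
  rw [Finsupp.prod_fintype _ _ (by simp), Fintype.prod_prod_type]
  rw [monomial_eq, C_1, one_mul, Finsupp.prod_fintype _ _ (by simp), Fintype.prod_prod_type, ← Finset.prod_mul_distrib]
  apply Finset.prod_congr rfl; intro j _
  rw [← Finset.prod_erase_mul _ _ (Finset.mem_univ i0)]
  congr 1
  rw [← Finset.prod_erase_mul Finset.univ (fun y => (X (j,y) : MvPolynomial (Fin m × Fin n) (MvPolynomial (Fin m) K)) ^ (resx i0 k α) (j,y)) (Finset.mem_univ i0)]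
  have h1 : (resx i0 k α) (j, i0) = 0 := by
    rw [resx, Finsupp.filter_apply_neg]; simp
  rw [h1, pow_zero, mul_one]
  apply Finset.prod_congr rfl
  intro i hi
  have hi0 := (Finset.mem_erase.1 hi).1
  by_cases hik : i = k
  · subst hik
    have h2 : (resx i0 i α) (j, i) = 0 := by
      rw [resx, Finsupp.filter_apply_neg]; simp
    rw [h2]; simp [ysub, hi0]
  · have h2 : (resx i0 k α) (j, i) = α (j, i) := by
      rw [resx, Finsupp.filter_apply_pos]; simp [hi0, hik]
    rw [h2]; simp [ysub, hi0, hik]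

lemma constCoeff_ysub (i0 k : Fin n) (hk : k ≠ i0) (ρ : Fin m → Fin n → K) (j : Fin m) :
    constantCoeff (ysub i0 k ρ (j, i0)) = X j + C (ρ j k) := by
  classical
  simp only [ysub, if_true, map_add, constantCoeff_C, map_sum, map_mul]
  congr 1
  rw [Finset.sum_eq_single k]
  · simp
  · intro l _ hl; simp [hl]
  · intro h; exact (h (Finset.mem_erase.2 ⟨hk, Finset.mem_univ _⟩)).elim

theorem reduce_poly [CharZero K] (i0 k : Fin n) (hk : k ≠ i0) (ρ : Fin m → Fin n → K) (r : Fin m → ℕ)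
    (P : MvPolynomial (Fin m × Fin n) ℤ) (hP : P ≠ 0) (hh : IsWeightedHomogeneous (bw m n) P r) :
    ∃ (p : MvPolynomial (Fin m) ℤ) (μ : Fin m × Fin n →₀ ℕ), p ≠ 0 ∧ (∀ j, degreeOf j p ≤ r j) ∧ n1 p ≤ n1 P ∧
      coeff μ (eval₂Hom (Int.castRingHom _) (ysub i0 k ρ) P) =
        tr (fun j => ρ j k) (map (Int.castRingHom K) p) := by
  classical
  obtain ⟨αs, hαs, hmin⟩ := Finset.exists_min_image P.support (fun α => (resx i0 k α).degree)
    (by rwa [Finset.nonempty_iff_ne_empty, Ne, support_eq_empty])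
  set μ := resx i0 k αs with hμ
  set Sx := P.support.filter (fun α => resx i0 k α = μ) with hSx
  have hinj : ∀ α ∈ Sx, ∀ β ∈ Sx, i0x i0 α = i0x i0 β → α = β := by
    intro α hα β hβ hab
    obtain ⟨hα1, hα2⟩ := Finset.mem_filter.1 hα
    obtain ⟨hβ1, hβ2⟩ := Finset.mem_filter.1 hβ
    have hout : ∀ j i, i ≠ k → α (j, i) = β (j, i) := by
      intro j i hik
      by_cases hi : i = i0
      · subst hi; exact DFunLike.congr_fun hab j
      · have := DFunLike.congr_fun (hα2.trans hβ2.symm) (j, i)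
        rwa [resx, resx, Finsupp.filter_apply_pos (fun x : Fin m × Fin n => x.2 ≠ i0 ∧ x.2 ≠ k) _ ⟨hi, hik⟩,
          Finsupp.filter_apply_pos (fun x : Fin m × Fin n => x.2 ≠ i0 ∧ x.2 ≠ k) _ ⟨hi, hik⟩] at this
    ext ⟨j, i⟩
    by_cases hik : i = k
    · subst hik
      have h1 := congrFun (hh (mem_support_iff.1 hα1)) j
      have h2 := congrFun (hh (mem_support_iff.1 hβ1)) j
      rw [weight_bw, ← Finset.add_sum_erase _ _ (Finset.mem_univ i)] at h1 h2
      have h3 : ∑ x ∈ Finset.univ.erase i, α (j, x) = ∑ x ∈ Finset.univ.erase i, β (j, x) :=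
        Finset.sum_congr rfl fun x hx => hout j x (Finset.mem_erase.1 hx).1
      omega
    · exact hout j i hik
  have hαsS : αs ∈ Sx := Finset.mem_filter.2 ⟨hαs, rfl⟩
  refine ⟨∑ α ∈ Sx, monomial (i0x i0 α) (coeff α P), μ, ?_, ?_, ?_, ?_⟩
  · intro h
    have h1 := congrArg (coeff (i0x i0 αs)) h
    rw [coeff_sum, Finset.sum_eq_single αs] at h1
    · rw [coeff_monomial, if_pos rfl] at h1
      exact (mem_support_iff.1 hαs) (by simpa using h1)
    · intro α hα hne
      rw [coeff_monomial, if_neg]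
      intro h2; exact hne (hinj α hα αs hαsS h2)
    · intro h2; exact (h2 hαsS).elim
  · intro j
    rw [degreeOf_le_iff]
    intro β hβ
    rw [mem_support_iff, coeff_sum] at hβ
    obtain ⟨α, hα, hne⟩ := Finset.exists_ne_zero_of_sum_ne_zero hβ
    rw [coeff_monomial] at hne
    have h1 : i0x i0 α = β := by by_contra h2; exact hne (if_neg h2)
    rw [← h1]
    have h2 := congrFun (hh (mem_support_iff.1 (Finset.mem_filter.1 hα).1)) j
    rw [weight_bw] at h2
    rw [← h2]
    exact Finset.single_le_sum (f := fun i => α (j, i)) (fun _ _ => Nat.zero_le _) (Finset.mem_univ i0)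
  · refine (n1_sum _ _).trans ?_
    calc ∑ α ∈ Sx, n1 (monomial (i0x i0 α) (coeff α P)) ≤ ∑ α ∈ Sx, |((coeff α P : ℤ) : ℝ)| :=
          Finset.sum_le_sum fun α _ => n1_monomial _ _
      _ ≤ n1 P := Finset.sum_le_sum_of_subset_of_nonneg (Finset.filter_subset _ _) (fun _ _ _ => abs_nonneg _)
  · conv_lhs => rw [P.as_sum, map_sum, coeff_sum]
    rw [map_sum, map_sum, hSx, Finset.sum_filter]
    apply Finset.sum_congr rfl
    intro α hα
    rw [eval₂Hom_monomial, ysub_monomial i0 k hk]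
    have hcast : (Int.castRingHom (MvPolynomial (Fin m × Fin n) (MvPolynomial (Fin m) K))) (coeff α P) =
        C (C ((coeff α P : ℤ) : K)) := by simp
    rw [hcast, coeff_C_mul, coeff_monomial_mul']
    by_cases hle : resx i0 k α = μ
    · rw [if_pos hle, if_pos (le_of_eq hle), hle, tsub_self, one_mul]
      rw [show coeff 0 (∏ j, ysub i0 k ρ (j, i0) ^ α (j, i0)) = constantCoeff (∏ j, ysub i0 k ρ (j, i0) ^ α (j, i0)) from rfl]
      rw [map_prod]
      simp_rw [map_pow, constCoeff_ysub i0 k hk]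
      rw [map_monomial, tr, aeval_monomial, Finsupp.prod_fintype _ _ (by simp)]
      rfl
    · rw [if_neg hle, if_neg, mul_zero]
      intro hle2
      apply hle
      have h1 := hmin α hα
      by_contra hne
      have h3 : (resx i0 k α).degree < μ.degree := by
        obtain ⟨δ, hδ⟩ := exists_add_of_le hle2
        rw [hδ, map_add]
        have hd : δ ≠ 0 := by
          rintro rfl; exact hne (by rw [hδ, add_zero])
        have := mt (Finsupp.degree_eq_zero_iff δ).1 hd
        omega
      omega
end red
end MLT

set_option linter.unusedSectionVars false
namespace MLT
open MvPolynomial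

section cs
variable {R σ : Type*} [CommRing R]

/-- polynomials with coefficients in a subring -/
def cSub (O : Subring R) : Subring (MvPolynomial σ R) where
  carrier := {p | ∀ α, coeff α p ∈ O}
  zero_mem' := by intro α; simp
  one_mem' := by
    classical
    intro α; rw [coeff_one]; split_ifs
    · exact O.one_mem
    · exact O.zero_mem
  add_mem' := by intro a b ha hb α; rw [coeff_add]; exact O.add_mem (ha α) (hb α)
  neg_mem' := by intro a ha α; rw [coeff_neg]; exact O.neg_mem (ha α)
  mul_mem' := by
    classical
    intro a b ha hb α; rw [coeff_mul]
    exact O.sum_mem fun x _ => O.mul_mem (ha _) (hb _)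

lemma C_mem_cSub (O : Subring R) {c : R} (hc : c ∈ O) : (C c : MvPolynomial σ R) ∈ cSub O := by
  classical
  intro α; rw [coeff_C]; split_ifs
  · exact hc
  · exact O.zero_mem

lemma X_mem_cSub (O : Subring R) (i : σ) : (X i : MvPolynomial σ R) ∈ cSub O := by
  classical
  intro α; rw [coeff_X']; split_ifs
  · exact O.one_mem
  · exact O.zero_mem

lemma eval_mem_subring (O : Subring R) {τ : Type*} (l : τ → R) (hl : ∀ x, l x ∈ O) (Q : MvPolynomial τ ℤ) :
    eval₂Hom (Int.castRingHom R) l Q ∈ O := by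
  rw [coe_eval₂Hom, eval₂_eq]
  refine O.sum_mem fun d _ => O.mul_mem ?_ (O.prod_mem fun i _ => O.pow_mem (hl i) _)
  exact intCast_mem O _
end cs

section num
lemma num_lem {m n : ℕ} (hn : 1 ≤ n) (r : Fin m → ℕ) (hr : ∀ j, 1 ≤ r j) (q : Fin m → ℝ) (D : ℝ) (hD : 0 ≤ D)
    (h1 : ∀ j, D - q j ≤ q j * r j) (h2 : ∀ j, q j * r j ≤ D) (e : Fin n → ℝ) (E : ℝ) (hE : ∀ i, |e i| ≤ E)
    (ε : ℝ) (hε : 0 ≤ ε)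
    (α : Fin m → Fin n → ℕ) (ha : ∀ j, ∑ i, α j i = r j) (hb : ∀ i, ∑ j, (α j i : ℝ) / r j ≤ m * (1 / n + ε)) :
    ∑ j, ∑ i, (α j i : ℝ) * (e i * q j) ≤ D * m * (∑ i, e i) / n + D * m * E * n ^ 2 * ε + E * ∑ j, q j := by
  have hn0 : (0:ℝ) < n := by exact_mod_cast hn
  have hE0 : 0 ≤ E := (abs_nonneg _).trans (hE ⟨0, hn⟩)
  have hrp : ∀ j, (0:ℝ) < r j := fun j => by exact_mod_cast hr j
  set β : Fin m → Fin n → ℝ := fun j i => (α j i : ℝ) / r j with hβ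
  have hβ0 : ∀ j i, 0 ≤ β j i := fun j i => by positivity
  have hβ1 : ∀ j, ∑ i, β j i = 1 := by
    intro j
    rw [hβ]; simp only
    rw [← Finset.sum_div, ← Nat.cast_sum, ha j, div_self (hrp j).ne']
  set s : Fin n → ℝ := fun i => ∑ j, β j i with hs
  have hstot : ∑ i, s i = m := by
    rw [hs]; simp only; rw [Finset.sum_comm]; simp [hβ1]
  have hsu : ∀ i, s i - m / n ≤ m * ε := by
    intro i; have := hb i
    have h3 : (m:ℝ) * (1 / n + ε) = m / n + m * ε := by ring
    rw [h3] at this; simp only [hs, hβ]; linarith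
  have hsl : ∀ i, -(n * m * ε) ≤ s i - m / n := by
    intro i
    have h3 : ∑ i', (s i' - m / n) = 0 := by
      rw [Finset.sum_sub_distrib, hstot]; simp; field_simp; ring
    rw [← Finset.add_sum_erase _ _ (Finset.mem_univ i)] at h3
    have h4 : ∑ i' ∈ Finset.univ.erase i, (s i' - m / n) ≤ ∑ i' ∈ Finset.univ.erase i, m * ε :=
      Finset.sum_le_sum fun i' _ => hsu i'
    have h5 : ∑ i' ∈ Finset.univ.erase i, m * ε ≤ ∑ i' : Fin n, m * ε :=
      Finset.sum_le_sum_of_subset_of_nonneg (Finset.erase_subset _ _) (fun _ _ _ => by positivity)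
    simp at h5
    have h6 : ∑ i' ∈ Finset.univ.erase i, m * ε = ((Finset.univ.erase i).card : ℝ) * (m * ε) := by simp
    have h7 : ((Finset.univ.erase i).card : ℝ) ≤ n := by
      have := Finset.card_le_card (Finset.erase_subset i (Finset.univ : Finset (Fin n)))
      simp only [Finset.card_univ, Fintype.card_fin] at this
      exact_mod_cast this
    have h8 : ((Finset.univ.erase i).card : ℝ) * (m * ε) ≤ n * (m * ε) := by gcongr
    rw [h6] at h4
    linarith
  have habs : ∀ i, |s i - m / n| ≤ n * m * ε := by
    intro i
    rw [abs_le]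
    refine ⟨hsl i, (hsu i).trans ?_⟩
    have : (1:ℝ) ≤ n := by exact_mod_cast hn
    have h3 : 0 ≤ m * ε := by positivity
    nlinarith
  have e1 : ∀ j i, (α j i : ℝ) * (e i * q j) = D * (e i * β j i) + e i * β j i * (q j * r j - D) := by
    intro j i
    simp only [hβ]; have := (hrp j).ne'; field_simp; ring
  simp_rw [e1, Finset.sum_add_distrib]
  have e2 : ∑ j, ∑ i, D * (e i * β j i) = D * m * (∑ i, e i) / n + D * ∑ i, e i * (s i - m / n) := by
    rw [Finset.sum_comm]
    have : D * m * (∑ i, e i) / n = D * ∑ i, e i * (m / n) := by rw [← Finset.sum_mul]; ring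
    rw [this, ← mul_add, ← Finset.sum_add_distrib, Finset.mul_sum]
    apply Finset.sum_congr rfl; intro i _
    rw [← Finset.mul_sum, ← Finset.mul_sum, ← mul_add]; congr 2; simp only [hs]; ring
  have e3 : ∑ i, e i * (s i - m / n) ≤ ∑ i : Fin n, E * (n * m * ε) := by
    apply Finset.sum_le_sum; intro i _
    refine (le_abs_self _).trans ?_
    rw [abs_mul]
    exact mul_le_mul (hE i) (habs i) (abs_nonneg _) hE0
  have e4 : ∑ j, ∑ i, e i * β j i * (q j * r j - D) ≤ ∑ j, ∑ i, E * β j i * q j := by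
    apply Finset.sum_le_sum; intro j _
    apply Finset.sum_le_sum; intro i _
    have hq : 0 ≤ q j := by
      by_contra hq; push Not at hq
      have := h1 j
      nlinarith [hrp j]
    refine (le_abs_self _).trans ?_
    rw [abs_mul, abs_mul, abs_of_nonneg (hβ0 j i)]
    refine mul_le_mul (mul_le_mul_of_nonneg_right (hE i) (hβ0 j i)) ?_ (abs_nonneg _) (mul_nonneg hE0 (hβ0 j i))
    rw [abs_le]; constructor
    · linarith [h1 j]
    · linarith [h2 j]
  have e5 : ∑ j, ∑ i, E * β j i * q j = E * ∑ j, q j := by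
    rw [Finset.mul_sum]
    apply Finset.sum_congr rfl; intro j _
    rw [← Finset.sum_mul, ← Finset.mul_sum, hβ1, mul_one]
  rw [e5] at e4
  have e6 : ∑ i : Fin n, E * (n * m * ε) = m * E * n ^ 2 * ε := by simp; ring
  rw [e6] at e3
  have e7 := mul_le_mul_of_nonneg_left e3 hD
  rw [e2]
  linarith
end num
end MLT

set_option linter.unusedSectionVars false
namespace MLT
open MvPolynomial NumberField

section core
variable {m n : ℕ} {K : Type*} [Field K] {ι : Type*} [Fintype ι]

/-- generic point -/
noncomputable def zv (i0 : Fin n) (ζ : Fin m → ι → Fin n → K) (x : Fin m × Fin n) :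
    MvPolynomial (Fin m × ι) (MvPolynomial (Fin m) K) :=
  (∑ a, C (C (ζ x.1 a x.2)) * X (x.1, a)) + if x.2 = i0 then C (X x.1) else 0

/-- linear forms at the generic point -/
noncomputable def lv (L : Matrix (Fin n) (Fin n) ℤ) (i0 : Fin n) (ζ : Fin m → ι → Fin n → K) (x : Fin m × Fin n) :
    MvPolynomial (Fin m × ι) (MvPolynomial (Fin m) K) :=
  ∑ i', (L x.2 i' : MvPolynomial (Fin m × ι) (MvPolynomial (Fin m) K)) * zv i0 ζ (x.1, i')

lemma eval_lv (L M : Matrix (Fin n) (Fin n) ℤ) (hML : M * L = 1) (i0 : Fin n) (ζ : Fin m → ι → Fin n → K)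
    (P : MvPolynomial (Fin m × Fin n) ℤ) :
    eval₂Hom (Int.castRingHom _) (zv i0 ζ) P = eval₂Hom (Int.castRingHom _) (lv L i0 ζ) (lsub M P) := by
  have : (eval₂Hom (Int.castRingHom _) (zv i0 ζ) : _ →+* MvPolynomial (Fin m × ι) (MvPolynomial (Fin m) K)) =
      (eval₂Hom (Int.castRingHom _) (lv L i0 ζ)).comp (lsub M).toRingHom := by
    apply MvPolynomial.ringHom_ext
    · intro c; simp
    · rintro ⟨j, i⟩
      simp only [eval₂Hom_X', RingHom.comp_apply, AlgHom.toRingHom_eq_coe, RingHom.coe_coe, lsub, aeval_X, map_sum, map_mul,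
        eval₂Hom_C, lv]
      simp only [Finset.mul_sum]
      rw [Finset.sum_comm]
      have h1 : ∀ i'', ∑ i', (Int.castRingHom (MvPolynomial (Fin m × ι) (MvPolynomial (Fin m) K))) (M i i') *
          ((L i' i'' : MvPolynomial (Fin m × ι) (MvPolynomial (Fin m) K)) * zv i0 ζ (j, i'')) =
          (((M * L) i i'' : ℤ) : MvPolynomial (Fin m × ι) (MvPolynomial (Fin m) K)) * zv i0 ζ (j, i'') := by
        intro i''
        rw [Matrix.mul_apply]; push_cast
        rw [Finset.sum_mul]
        apply Finset.sum_congr rfl; intro i' _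
        simp [mul_assoc]
      simp_rw [h1, hML, Matrix.one_apply]
      simp
  exact RingHom.congr_fun this P

lemma lv_eq (L : Matrix (Fin n) (Fin n) ℤ) (i0 : Fin n) (ζ : Fin m → ι → Fin n → K) (j : Fin m) (i : Fin n) :
    lv L i0 ζ (j, i) = (∑ a, C (C (∑ i', (L i i' : K) * ζ j a i')) * X (j, a)) + C (C (L i i0 : K)) * C (X j) := by
  simp only [lv, zv, mul_add, Finset.sum_add_distrib]
  congr 1
  · simp only [Finset.mul_sum]
    rw [Finset.sum_comm]
    apply Finset.sum_congr rfl; intro a _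
    rw [map_sum, map_sum, Finset.sum_mul]
    apply Finset.sum_congr rfl; intro i' _
    simp [mul_assoc]
  · simp

lemma wn_lv (v : AbsoluteValue K ℝ) (L : Matrix (Fin n) (Fin n) ℤ) (i0 : Fin n) (ζ : Fin m → ι → Fin n → K)
    (t : Fin m → ℝ) (ht : ∀ j, 0 ≤ t j) (j : Fin m) (i : Fin n) (B : ℝ) (htB : t j ≤ B)
    (hB : ∀ a, v (∑ i', (L i i' : K) * ζ j a i') ≤ B) :
    wn (wn (fun x => v x) t) (fun _ => 1) (lv L i0 ζ (j, i)) ≤ (Fintype.card ι + msz L) * B := by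
  have h0 := isSN_abv v
  have h1 := wn_isSN h0 ht
  have ht1 : ∀ x : Fin m × ι, (0:ℝ) ≤ (fun _ => 1 : Fin m × ι → ℝ) x := fun _ => zero_le_one
  have h2 := wn_isSN h1 ht1
  have hB0 : 0 ≤ B := (ht j).trans htB
  rw [lv_eq]
  refine (h2.add _ _).trans ?_
  rw [add_mul]
  refine add_le_add ?_ ?_
  · refine (h2.sum _ _).trans ?_
    refine (Finset.sum_le_sum (g := fun _ => B) fun a _ => ?_).trans (by simp)
    refine (h2.mul _ _).trans ?_
    rw [wn_C h1, wn_C h0]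
    calc _ ≤ B * 1 := mul_le_mul (hB a) (wn_X h1 ht1 _) (h2.nonneg _) hB0
      _ = _ := mul_one _
  · refine (h2.mul _ _).trans ?_
    rw [wn_C h1, wn_C h1, wn_C h0]
    refine mul_le_mul ?_ ((wn_X h0 ht j).trans htB) (h1.nonneg _) (zero_le_one.trans (one_le_msz _))
    refine (abv_int_le v _).trans ((Finset.single_le_sum (f := fun i' => |(L i i' : ℝ)|) (fun _ _ => abs_nonneg _) (Finset.mem_univ i0)).trans (row_le_msz L i))

/-- local bound on coefficients -/
lemma coef_bound (hn : 1 ≤ n) (v : AbsoluteValue K ℝ) (L M : Matrix (Fin n) (Fin n) ℤ) (hML : M * L = 1) (i0 : Fin n)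
    (ζ : Fin m → ι → Fin n → K) (P : MvPolynomial (Fin m × Fin n) ℤ)
    (r : Fin m → ℕ) (hr : ∀ j, 1 ≤ r j) (hh : IsWeightedHomogeneous (bw m n) P r)
    (Cc : ℝ) (hP1 : n1 P ≤ Cc ^ (∑ j, r j)) (ε : ℝ) (hε : 0 ≤ ε)
    (hgood : ∀ α, coeff α (lsub M P) ≠ 0 → ∀ i, ∑ j, (α (j,i):ℝ)/r j ≤ m*(1/n+ε))
    (q : Fin m → ℝ) (D : ℝ) (hD : 0 ≤ D)
    (h1 : ∀ j, D - q j ≤ q j * r j) (h2 : ∀ j, q j * r j ≤ D) (e : Fin n → ℝ) (E : ℝ) (hE : ∀ i, |e i| ≤ E)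
    (hb : ∀ j i a, v (∑ i', (L i i' : K) * ζ j a i') ≤ Real.exp (e i * q j))
    (γ : Fin m × ι →₀ ℕ) (I : Fin m →₀ ℕ) (η : ℝ) (hI : ∑ j, (I j : ℝ) / r j < m * η)
    (C3 : ℝ) (hC3 : msz M * Cc * (Fintype.card ι + msz L) ≤ C3) (hCc : 1 ≤ Cc) :
    v (coeff I (coeff γ (eval₂Hom (Int.castRingHom _) (zv i0 ζ) P))) ≤
      Real.exp ((∑ j, (r j : ℝ)) * Real.log C3 + (D * m * (∑ i, e i) / n + D * m * E * n ^ 2 * ε + E * ∑ j, q j)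
        + E * (D * (m * η))) := by
  have hE0 : 0 ≤ E := (abs_nonneg _).trans (hE ⟨0, hn⟩)
  have hrp : ∀ j, (0:ℝ) < r j := fun j => by exact_mod_cast hr j
  have hq : ∀ j, 0 ≤ q j := by
    intro j
    by_contra hq; push Not at hq
    have := h1 j
    nlinarith [hrp j]
  set t : Fin m → ℝ := fun j => Real.exp (-E * q j) with ht
  have ht0 : ∀ j, 0 ≤ t j := fun j => (Real.exp_pos _).le
  have s0 := isSN_abv v
  have s1 := wn_isSN s0 ht0
  have ht1 : ∀ x : Fin m × ι, (0:ℝ) ≤ (fun _ => 1 : Fin m × ι → ℝ) x := fun _ => zero_le_one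
  have s2 := wn_isSN s1 ht1
  set Cl : ℝ := Fintype.card ι + msz L with hCl
  have hCl1 : 1 ≤ Cl := by have := one_le_msz L; have h : (0:ℝ) ≤ Fintype.card ι := by positivity
                           linarith
  have hM1 := one_le_msz M
  have hC3' : 1 ≤ C3 := by
    refine le_trans ?_ hC3
    exact one_le_mul_of_one_le_of_one_le (one_le_mul_of_one_le_of_one_le hM1 hCc) hCl1
  have hlv : ∀ j i, wn (wn (fun x => v x) t) (fun _ => 1) (lv L i0 ζ (j, i)) ≤ Cl * Real.exp (e i * q j) := by
    intro j i
    apply wn_lv v L i0 ζ t ht0 j i _ _ (hb j i)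
    apply Real.exp_le_exp.2
    apply mul_le_mul_of_nonneg_right _ (hq j)
    have := hE i; rw [abs_le] at this; exact this.1
  set Ex : ℝ := D * m * (∑ i, e i) / n + D * m * E * n ^ 2 * ε + E * ∑ j, q j with hEx
  have hlh := lsub_homog M P r hh
  have hev := SN_eval (N := wn (wn (fun x => v x) t) (fun _ => 1)) s2 (fun c => by
      have : (c : MvPolynomial (Fin m × ι) (MvPolynomial (Fin m) K)) = C (C (c : K)) := by simp
      rw [this, wn_C s1, wn_C s0]; exact abv_int_le v c) (lv L i0 ζ) (lsub M P)
      (Cl ^ (∑ j, r j) * Real.exp Ex) (by positivity) (by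
      intro α hα
      have hw : ∀ j, ∑ i, α (j, i) = r j := fun j => by
        rw [← weight_bw]; exact congrFun (hlh (mem_support_iff.1 hα)) j
      have hnum := num_lem hn r hr q D hD h1 h2 e E hE ε hε (fun j i => α (j, i)) hw (hgood α (mem_support_iff.1 hα))
      rw [Finsupp.prod_fintype _ _ (by simp), Fintype.prod_prod_type]
      calc _ ≤ ∏ j, ∏ i, (Cl * Real.exp (e i * q j)) ^ α (j, i) := by
            apply Finset.prod_le_prod (fun j _ => Finset.prod_nonneg fun i _ => pow_nonneg (s2.nonneg _) _)
            intro j _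
            apply Finset.prod_le_prod (fun i _ => pow_nonneg (s2.nonneg _) _)
            intro i _
            exact pow_le_pow_left₀ (s2.nonneg _) (hlv j i) _
        _ = Cl ^ (∑ j, r j) * Real.exp (∑ j, ∑ i, (α (j, i) : ℝ) * (e i * q j)) := by
            simp_rw [mul_pow, Finset.prod_mul_distrib, Finset.prod_pow_eq_pow_sum, hw]
            rw [Real.exp_sum]
            congr 1
            apply Finset.prod_congr rfl; intro j _
            rw [Real.exp_sum]
            apply Finset.prod_congr rfl; intro i _
            rw [← Real.exp_nat_mul]
        _ ≤ _ := by
            apply mul_le_mul_of_nonneg_left (Real.exp_le_exp.2 hnum) (by positivity))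
  rw [← eval_lv L M hML] at hev
  set F := eval₂Hom (Int.castRingHom _) (zv i0 ζ) P with hF
  have c1 := coeff_le_wn s1 ht1 F γ
  simp only [one_pow, Finsupp.prod_fun_one, mul_one] at c1
  have c2 := (coeff_le_wn s0 ht0 (coeff γ F) I).trans (c1.trans hev)
  have hl1 := n1_lsub M P r hh
  have hpr : (I.prod fun j k => t j ^ k) = Real.exp (-(E * ∑ j, I j * q j)) := by
    rw [Finsupp.prod_fintype _ _ (by simp), Finset.mul_sum, ← Finset.sum_neg_distrib, Real.exp_sum]
    apply Finset.prod_congr rfl; intro j _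
    rw [ht]; simp only; rw [← Real.exp_nat_mul]; congr 1; ring
  rw [hpr] at c2
  have c3 : v (coeff I (coeff γ F)) ≤ (n1 (lsub M P) * (Cl ^ (∑ j, r j) * Real.exp Ex)) * Real.exp (E * ∑ j, I j * q j) := by
    have := mul_le_mul_of_nonneg_right c2 (Real.exp_pos (E * ∑ j, I j * q j)).le
    rwa [mul_assoc, ← Real.exp_add, neg_add_cancel, Real.exp_zero, mul_one] at this
  have hsI : ∑ j, (I j : ℝ) * q j ≤ D * (m * η) := by
    calc ∑ j, (I j : ℝ) * q j = ∑ j, ((I j : ℝ) / r j) * (q j * r j) := by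
          apply Finset.sum_congr rfl; intro j _; have := (hrp j).ne'; field_simp
      _ ≤ ∑ j, ((I j : ℝ) / r j) * D := by
          apply Finset.sum_le_sum; intro j _
          exact mul_le_mul_of_nonneg_left (h2 j) (by positivity)
      _ = D * ∑ j, ((I j : ℝ) / r j) := by rw [← Finset.sum_mul, mul_comm]
      _ ≤ _ := mul_le_mul_of_nonneg_left hI.le hD
  have hpow : n1 (lsub M P) * Cl ^ (∑ j, r j) ≤ Real.exp ((∑ j, (r j : ℝ)) * Real.log C3) := by
    have : Real.exp ((∑ j, (r j : ℝ)) * Real.log C3) = C3 ^ (∑ j, r j) := by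
      rw [← Nat.cast_sum, Real.exp_nat_mul, Real.exp_log (by linarith)]
    rw [this]
    calc _ ≤ (msz M ^ (∑ j, r j) * Cc ^ (∑ j, r j)) * Cl ^ (∑ j, r j) := by
          apply mul_le_mul_of_nonneg_right _ (by positivity)
          exact hl1.trans (mul_le_mul_of_nonneg_left hP1 (by positivity))
      _ = (msz M * Cc * Cl) ^ (∑ j, r j) := by rw [mul_pow, mul_pow]
      _ ≤ _ := pow_le_pow_left₀ (by positivity) hC3 _
  refine c3.trans ?_
  rw [Real.exp_add ((∑ j, (r j:ℝ)) * Real.log C3 + Ex), Real.exp_add _ Ex]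
  rw [← mul_assoc]
  refine mul_le_mul (mul_le_mul_of_nonneg_right hpow (Real.exp_pos _).le) ?_ (Real.exp_pos _).le (by positivity)
  exact Real.exp_le_exp.2 (mul_le_mul_of_nonneg_left hsI hE0)

end core

section core2
variable {m n : ℕ} {K : Type*} [Field K] [NumberField K] {ι : Type*} [Fintype ι]

/-- the ring of S-integers -/
def OS (S : Finset (FinitePlace K)) : Subring K where
  carrier := {y | IsSInt S y}
  zero_mem' := by intro v _; simp
  one_mem' := by intro v _; simp
  add_mem' := by
    intro a b ha hb v hv
    exact (fin_nonarch v a b).trans (max_le (ha v hv) (hb v hv))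
  neg_mem' := by
    intro a ha v hv
    have := ha v hv
    change v.1 (-a) ≤ 1
    rw [AbsoluteValue.map_neg]; exact this
  mul_mem' := by
    intro a b ha hb v hv
    rw [map_mul]; exact mul_le_one₀ (ha v hv) (apply_nonneg _ _) (hb v hv)

lemma mem_OS (S : Finset (FinitePlace K)) (y : K) : y ∈ OS S ↔ IsSInt S y := Iff.rfl

lemma F_sint (S : Finset (FinitePlace K)) (i0 : Fin n) (ζ : Fin m → ι → Fin n → K) (hζ : ∀ j a i, IsSInt S (ζ j a i))
    (P : MvPolynomial (Fin m × Fin n) ℤ) (γ I) :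
    IsSInt S (coeff I (coeff γ (eval₂Hom (Int.castRingHom _) (zv i0 ζ) P))) := by
  have : eval₂Hom (Int.castRingHom _) (zv i0 ζ) P ∈ (cSub (cSub (OS S)) : Subring (MvPolynomial (Fin m × ι) (MvPolynomial (Fin m) K))) := by
    apply eval_mem_subring
    rintro ⟨j, i⟩
    apply Subring.add_mem
    · apply Subring.sum_mem; intro a _
      exact Subring.mul_mem _ (C_mem_cSub _ (C_mem_cSub _ (hζ _ _ _))) (X_mem_cSub _ _)
    · simp only; split_ifs
      · exact C_mem_cSub _ (X_mem_cSub _ _)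
      · exact Subring.zero_mem _
  exact this γ I

/-- the geometric reduction -/
lemma reduce_mem (i0 k : Fin n) (hk : k ≠ i0) (ζ : Fin m → ι → Fin n → K) (x : Fin m → Fin n → K) (hx : ∀ j, x j i0 ≠ 0)
    (hspan : ∀ j, ∀ z : Fin n → K, ∑ i, x j i * z i = 0 → ∃ b : ι → K, ∀ i, z i = ∑ a, b a * ζ j a i)
    (r : Fin m → ℕ) (P : MvPolynomial (Fin m × Fin n) ℤ) (hP : P ≠ 0) (hh : IsWeightedHomogeneous (bw m n) P r)
    (J : Ideal (MvPolynomial (Fin m) K)) (hF : eval₂Hom (Int.castRingHom _) (zv i0 ζ) P ∈ J.map C) :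
    ∃ p : MvPolynomial (Fin m) ℤ, p ≠ 0 ∧ (∀ j, degreeOf j p ≤ r j) ∧ n1 p ≤ n1 P ∧
      tr (fun j => - x j k / x j i0) (map (Int.castRingHom K) p) ∈ J := by
  classical
  have hb : ∀ j l, l ≠ i0 → ∃ b : ι → K, ∀ i, (if i = l then 1 else if i = i0 then - x j l / x j i0 else 0) = ∑ a, b a * ζ j a i := by
    intro j l hl
    apply hspan j
    rw [Finset.sum_eq_add l i0 hl]
    · simp [hl.symm]; field_simp [hx j]; ring
    · intro c _ hc; simp [hc.1, hc.2]
    · simp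
    · simp
  choose! b hb using hb
  set ρ : Fin m → Fin n → K := fun j l => - x j l / x j i0 with hρ
  obtain ⟨p, μ, hp0, hpd, hpn, hpc⟩ := reduce_poly i0 k hk ρ r P hP hh
  refine ⟨p, hp0, hpd, hpn, ?_⟩
  let Ψ : MvPolynomial (Fin m × ι) (MvPolynomial (Fin m) K) →ₐ[MvPolynomial (Fin m) K]
      MvPolynomial (Fin m × Fin n) (MvPolynomial (Fin m) K) :=
    aeval (fun y => ∑ l ∈ Finset.univ.erase i0, C (C (b y.1 l y.2)) * (if l = k then 1 else X (y.1, l)))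
  have h1 := map_idl_hom J Ψ _ hF
  have h2 : ∀ y, Ψ (zv i0 ζ y) = ysub i0 k ρ y := by
    rintro ⟨j, i⟩
    simp only [zv, map_add, map_sum, map_mul]
    have e1 : ∀ c : MvPolynomial (Fin m) K, Ψ (C c) = C c := fun c => by
      rw [← algebraMap_eq]; rw [AlgHom.commutes]; rfl
    have e2 : ∀ a, Ψ (X (j, a)) = ∑ l ∈ Finset.univ.erase i0, C (C (b j l a)) * (if l = k then 1 else X (j, l)) := fun a => by
      simp only [Ψ, aeval_X]
    simp_rw [e1, e2, Finset.mul_sum]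
    rw [Finset.sum_comm]
    have e3 : ∀ l ∈ Finset.univ.erase i0, (∑ a, (C (C (ζ j a i)) : MvPolynomial (Fin m × Fin n) (MvPolynomial (Fin m) K)) * (C (C (b j l a)) * (if l = k then 1 else X (j, l)))) =
        C (C (if i = l then 1 else if i = i0 then - x j l / x j i0 else 0)) * (if l = k then 1 else X (j, l)) := by
      intro l hl
      rw [hb j l (Finset.mem_erase.1 hl).1 i, map_sum, map_sum, Finset.sum_mul]
      apply Finset.sum_congr rfl; intro a _
      rw [← mul_assoc, map_mul, map_mul]; ring
    rw [Finset.sum_congr rfl e3]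
    by_cases hi : i = i0
    · subst hi
      simp only [ysub, if_true, e1]
      rw [add_comm]; congr 1
      apply Finset.sum_congr rfl
      intro l hl
      have := (Finset.mem_erase.1 hl).1
      rw [if_neg this.symm]
    · simp only [ysub, hi, if_false, map_zero, add_zero]
      rw [Finset.sum_eq_single i]
      · simp
      · intro l _ hl; simp [hl.symm]
      · intro h; exact (h (Finset.mem_erase.2 ⟨hi, Finset.mem_univ _⟩)).elim
  have h3 : Ψ (eval₂Hom (Int.castRingHom _) (zv i0 ζ) P) = eval₂Hom (Int.castRingHom _) (ysub i0 k ρ) P := by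
    have : Ψ.toRingHom.comp (eval₂Hom (Int.castRingHom _) (zv i0 ζ)) = eval₂Hom (Int.castRingHom _) (ysub i0 k ρ) := by
      apply MvPolynomial.ringHom_ext
      · intro c; simp
      · intro y; simpa using h2 y
    exact RingHom.congr_fun this P
  rw [h3, mem_map_C_iff] at h1
  have := h1 μ
  rwa [hpc] at this
end core2
end MLT

set_option linter.unusedSectionVars false
namespace MLT
open MvPolynomial NumberField

section TR
variable {K : Type*} [Field K] [NumberField K]

lemma pw_sum_pos (S : Finset (FinitePlace K)) : 0 < ∑ p : Pl S, pw p := by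
  obtain ⟨w⟩ := (inferInstance : Nonempty (InfinitePlace K))
  exact Finset.sum_pos (fun p _ => pw_pos p) ⟨Sum.inl w, Finset.mem_univ _⟩

set_option maxHeartbeats 1000000 in
theorem TR (S : Finset (FinitePlace K)) {n : ℕ} (hn : 2 ≤ n) (e : Pl S → Fin n → ℝ)
    (he : ∑ p, ∑ i, pw p * e p i < 0) (Lm Mm : Pl S → Matrix (Fin n) (Fin n) ℤ) (hML : ∀ p, Mm p * Lm p = 1)
    (κ : ℝ) (hκ : 0 < κ) (i0 k : Fin n) (hk : k ≠ i0) {ι : Type*} [Fintype ι]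
    (hyp : ∀ T : ℝ, ∃ q, T ≤ q ∧ ∃ (ζ : ι → Fin n → K) (x : Fin n → K), (∀ a i, IsSInt S (ζ a i)) ∧
      (∀ p i a, pa p (∑ i', (Lm p i i' : K) * ζ a i') ≤ Real.exp (e p i * q)) ∧ x i0 ≠ 0 ∧
      (∀ z : Fin n → K, ∑ i, x i * z i = 0 → ∃ b : ι → K, ∀ i, z i = ∑ a, b a * ζ a i) ∧
      κ * q ≤ hS S (- x k / x i0)) : False := by
  classical
  have hn1 : 1 ≤ n := by omega
  have hn0 : (0:ℝ) < n := by exact_mod_cast hn1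
  set E : ℝ := 1 + ∑ p, ∑ i, |e p i| with hE
  have hEe : ∀ p i, |e p i| ≤ E := by
    intro p i
    have h1 := Finset.single_le_sum (f := fun i => |e p i|) (fun _ _ => abs_nonneg _) (Finset.mem_univ i)
    have h2 := Finset.single_le_sum (f := fun p => ∑ i, |e p i|) (fun _ _ => Finset.sum_nonneg fun _ _ => abs_nonneg _) (Finset.mem_univ p)
    linarith
  have hE1 : 1 ≤ E := by
    have : 0 ≤ ∑ p, ∑ i, |e p i| := Finset.sum_nonneg fun _ _ => Finset.sum_nonneg fun _ _ => abs_nonneg _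
    linarith
  clear_value E
  set W : ℝ := ∑ p : Pl S, pw p with hW
  have hW0 : 0 < W := pw_sum_pos S
  obtain ⟨A, hA⟩ : ∃ A, A = - ∑ p, ∑ i, pw p * e p i := ⟨_, rfl⟩
  have hA0 : 0 < A := by linarith
  obtain ⟨ε, hε0, hε1, hε⟩ : ∃ ε : ℝ, 0 < ε ∧ ε ≤ 1 ∧ W * (E * (n ^ 2 * ε + ε)) ≤ A / (4 * n) := by
    have hden : 0 < W * E * (n ^ 2 + 1) := by positivity
    refine ⟨min 1 (A / (4 * n) / (W * E * (n ^ 2 + 1))), lt_min one_pos (by positivity), min_le_left _ _, ?_⟩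
    have h1 : min 1 (A / (4 * n) / (W * E * (n ^ 2 + 1))) ≤ A / (4 * n) / (W * E * (n ^ 2 + 1)) := min_le_right _ _
    rw [le_div_iff₀ hden] at h1
    linarith
  obtain ⟨m, hm, Cc, hCc, haux⟩ := aux_poly n hn1 Mm ε hε0 hε1
  have hm0 : (0:ℝ) < m := by exact_mod_cast hm
  obtain ⟨C3, hC3⟩ : ∃ C3 : ℝ, ∀ p, msz (Mm p) * Cc * (Fintype.card ι + msz (Lm p)) ≤ C3 := by
    refine ⟨∑ p, msz (Mm p) * Cc * (Fintype.card ι + msz (Lm p)), fun p => ?_⟩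
    apply Finset.single_le_sum (f := fun p => msz (Mm p) * Cc * (Fintype.card ι + msz (Lm p))) (fun p _ => ?_) (Finset.mem_univ p)
    have h1 := one_le_msz (Mm p); have h2 := one_le_msz (Lm p)
    positivity
  obtain ⟨ω, hω, hRL⟩ := RL S m (m * ε) (by positivity)
  obtain ⟨Λ, hΛ1, hΛ2⟩ : ∃ Λ : ℝ, 1 ≤ Λ ∧ 2 / ω ≤ Λ := ⟨max 1 (2 / ω), le_max_left _ _, le_max_right _ _⟩
  obtain ⟨T0, hT1, hT2, hT3⟩ : ∃ T0 : ℝ, 1 ≤ T0 ∧ W * Real.log C3 ≤ A / (4 * n) * T0 ∧ m * Real.log Cc + 1 ≤ ω * κ / 2 * T0 := by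
    refine ⟨max 1 (max (W * Real.log C3 / (A / (4 * n))) ((m * Real.log Cc + 1) / (ω * κ / 2))), le_max_left _ _, ?_, ?_⟩
    · have : W * Real.log C3 / (A / (4 * n)) ≤ max 1 (max (W * Real.log C3 / (A / (4 * n))) ((m * Real.log Cc + 1) / (ω * κ / 2))) :=
        (le_max_left _ _).trans (le_max_right _ _)
      rw [div_le_iff₀ (by positivity)] at this
      linarith
    · have : (m * Real.log Cc + 1) / (ω * κ / 2) ≤ max 1 (max (W * Real.log C3 / (A / (4 * n))) ((m * Real.log Cc + 1) / (ω * κ / 2))) :=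
        (le_max_right _ _).trans (le_max_right _ _)
      rw [div_le_iff₀ (by positivity)] at this
      linarith
  choose g hg ζ x hζ hbd hx hsp hht using hyp
  set Tq : ℕ → ℝ := fun t => Nat.rec T0 (fun _ y => Λ * g y) t with hTq
  have hTs : ∀ t, Tq (t + 1) = Λ * g (Tq t) := fun t => rfl
  have hT0' : ∀ t, T0 ≤ Tq t := by
    intro t
    induction t with
    | zero => exact le_refl _
    | succ t ih =>
      rw [hTs]
      have := hg (Tq t)
      nlinarith
  have hQ0 : ∀ t, T0 ≤ g (Tq t) := fun t => (hT0' t).trans (hg _)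
  have hQm : ∀ s t, s < t → Λ * g (Tq s) ≤ g (Tq t) := by
    intro s t hst
    induction t with
    | zero => omega
    | succ t ih =>
      have h1 : Λ * g (Tq t) ≤ g (Tq (t+1)) := by rw [← hTs]; exact hg _
      rcases Nat.lt_succ_iff_lt_or_eq.1 hst with h | h
      · refine (ih h).trans (le_trans ?_ h1)
        have := hQ0 t
        nlinarith
      · rw [h]; exact h1
  set u : Fin m → ℝ := fun j => Tq (m - 1 - j) with hu
  set q : Fin m → ℝ := fun j => g (u j) with hq
  have hqT : ∀ j, T0 ≤ q j := fun j => hQ0 _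
  have hqp : ∀ j, 0 < q j := fun j => by linarith [hqT j]
  have hqm : ∀ i j : Fin m, i < j → Λ * q j ≤ q i := by
    intro i j hij
    apply hQm
    have := j.2
    have : i.1 < j.1 := hij
    omega
  set Sq := ∑ j, q j with hSq
  have hSq0 : 0 ≤ Sq := Finset.sum_nonneg fun j _ => (hqp j).le
  have hqle : ∀ j, q j ≤ Sq := fun j => Finset.single_le_sum (f := q) (fun j _ => (hqp j).le) (Finset.mem_univ j)
  obtain ⟨D, hD0, hD1, hD2⟩ : ∃ D : ℝ, 0 < D ∧ 2 * Sq ≤ D ∧ W * E * Sq ≤ D * m * (A / (4 * n)) := by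
    have hmA : 0 < m * (A / (4 * n)) := by positivity
    have h0 : 0 ≤ W * E * Sq / (m * (A / (4 * n))) := by positivity
    refine ⟨1 + 2 * Sq + W * E * Sq / (m * (A / (4 * n))), by linarith, by linarith, ?_⟩
    have : W * E * Sq = (W * E * Sq / (m * (A / (4 * n)))) * (m * (A / (4 * n))) := by field_simp
    have h1 : (W * E * Sq / (m * (A / (4 * n)))) * (m * (A / (4 * n))) ≤ (1 + 2 * Sq + W * E * Sq / (m * (A / (4 * n)))) * (m * (A / (4 * n))) := by
      apply mul_le_mul_of_nonneg_right _ hmA.le; linarith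
    exact (this.le.trans h1).trans_eq (mul_assoc _ _ _).symm
  set r : Fin m → ℕ := fun j => ⌊D / q j⌋₊ with hr
  have hr2 : ∀ j, q j * r j ≤ D := by
    intro j
    have := Nat.floor_le (a := D / q j) (by have := hqp j; positivity)
    rw [le_div_iff₀ (hqp j)] at this
    simp only [hr]; linarith
  have hr1 : ∀ j, D - q j ≤ q j * r j := by
    intro j
    have := Nat.lt_floor_add_one (D / q j)
    rw [div_lt_iff₀ (hqp j)] at this
    simp only [hr]; linarith
  have hrD : ∀ j, D / 2 ≤ q j * r j := fun j => by linarith [hr1 j, hqle j, hqp j]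
  have hrp : ∀ j, 1 ≤ r j := by
    intro j
    by_contra h
    have h0 : r j = 0 := by omega
    have := hrD j
    rw [h0] at this; simp at this; linarith
  clear_value r
  have hrR : ∀ j, (r j : ℝ) ≤ D / T0 := by
    intro j
    rw [le_div_iff₀ (by linarith)]
    have h1 := hr2 j
    have h2 : (r j : ℝ) * T0 ≤ r j * q j := mul_le_mul_of_nonneg_left (hqT j) (by positivity)
    linarith
  have hSr : ∑ j, (r j : ℝ) ≤ m * (D / T0) := by
    calc ∑ j, (r j : ℝ) ≤ ∑ j : Fin m, D / T0 := Finset.sum_le_sum fun j _ => hrR j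
      _ = _ := by simp
  have hrω : ∀ i j : Fin m, i < j → (r i : ℝ) ≤ ω * r j := by
    intro i j hij
    have h1 := hqm i j hij
    have h2 : 2 * q j ≤ ω * q i := by
      rw [div_le_iff₀ hω] at hΛ2
      have h3 := mul_le_mul_of_nonneg_right hΛ2 (hqp j).le
      nlinarith [hqp j]
    have h3 := hr2 i
    have h4 := hrD j
    have h5 : (r i:ℝ) * (2 * q j) ≤ r i * (ω * q i) := mul_le_mul_of_nonneg_left h2 (by positivity)
    have h6 : ω * (q i * r i) ≤ ω * D := mul_le_mul_of_nonneg_left h3 hω.le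
    have h7 : ω * D ≤ ω * (2 * (q j * r j)) := mul_le_mul_of_nonneg_left (by linarith) hω.le
    have h8 : (r i:ℝ) * (2 * q j) ≤ (ω * r j) * (2 * q j) := by linarith
    exact le_of_mul_le_mul_right h8 (by linarith [hqp j])
  obtain ⟨P, hP0, hPh, hP1, hPg⟩ := haux r hrp
  -- the coefficients vanish
  have hCc0 : 0 ≤ Real.log Cc := Real.log_nonneg hCc
  have hC31 : 1 ≤ C3 := by
    obtain ⟨w⟩ := (inferInstance : Nonempty (InfinitePlace K))
    refine le_trans ?_ (hC3 (Sum.inl w))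
    have h1 := one_le_msz (Mm (Sum.inl w)); have h2 := one_le_msz (Lm (Sum.inl w))
    have h3 : (0:ℝ) ≤ Fintype.card ι := by positivity
    exact one_le_mul_of_one_le_of_one_le (one_le_mul_of_one_le_of_one_le h1 hCc) (by linarith)
  have hlC3 : 0 ≤ Real.log C3 := Real.log_nonneg hC31
  have hvan : ∀ γ I, ∑ j, (I j : ℝ) / r j < m * ε →
      coeff I (coeff γ (eval₂Hom (Int.castRingHom _) (zv i0 (fun j => ζ (u j))) P)) = 0 := by
    intro γ I hI
    by_contra hne
    have h1 := sum_log_nonneg S hne (F_sint S i0 (fun j => ζ (u j)) (fun j a i => hζ _ _ _) P γ I)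
    have h2 : ∀ p : Pl S, Real.log (pa p (coeff I (coeff γ (eval₂Hom (Int.castRingHom _) (zv i0 (fun j => ζ (u j))) P)))) ≤
        (∑ j, (r j : ℝ)) * Real.log C3 + (D * m * (∑ i, e p i) / n + D * m * E * n ^ 2 * ε + E * Sq) + E * (D * (m * ε)) := by
      intro p
      have h3 := coef_bound hn1 (pa p) (Lm p) (Mm p) (hML p) i0 (fun j => ζ (u j)) P r hrp hPh Cc hP1 ε hε0.le (hPg p) q D hD0.le
        hr1 hr2 (e p) E (hEe p) (fun j i a => hbd _ _ _ _) γ I ε hI C3 (hC3 p) hCc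
      have h4 := Real.log_le_log ((pa p).pos hne) h3
      rwa [Real.log_exp] at h4
    have h5 : ∑ p : Pl S, pw p * Real.log (pa p (coeff I (coeff γ (eval₂Hom (Int.castRingHom _) (zv i0 (fun j => ζ (u j))) P)))) ≤
        ∑ p : Pl S, (pw p * ((∑ j, (r j : ℝ)) * Real.log C3 + D * m * (E * (n ^ 2 * ε + ε)) + E * Sq) + D * m / n * ∑ i, pw p * e p i) := by
      apply Finset.sum_le_sum; intro p _
      refine (mul_le_mul_of_nonneg_left (h2 p) (pw_pos p).le).trans (le_of_eq ?_)
      rw [← Finset.mul_sum]; ring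
    rw [Finset.sum_add_distrib, ← Finset.sum_mul, ← Finset.mul_sum, ← hW, show ∑ p, ∑ i, pw p * e p i = -A by linarith] at h5
    have h6 : W * ((∑ j, (r j : ℝ)) * Real.log C3) ≤ m * D * (A / (4 * n)) := by
      have h7 : (∑ j, (r j : ℝ)) * (W * Real.log C3) ≤ (m * (D / T0)) * (A / (4 * n) * T0) :=
        mul_le_mul hSr hT2 (by positivity) (by positivity)
      have h8 : (m * (D / T0)) * (A / (4 * n) * T0) = m * D * (A / (4 * n)) := by
        have : T0 ≠ 0 := by linarith
        field_simp
      linarith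
    have h9 : D * m * (W * (E * (n ^ 2 * ε + ε))) ≤ D * m * (A / (4 * n)) := mul_le_mul_of_nonneg_left hε (by positivity)
    have h10 : D * m / n * A = 4 * (D * m * (A / (4 * n))) := by field_simp
    have h11 : 0 < D * m * (A / (4 * n)) := by positivity
    have h12 := h1.trans h5
    clear h5 h1 h2
    generalize (∑ j, (r j : ℝ)) = σr at *
    generalize Real.log C3 = lC at *
    generalize E * ((n:ℝ) ^ 2 * ε + ε) = Y at *
    generalize A / (4 * (n:ℝ)) = Z at *
    rw [mul_neg, h10] at h12
    linarith
  have hw : ∀ j, (0:ℝ) ≤ 1 / r j := fun j => by positivity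
  have hmem : eval₂Hom (Int.castRingHom _) (zv i0 (fun j => ζ (u j))) P ∈
      (idl (K := K) (fun j => 1 / (r j : ℝ)) hw (m * ε)).map C := by
    rw [mem_map_C_iff]
    intro γ
    rw [mem_idl]
    intro I hI
    by_contra hlt
    push Not at hlt
    apply hI
    apply hvan
    simpa [wsum, mul_one_div, div_eq_mul_inv] using hlt
  obtain ⟨p, hp0, hpd, hpn, hpm⟩ := reduce_mem i0 k hk (fun j => ζ (u j)) (fun j => x (u j)) (fun j => hx _) (fun j => hsp _) r P hP0 hPh _ hmem
  have hlogp : Real.log (n1 p) ≤ (∑ j, (r j:ℝ)) * Real.log Cc := by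
    have h1 := Real.log_le_log (by linarith [one_le_n1 hp0]) (hpn.trans hP1)
    rwa [Real.log_pow, Nat.cast_sum] at h1
  obtain ⟨I, hI1, hI2⟩ := hRL r (fun j => - x (u j) k / x (u j) i0) p (D / T0) _ hp0 hpd hrp hrω hrR hlogp (by
    intro j
    have h1 := hht (u j)
    have h2 : D / 2 * κ ≤ r j * hS S (- x (u j) k / x (u j) i0) := by
      calc D / 2 * κ ≤ (q j * r j) * κ := mul_le_mul_of_nonneg_right (hrD j) hκ.le
        _ = r j * (κ * q j) := by ring
        _ ≤ _ := mul_le_mul_of_nonneg_left h1 (by positivity)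
    have h3 := mul_le_mul_of_nonneg_left h2 hω.le
    have h4 : (∑ j, (r j:ℝ)) * Real.log Cc ≤ m * (D / T0) * Real.log Cc := mul_le_mul_of_nonneg_right hSr hCc0
    have h5 : (D / T0) * (m * Real.log Cc + 1) ≤ (D / T0) * (ω * κ / 2 * T0) := mul_le_mul_of_nonneg_left hT3 (by positivity)
    have h6 : (D / T0) * (ω * κ / 2 * T0) = ω * (D / 2 * κ) := by
      have : T0 ≠ 0 := by linarith
      field_simp
    nlinarith)
  have h7 := hpm I hI1
  simp only [wsum, mul_one_div] at h7
  linarith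
end TR
end MLT

set_option linter.unusedSectionVars false
namespace MLT
open NumberField Filter

section germs
variable {K : Type*} [Field K]

/-- ultrapower -/
abbrev GF (𝓤 : Ultrafilter ℕ) (K : Type*) := (𝓤 : Filter ℕ).Germ K

noncomputable instance (𝓤 : Ultrafilter ℕ) : Field (GF 𝓤 K) := inferInstance

variable {𝓤 : Ultrafilter ℕ}

/-- representative -/
noncomputable def rep (a : GF 𝓤 K) : ℕ → K := Quotient.out a

lemma coe_rep (a : GF 𝓤 K) : ((rep a : ℕ → K) : GF 𝓤 K) = a := Quotient.out_eq a

lemma rep_coe (f : ℕ → K) : ∀ᶠ t in 𝓤, rep (f : GF 𝓤 K) t = f t :=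
  Germ.coe_eq.1 (coe_rep (f : GF 𝓤 K))

lemma rep_eq_iff (a b : GF 𝓤 K) : a = b ↔ ∀ᶠ t in 𝓤, rep a t = rep b t := by
  conv_lhs => rw [← coe_rep a, ← coe_rep b]
  exact Germ.coe_eq

lemma rep_add (a b : GF 𝓤 K) : ∀ᶠ t in 𝓤, rep (a + b) t = rep a t + rep b t := by
  have := rep_coe (𝓤 := 𝓤) (rep a + rep b)
  rwa [Germ.coe_add, coe_rep, coe_rep] at this

lemma rep_mul (a b : GF 𝓤 K) : ∀ᶠ t in 𝓤, rep (a * b) t = rep a t * rep b t := by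
  have := rep_coe (𝓤 := 𝓤) (rep a * rep b)
  rwa [Germ.coe_mul, coe_rep, coe_rep] at this

lemma rep_neg (a : GF 𝓤 K) : ∀ᶠ t in 𝓤, rep (-a) t = - rep a t := by
  have := rep_coe (𝓤 := 𝓤) (- rep a)
  rwa [Germ.coe_neg, coe_rep] at this

lemma rep_inv (a : GF 𝓤 K) : ∀ᶠ t in 𝓤, rep (a⁻¹) t = (rep a t)⁻¹ := by
  have := rep_coe (𝓤 := 𝓤) ((rep a)⁻¹)
  rwa [Germ.coe_inv, coe_rep] at this

lemma rep_sub (a b : GF 𝓤 K) : ∀ᶠ t in 𝓤, rep (a - b) t = rep a t - rep b t := by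
  filter_upwards [rep_add a (-b), rep_neg b] with t h1 h2
  rw [sub_eq_add_neg, h1, h2, ← sub_eq_add_neg]

lemma rep_div (a b : GF 𝓤 K) : ∀ᶠ t in 𝓤, rep (a / b) t = rep a t / rep b t := by
  filter_upwards [rep_mul a (b⁻¹), rep_inv b] with t h1 h2
  rw [div_eq_mul_inv, h1, h2, ← div_eq_mul_inv]

lemma rep_zero : ∀ᶠ t in 𝓤, rep (0 : GF 𝓤 K) t = 0 := rep_coe (𝓤 := 𝓤) (0 : ℕ → K)
lemma rep_one : ∀ᶠ t in 𝓤, rep (1 : GF 𝓤 K) t = 1 := rep_coe (𝓤 := 𝓤) (1 : ℕ → K)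

lemma rep_ne (a : GF 𝓤 K) (ha : a ≠ 0) : ∀ᶠ t in 𝓤, rep a t ≠ 0 := by
  by_contra h
  rw [Ultrafilter.eventually_not, not_not] at h
  apply ha
  rw [rep_eq_iff]
  filter_upwards [h, rep_zero (𝓤 := 𝓤) (K := K)] with t h1 h2
  rw [h1, h2]

lemma rep_sum {ι : Type*} (s : Finset ι) (f : ι → GF 𝓤 K) : ∀ᶠ t in 𝓤, rep (∑ i ∈ s, f i) t = ∑ i ∈ s, rep (f i) t := by
  classical
  induction s using Finset.induction_on with
  | empty => simpa using rep_zero (𝓤 := 𝓤) (K := K)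
  | insert a s ha ih =>
    filter_upwards [ih, rep_add (f a) (∑ i ∈ s, f i)] with t h1 h2
    rw [Finset.sum_insert ha, Finset.sum_insert ha, h2, h1]

/-- germs with values in a subring -/
def gsub (𝓤 : Ultrafilter ℕ) (O : Subring K) : Subring (GF 𝓤 K) where
  carrier := {a | ∀ᶠ t in 𝓤, rep a t ∈ O}
  zero_mem' := by
    filter_upwards [rep_zero (𝓤 := 𝓤) (K := K)] with t h; rw [h]; exact O.zero_mem
  one_mem' := by
    filter_upwards [rep_one (𝓤 := 𝓤) (K := K)] with t h; rw [h]; exact O.one_mem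
  add_mem' := by
    intro a b ha hb
    filter_upwards [ha, hb, rep_add a b] with t h1 h2 h; rw [h]; exact O.add_mem h1 h2
  neg_mem' := by
    intro a ha
    filter_upwards [ha, rep_neg a] with t h1 h; rw [h]; exact O.neg_mem h1
  mul_mem' := by
    intro a b ha hb
    filter_upwards [ha, hb, rep_mul a b] with t h1 h2 h; rw [h]; exact O.mul_mem h1 h2

lemma mem_gsub (O : Subring K) (a : GF 𝓤 K) : a ∈ gsub 𝓤 O ↔ ∀ᶠ t in 𝓤, rep a t ∈ O := Iff.rfl

lemma coe_mem_gsub (O : Subring K) (f : ℕ → K) (hf : ∀ᶠ t in 𝓤, f t ∈ O) : (f : GF 𝓤 K) ∈ gsub 𝓤 O := by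
  filter_upwards [hf, rep_coe (𝓤 := 𝓤) f] with t h1 h2; rw [h2]; exact h1

lemma gsub_mono {O O' : Subring K} (h : O ≤ O') : gsub 𝓤 O ≤ gsub 𝓤 O' := by
  intro a ha
  exact Eventually.mono ha fun t ht => h ht

end germs

section sz
variable {K : Type*} [Field K] [NumberField K] {𝓤 : Ultrafilter ℕ} {S : Finset (FinitePlace K)} {q : ℕ → ℝ}

/-- exponential size bound -/
def sz (q : ℕ → ℝ) (p : Pl S) (a : GF 𝓤 K) (c : ℝ) : Prop :=
  ∀ ε > 0, ∀ᶠ t in 𝓤, pa p (rep a t) ≤ Real.exp ((c + ε) * q t)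

variable (hq : Tendsto q 𝓤 atTop) {p : Pl S}

lemma ev_pos (hq : Tendsto q 𝓤 atTop) : ∀ᶠ t in 𝓤, 0 < q t := hq.eventually_gt_atTop 0

lemma sz_coe (f : ℕ → K) (c : ℝ) (h : ∀ ε > 0, ∀ᶠ t in 𝓤, pa p (f t) ≤ Real.exp ((c + ε) * q t)) : sz q p (f : GF 𝓤 K) c := by
  intro ε hε
  filter_upwards [h ε hε, rep_coe (𝓤 := 𝓤) f] with t h1 h2
  rw [h2]; exact h1

lemma sz_zero (c : ℝ) : sz q p (0 : GF 𝓤 K) c := by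
  intro ε _
  filter_upwards [rep_zero (𝓤 := 𝓤) (K := K)] with t h
  rw [h, map_zero]; exact (Real.exp_pos _).le

lemma sz.mono (hq : Tendsto q 𝓤 atTop) {a : GF 𝓤 K} {c c' : ℝ} (h : sz q p a c) (hc : c ≤ c') : sz q p a c' := by
  intro ε hε
  filter_upwards [h ε hε, ev_pos hq] with t h1 h2
  refine h1.trans (Real.exp_le_exp.2 ?_)
  exact mul_le_mul_of_nonneg_right (by linarith) h2.le

lemma sz_one (hq : Tendsto q 𝓤 atTop) : sz q p (1 : GF 𝓤 K) 0 := by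
  intro ε hε
  filter_upwards [rep_one (𝓤 := 𝓤) (K := K), ev_pos hq] with t h h2
  rw [h, map_one]; apply Real.one_le_exp; positivity

lemma sz.neg {a : GF 𝓤 K} {c : ℝ} (h : sz q p a c) : sz q p (-a) c := by
  intro ε hε
  filter_upwards [h ε hε, rep_neg a] with t h1 h2
  rwa [h2, AbsoluteValue.map_neg]

lemma sz.mul {a b : GF 𝓤 K} {c c' : ℝ} (h : sz q p a c) (h' : sz q p b c') : sz q p (a * b) (c + c') := by
  intro ε hε
  filter_upwards [h (ε/2) (by linarith), h' (ε/2) (by linarith), rep_mul a b] with t h1 h2 h3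
  rw [h3, map_mul, show (c + c' + ε) * q t = (c + ε/2) * q t + (c' + ε/2) * q t by ring, Real.exp_add]
  exact mul_le_mul h1 h2 (AbsoluteValue.nonneg _ _) (Real.exp_pos _).le

lemma sz.add (hq : Tendsto q 𝓤 atTop) {a b : GF 𝓤 K} {c : ℝ} (h : sz q p a c) (h' : sz q p b c) : sz q p (a + b) c := by
  intro ε hε
  have h5 : Tendsto (fun t => (ε/2) * q t) 𝓤 atTop := hq.const_mul_atTop (by linarith)
  filter_upwards [h (ε/2) (by linarith), h' (ε/2) (by linarith), rep_add a b, h5.eventually_ge_atTop 1] with t h1 h2 h3 h4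
  rw [h3, show (c + ε) * q t = (c + ε/2) * q t + ε/2 * q t by ring, Real.exp_add]
  refine (AbsoluteValue.add_le _ _ _).trans ?_
  have h6 : 2 ≤ Real.exp (ε/2 * q t) := by linarith [Real.add_one_le_exp (ε/2 * q t)]
  nlinarith [Real.exp_pos ((c + ε/2) * q t)]

lemma sz_sum (hq : Tendsto q 𝓤 atTop) {ι : Type*} (s : Finset ι) (f : ι → GF 𝓤 K) (c : ℝ) (h : ∀ i ∈ s, sz q p (f i) c) :
    sz q p (∑ i ∈ s, f i) c := by
  classical
  induction s using Finset.induction_on with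
  | empty => simpa using sz_zero c
  | insert a s ha ih =>
    rw [Finset.sum_insert ha]
    exact (h a (Finset.mem_insert_self _ _)).add hq (ih fun i hi => h i (Finset.mem_insert_of_mem hi))

lemma sz_prod (hq : Tendsto q 𝓤 atTop) {ι : Type*} (s : Finset ι) (f : ι → GF 𝓤 K) (c : ι → ℝ) (h : ∀ i ∈ s, sz q p (f i) (c i)) :
    sz q p (∏ i ∈ s, f i) (∑ i ∈ s, c i) := by
  classical
  induction s using Finset.induction_on with
  | empty => simpa using sz_one hq
  | insert a s ha ih =>
    rw [Finset.prod_insert ha, Finset.sum_insert ha]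
    exact (h a (Finset.mem_insert_self _ _)).mul (ih fun i hi => h i (Finset.mem_insert_of_mem hi))

lemma sz_det (hq : Tendsto q 𝓤 atTop) {ι : Type*} [Fintype ι] [DecidableEq ι] (D : Matrix ι ι (GF 𝓤 K)) (ρ τ : ι → ℝ)
    (h : ∀ a b, sz q p (D a b) (ρ a + τ b)) : sz q p D.det (∑ a, ρ a + ∑ b, τ b) := by
  rw [Matrix.det_apply]
  apply sz_sum hq
  intro σ _
  have h1 : sz q p (∏ i, D (σ i) i) (∑ a, ρ a + ∑ b, τ b) := by
    have := sz_prod hq Finset.univ (fun i => D (σ i) i) (fun i => ρ (σ i) + τ i) (fun i _ => h _ _)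
    rwa [Finset.sum_add_distrib, Equiv.sum_comp σ ρ] at this
  rcases Int.units_eq_one_or (Equiv.Perm.sign σ) with h2 | h2
  · rw [h2, one_smul]; exact h1
  · rw [h2, Units.neg_smul, one_smul]; exact h1.neg

/-- product formula -/
theorem sz_pf (hq : Tendsto q 𝓤 atTop) {a : GF 𝓤 K} (ha : a ≠ 0) (hS : a ∈ gsub 𝓤 (OS S)) (c : Pl S → ℝ)
    (h : ∀ p, sz q p a (c p)) : 0 ≤ ∑ p : Pl S, pw p * c p := by
  by_contra hneg
  push Not at hneg
  have hW := pw_sum_pos S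
  set W := ∑ p : Pl S, pw p with hWd
  set s := ∑ p : Pl S, pw p * c p with hs
  set ε := -s / (2 * W) with hε
  have hε0 : 0 < ε := by apply div_pos <;> linarith
  have h1 : ∀ᶠ t in 𝓤, ∀ p : Pl S, pa p (rep a t) ≤ Real.exp ((c p + ε) * q t) :=
    eventually_all.2 fun p => h p ε hε0
  obtain ⟨t, h1, h2, h3, h4⟩ := (h1.and ((rep_ne a ha).and (((mem_gsub _ _).1 hS).and (ev_pos hq)))).exists
  have h5 := sum_log_nonneg S h2 h3
  have h6 : ∑ p : Pl S, pw p * Real.log (pa p (rep a t)) ≤ ∑ p : Pl S, (pw p * c p + pw p * ε) * q t := by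
    apply Finset.sum_le_sum; intro p _
    have h7 := Real.log_le_log ((pa p).pos h2) (h1 p)
    rw [Real.log_exp] at h7
    have := mul_le_mul_of_nonneg_left h7 (pw_pos p).le
    linarith
  rw [← Finset.sum_mul, Finset.sum_add_distrib, ← Finset.sum_mul, ← hWd, ← hs] at h6
  have h8 : W * ε = - s / 2 := by rw [hε]; field_simp
  rw [h8] at h6
  nlinarith

/-- product formula, inverse form -/
theorem sz_inv_of (hq : Tendsto q 𝓤 atTop) {a : GF 𝓤 K} (ha : a ≠ 0) (hS : a ∈ gsub 𝓤 (OS S))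
    (h : ∀ p : Pl S, sz q p a 0) (p : Pl S) : sz q p a⁻¹ 0 := by
  classical
  intro ε hε
  have hW := pw_sum_pos S
  set W := ∑ p : Pl S, pw p with hWd
  set ε' := pw p * ε / W with hε'
  have hp := pw_pos p
  have hε0 : 0 < ε' := by positivity
  have h1 : ∀ᶠ t in 𝓤, ∀ p : Pl S, pa p (rep a t) ≤ Real.exp ((0 + ε') * q t) :=
    eventually_all.2 fun p => h p ε' hε0
  filter_upwards [h1, rep_ne a ha, (mem_gsub _ _).1 hS, ev_pos hq, rep_inv a] with t h1 h2 h3 h4 h5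
  rw [h5, map_inv₀]
  have h6 := sum_log_nonneg S h2 h3
  rw [← Finset.add_sum_erase _ _ (Finset.mem_univ p)] at h6
  have h7 : ∑ p ∈ Finset.univ.erase p, pw p * Real.log (pa p (rep a t)) ≤ ∑ p ∈ Finset.univ.erase p, pw p * (ε' * q t) := by
    apply Finset.sum_le_sum; intro p _
    have h7 := Real.log_le_log ((pa p).pos h2) (h1 p)
    rw [Real.log_exp, zero_add] at h7
    exact mul_le_mul_of_nonneg_left h7 (pw_pos p).le
  have h8 : ∑ p ∈ Finset.univ.erase p, pw p * (ε' * q t) ≤ ∑ p : Pl S, pw p * (ε' * q t) :=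
    Finset.sum_le_sum_of_subset_of_nonneg (Finset.erase_subset _ _) (fun p _ _ => by have := pw_pos p; positivity)
  have h8' : ∑ p : Pl S, pw p * (ε' * q t) = W * (ε' * q t) := by rw [hWd, Finset.sum_mul]
  have h9 : W * (ε' * q t) = pw p * (ε * q t) := by rw [hε']; field_simp
  have h10 : pw p * (-(Real.log (pa p (rep a t)))) ≤ pw p * (ε * q t) := by linarith
  have h11 := le_of_mul_le_mul_left h10 hp
  rw [← Real.log_inv] at h11
  have h12 := Real.exp_le_exp.2 h11
  rw [Real.exp_log (inv_pos.2 ((pa p).pos h2))] at h12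
  rwa [zero_add]

/-- argmax -/
theorem argmax (hq : Tendsto q 𝓤 atTop) {ι : Type*} [Fintype ι] (p : Pl S) (α : ι → GF 𝓤 K) (hα : α ≠ 0) (s : ι → ℝ) :
    ∃ l, α l ≠ 0 ∧ ∀ l', sz q p (α l' / α l) (s l - s l') := by
  classical
  have hne : Nonempty ι := by
    by_contra h; rw [not_nonempty_iff] at h; exact hα (Subsingleton.elim _ _)
  have h1 : ∀ t, ∃ l, ∀ l', pa p (rep (α l') t) * Real.exp (s l' * q t) ≤ pa p (rep (α l) t) * Real.exp (s l * q t) := by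
    intro t
    obtain ⟨l, -, hl⟩ := Finset.exists_max_image Finset.univ (fun l => pa p (rep (α l) t) * Real.exp (s l * q t)) Finset.univ_nonempty
    exact ⟨l, fun l' => hl l' (Finset.mem_univ _)⟩
  choose L hL using h1
  obtain ⟨l, hl⟩ : ∃ l, ∀ᶠ t in 𝓤, L t = l := by
    by_contra hcon
    push Not at hcon
    have h2 : ∀ l, ∀ᶠ t in 𝓤, L t ≠ l := hcon
    obtain ⟨t, ht⟩ := (eventually_all.2 h2).exists
    exact ht (L t) rfl
  have hl0 : α l ≠ 0 := by
    intro h0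
    apply hα
    funext l'
    rw [Pi.zero_apply, rep_eq_iff]
    have h2 := rep_zero (𝓤 := 𝓤) (K := K)
    filter_upwards [hl, h2] with t h3 h4
    have h5 := hL t l'
    rw [h3, h0, h4, map_zero, zero_mul] at h5
    have h6 : pa p (rep (α l') t) ≤ 0 := by
      by_contra h; push Not at h
      have := mul_pos h (Real.exp_pos (s l' * q t)); linarith
    have := le_antisymm h6 (AbsoluteValue.nonneg _ _)
    rw [h4]; exact (AbsoluteValue.eq_zero _).1 this
  refine ⟨l, hl0, fun l' ε hε => ?_⟩
  filter_upwards [hl, rep_ne _ hl0, rep_div (α l') (α l), ev_pos hq] with t h1 h2 h3 h4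
  rw [h3, map_div₀, div_le_iff₀ ((pa p).pos h2)]
  have h5 := hL t l'
  rw [h1] at h5
  have h6 : pa p (rep (α l') t) ≤ pa p (rep (α l) t) * Real.exp ((s l - s l') * q t) := by
    have := mul_le_mul_of_nonneg_right h5 (Real.exp_pos (-(s l' * q t))).le
    rw [mul_assoc, ← Real.exp_add, mul_assoc, ← Real.exp_add, add_neg_cancel, Real.exp_zero, mul_one] at this
    rwa [show s l * q t + -(s l' * q t) = (s l - s l') * q t by ring] at this
  refine h6.trans ?_
  rw [mul_comm]
  apply mul_le_mul_of_nonneg_right _ (AbsoluteValue.nonneg _ _)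
  apply Real.exp_le_exp.2
  apply mul_le_mul_of_nonneg_right _ h4.le; linarith
end sz
end MLT

set_option linter.unusedSectionVars false
namespace MLT
open NumberField Filter

section mink
variable (K : Type*) [Field K] [NumberField K]

open NumberField.mixedEmbedding in
lemma mink1 : ∃ C : ℝ, 0 < C ∧ ∀ f : InfinitePlace K → ℝ, (∀ w, 0 < f w) → 1 ≤ ∏ w, f w ^ w.mult →
    ∃ u : 𝓞 K, u ≠ 0 ∧ ∀ w : InfinitePlace K, w u ≤ C * f w := by
  classical
  set M := (minkowskiBound K 1).toReal with hM
  have hM0 : 0 ≤ M := ENNReal.toReal_nonneg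
  refine ⟨M + 1, by linarith, fun f hf h1 => ?_⟩
  set g : InfinitePlace K → NNReal := fun w => ((M + 1) * f w).toNNReal with hg
  have hgc : ∀ w, (g w : ℝ) = (M + 1) * f w := fun w => Real.coe_toNNReal _ (by have := hf w; positivity)
  have hprod : M + 1 ≤ ∏ w, ((M + 1) * f w) ^ w.mult := by
    simp_rw [mul_pow]
    rw [Finset.prod_mul_distrib, Finset.prod_pow_eq_pow_sum, InfinitePlace.sum_mult_eq]
    have h2 : M + 1 ≤ (M + 1) ^ Module.finrank ℚ K := le_self_pow₀ (by linarith) Module.finrank_pos.ne'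
    have h3 : 0 < (M + 1) ^ Module.finrank ℚ K := by positivity
    nlinarith
  have key : minkowskiBound K ↑1 < MeasureTheory.volume (convexBodyLT K g) := by
    rw [convexBodyLT_volume]
    have h4 : minkowskiBound K ↑1 < ENNReal.ofReal (M + 1) := by
      rw [ENNReal.lt_ofReal_iff_toReal_lt (minkowskiBound_lt_top K ↑1).ne]
      show M < M + 1
      linarith
    refine h4.trans_le ?_
    have h5 : ENNReal.ofReal (M + 1) ≤ ((∏ w, (g w) ^ w.mult : NNReal) : ENNReal) := by
      rw [← ENNReal.ofReal_coe_nnreal]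
      apply ENNReal.ofReal_le_ofReal
      push_cast
      simp_rw [hgc]; exact hprod
    refine h5.trans ?_
    push_cast
    apply le_mul_of_one_le_left (zero_le)
    exact ENNReal.one_le_coe_iff.2 (one_le_convexBodyLTFactor K)
  obtain ⟨a, ha, h⟩ := exists_ne_zero_mem_ringOfIntegers_lt K key
  refine ⟨a, ha, fun w => ?_⟩
  have := (h w).le
  rwa [hgc] at this

lemma box : ∃ C : ℝ, 0 < C ∧ ∀ B : InfinitePlace K → ℝ, (∀ w, 0 < B w) →
    ∃ T : Finset (𝓞 K), ∏ w, B w ^ w.mult ≤ T.card ∧ ∀ a ∈ T, ∀ w : InfinitePlace K, w a ≤ C * B w := by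
  classical
  obtain ⟨C, hC, hm⟩ := mink1 K
  set ω := RingOfIntegers.basis K
  set D : ℝ := 1 + ∑ j, ∑ w : InfinitePlace K, w (ω j) with hD
  have hD0 : ∀ w : InfinitePlace K, ∑ j, w (ω j) ≤ D := by
    intro w
    rw [hD, Finset.sum_comm]
    have : ∑ j, w (ω j) ≤ ∑ w : InfinitePlace K, ∑ j, w (ω j) :=
      Finset.single_le_sum (f := fun w : InfinitePlace K => ∑ j, w (ω j)) (fun w _ => Finset.sum_nonneg fun j _ => apply_nonneg _ _) (Finset.mem_univ w)
    linarith
  have hD1 : 0 < D := by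
    have : 0 ≤ ∑ j, ∑ w : InfinitePlace K, w (ω j) := Finset.sum_nonneg fun j _ => Finset.sum_nonneg fun w _ => apply_nonneg _ _
    linarith
  refine ⟨C * D, by positivity, fun B hB => ?_⟩
  set P := ∏ w, B w ^ w.mult with hP
  have hP0 : 0 < P := Finset.prod_pos fun w _ => pow_pos (hB w) _
  by_cases h1 : P < 1
  · refine ⟨{0}, by simpa using h1.le, ?_⟩
    intro a ha w
    rw [Finset.mem_singleton] at ha
    rw [ha]; have := hB w
    simp; positivity
  push Not at h1
  set d := Module.finrank ℚ K with hd
  have hd0 : (d : ℝ) ≠ 0 := by exact_mod_cast Module.finrank_pos.ne'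
  set Y := P ^ ((1 : ℝ) / d) with hY
  have hY0 : 0 < Y := Real.rpow_pos_of_pos hP0 _
  have hYd : Y ^ d = P := by
    rw [hY, ← Real.rpow_natCast, ← Real.rpow_mul hP0.le, one_div_mul_cancel hd0, Real.rpow_one]
  obtain ⟨u, hu, hub⟩ := hm (fun w => B w / Y) (fun w => div_pos (hB w) hY0) (by
    simp_rw [div_pow]
    rw [Finset.prod_div_distrib, Finset.prod_pow_eq_pow_sum, InfinitePlace.sum_mult_eq, ← hd, hYd, ← hP, div_self hP0.ne'])
  set g : (Module.Free.ChooseBasisIndex ℤ (𝓞 K) → ℕ) → 𝓞 K := fun a => u * ∑ j, (a j : ℤ) • ω j with hg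
  have hginj : Function.Injective g := by
    intro a b hab
    have h2 := mul_left_cancel₀ hu hab
    have h3 : ∑ j, ((a j : ℤ) - b j) • ω j = 0 := by
      simp_rw [sub_smul]; rw [Finset.sum_sub_distrib, h2, sub_self]
    funext j
    have := (Fintype.linearIndependent_iff.1 ω.linearIndependent) _ h3 j
    omega
  refine ⟨(Fintype.piFinset fun _ => Finset.range (⌊Y⌋₊ + 1)).image g, ?_, ?_⟩
  · rw [Finset.card_image_of_injective _ hginj, Fintype.card_piFinset]
    simp only [Finset.card_range, Finset.prod_const, Finset.card_univ]
    have hcard : Fintype.card (Module.Free.ChooseBasisIndex ℤ (𝓞 K)) = d := by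
      rw [← Module.finrank_eq_card_chooseBasisIndex, RingOfIntegers.rank]
    rw [hcard, ← hYd]
    push_cast
    exact pow_le_pow_left₀ hY0.le (Nat.lt_floor_add_one Y).le _
  · intro a ha w
    rw [Finset.mem_image] at ha
    obtain ⟨c, hc, rfl⟩ := ha
    rw [Fintype.mem_piFinset] at hc
    have h5 : w ((g c : 𝓞 K) : K) = w (u : K) * w (∑ j, (c j : K) * (ω j : K)) := by
      rw [← map_mul, hg]; congr 1
      simp
    rw [h5]
    have h6 : w (∑ j, (c j : K) * (ω j : K)) ≤ Y * D := by
      calc w (∑ j, (c j : K) * (ω j : K)) ≤ ∑ j, w ((c j : K) * (ω j : K)) := by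
            have := AbsoluteValue.sum_le w.1 Finset.univ (fun j => (c j : K) * (ω j : K))
            exact this
        _ ≤ ∑ j, Y * w (ω j) := by
            apply Finset.sum_le_sum; intro j _
            rw [map_mul]
            apply mul_le_mul_of_nonneg_right _ (apply_nonneg _ _)
            have h7 := hc j
            rw [Finset.mem_range] at h7
            have h8 : w (c j : K) = c j := by
              rw [← w.norm_embedding_eq, map_natCast]; simp
            rw [h8]
            calc (c j : ℝ) ≤ (⌊Y⌋₊ : ℝ) := by exact_mod_cast Nat.lt_succ_iff.1 h7
              _ ≤ Y := Nat.floor_le hY0.le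
        _ ≤ Y * D := by
            rw [← Finset.mul_sum]; exact mul_le_mul_of_nonneg_left (hD0 w) hY0.le
    calc w (u : K) * w (∑ j, (c j : K) * (ω j : K)) ≤ (C * (B w / Y)) * (Y * D) :=
          mul_le_mul (hub w) h6 (apply_nonneg _ _) (by have := hB w; positivity)
      _ = C * D * B w := by field_simp

/-- Minkowski by pigeonhole -/
theorem minkP {ι : Type*} [Fintype ι] [Nonempty ι] : ∃ C : ℝ, 0 < C ∧ ∀ (x : ι → K) (B : InfinitePlace K → ι → ℝ) (R δ : ℝ), (∀ w l, 0 < B w l) →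
    0 < δ → δ ≤ R → (∀ (w : InfinitePlace K) l, w (x l) * B w l ≤ R) →
    (∀ y : K, (∀ w : InfinitePlace K, w y ≤ δ) → (∀ v : FinitePlace K, ∃ i, v y ≤ v (x i)) → y = 0) →
    (C * (R / δ)) ^ (Module.finrank ℚ K) < ∏ l, ∏ w, B w l ^ w.mult →
    ∃ z : ι → 𝓞 K, z ≠ 0 ∧ ∑ l, x l * z l = 0 ∧ ∀ (w : InfinitePlace K) l, w (z l) ≤ C * B w l := by
  classical
  obtain ⟨C, hC, hbox⟩ := box K
  set N : ℝ := (Fintype.card ι : ℝ) with hN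
  have hN1 : 1 ≤ N := by rw [hN]; exact_mod_cast Fintype.card_pos
  set C' : ℝ := 4 * N * C + 2 + 2 * C with hC'
  refine ⟨C', by positivity, fun x B R δ hB hδ hδR hxB hy hcount => ?_⟩
  have hR : 0 < R := hδ.trans_le hδR
  choose T hT1 hT2 using fun l => hbox (fun w => B w l) (fun w => hB w l)
  set ρ : (K →+* ℂ) → K → ℝ := fun σ y => (σ y).re + (σ y).im with hρ
  set Y : (ι → 𝓞 K) → K := fun z => ∑ l, x l * z l with hYd
  set cell : (ι → 𝓞 K) → ((K →+* ℂ) → ℤ) := fun z σ => ⌊ρ σ (Y z) / δ⌋ with hcell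
  set R' := N * (C * R) with hR'
  have hbd : ∀ z ∈ Fintype.piFinset T, ∀ σ, |ρ σ (Y z)| ≤ 2 * R' := by
    intro z hz σ
    rw [Fintype.mem_piFinset] at hz
    have h1 : ‖σ (Y z)‖ ≤ R' := by
      rw [hYd, map_sum]
      calc ‖∑ l, σ (x l * z l)‖ ≤ ∑ l, ‖σ (x l * z l)‖ := norm_sum_le _ _
        _ ≤ ∑ l : ι, C * R := by
            apply Finset.sum_le_sum; intro l _
            rw [map_mul, norm_mul]
            have h2 := hT2 l (z l) (hz l) (InfinitePlace.mk σ)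
            rw [InfinitePlace.apply] at h2
            have h3 := hxB (InfinitePlace.mk σ) l
            rw [InfinitePlace.apply] at h3
            calc ‖σ (x l)‖ * ‖σ (z l)‖ ≤ ‖σ (x l)‖ * (C * B (InfinitePlace.mk σ) l) :=
                  mul_le_mul_of_nonneg_left h2 (norm_nonneg _)
              _ = C * (‖σ (x l)‖ * B (InfinitePlace.mk σ) l) := by ring
              _ ≤ C * R := mul_le_mul_of_nonneg_left h3 hC.le
        _ = R' := by simp [hR', hN]
    have h4 := Complex.abs_re_le_norm (σ (Y z))
    have h5 := Complex.abs_im_le_norm (σ (Y z))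
    have h6 := abs_add_le (σ (Y z)).re (σ (Y z)).im
    show |(σ (Y z)).re + (σ (Y z)).im| ≤ _
    linarith
  set Q : Finset ((K →+* ℂ) → ℤ) := Fintype.piFinset fun _ => Finset.Icc ⌊-(2 * R') / δ⌋ ⌊2 * R' / δ⌋ with hQ
  have hmap : ∀ z ∈ Fintype.piFinset T, cell z ∈ Q := by
    intro z hz
    rw [hQ, Fintype.mem_piFinset]
    intro σ
    have h1 := abs_le.1 (hbd z hz σ)
    rw [Finset.mem_Icc]
    exact ⟨Int.floor_le_floor (div_le_div_of_nonneg_right h1.1 hδ.le), Int.floor_le_floor (div_le_div_of_nonneg_right h1.2 hδ.le)⟩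
  have hcard : Q.card < (Fintype.piFinset T).card := by
    have h1 : (Q.card : ℝ) ≤ (C' * (R / δ)) ^ (Module.finrank ℚ K) := by
      rw [hQ, Fintype.card_piFinset, Finset.prod_const, Finset.card_univ, Embeddings.card, Nat.cast_pow]
      apply pow_le_pow_left₀ (Nat.cast_nonneg _)
      rw [Int.card_Icc]
      have h2 : ((⌊2 * R' / δ⌋ + 1 - ⌊-(2 * R') / δ⌋).toNat : ℝ) ≤ 4 * R' / δ + 2 := by
        have h3 := Int.floor_le (2 * R' / δ)
        have h4 := Int.lt_floor_add_one (-(2 * R') / δ)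
        have h5 : -(2 * R') / δ = - (2 * R' / δ) := by ring
        have h6 : 4 * R' / δ = 2 * R' / δ + 2 * R' / δ := by ring
        have h7 : (0:ℝ) ≤ 2 * R' / δ := by positivity
        rw [h5] at h4 ⊢
        rw [h6]
        have h8 : (((⌊2 * R' / δ⌋ + 1 - ⌊-(2 * R' / δ)⌋).toNat : ℤ) : ℝ) ≤ 2 * R' / δ + 2 * R' / δ + 2 := by
          rcases le_total 0 (⌊2 * R' / δ⌋ + 1 - ⌊-(2 * R' / δ)⌋) with h9 | h9
          · rw [Int.toNat_of_nonneg h9]; push_cast; linarith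
          · rw [Int.toNat_of_nonpos h9]; push_cast; linarith
        exact_mod_cast h8
      refine h2.trans ?_
      have h3 : 1 ≤ R / δ := (one_le_div hδ).2 hδR
      have h4 : 4 * R' / δ = 4 * N * C * (R / δ) := by rw [hR']; ring
      rw [h4, hC']
      nlinarith [mul_pos hC (lt_of_lt_of_le one_pos h3)]
    have h2 : ∏ l, ∏ w, B w l ^ w.mult ≤ ((Fintype.piFinset T).card : ℝ) := by
      rw [Fintype.card_piFinset, Nat.cast_prod]
      exact Finset.prod_le_prod (fun l _ => Finset.prod_nonneg fun w _ => (pow_pos (hB w l) _).le) (fun l _ => hT1 l)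
    exact_mod_cast (h1.trans_lt hcount).trans_le h2
  obtain ⟨z1, hz1, z2, hz2, hne, heq⟩ := Finset.exists_ne_map_eq_of_card_lt_of_maps_to hcard hmap
  rw [Fintype.mem_piFinset] at hz1 hz2
  refine ⟨z1 - z2, sub_ne_zero.2 hne, ?_, ?_⟩
  · have hYs : ∑ l, x l * (((z1 - z2) l : 𝓞 K) : K) = Y z1 - Y z2 := by
      rw [hYd, ← Finset.sum_sub_distrib]
      apply Finset.sum_congr rfl; intro l _; simp [mul_sub]
    apply hy
    · have hρs : ∀ σ, |ρ σ (Y z1 - Y z2)| ≤ δ := by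
        intro σ
        have h1 := congrFun heq σ
        have h2 := Int.abs_sub_lt_one_of_floor_eq_floor h1
        have h3 : ρ σ (Y z1) / δ - ρ σ (Y z2) / δ = ρ σ (Y z1 - Y z2) / δ := by
          simp only [hρ, map_sub, Complex.sub_re, Complex.sub_im]; ring
        rw [h3, abs_div, abs_of_pos hδ, div_lt_one hδ] at h2
        exact h2.le
      intro w
      rw [hYs, ← w.norm_embedding_eq]
      have h1 := abs_le.1 (hρs w.embedding)
      have h2 := abs_le.1 (hρs (ComplexEmbedding.conjugate w.embedding))
      simp only [hρ, ComplexEmbedding.conjugate_coe_eq, Complex.conj_re, Complex.conj_im] at h1 h2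
      set c := w.embedding (Y z1 - Y z2)
      apply abs_le_of_sq_le_sq' _ hδ.le |>.2
      rw [← Complex.normSq_eq_norm_sq, Complex.normSq_apply]
      have h3 : (c.re + c.im) ^ 2 ≤ δ ^ 2 := sq_le_sq' h1.1 h1.2
      have h4 : (c.re + -c.im) ^ 2 ≤ δ ^ 2 := sq_le_sq' h2.1 h2.2
      nlinarith
    · intro v
      have h1 := IsNonarchimedean.finset_image_add_of_nonempty (f := v.1) (fin_nonarch v) (fun l => x l * (((z1 - z2) l : 𝓞 K) : K)) (Finset.univ_nonempty (α := ι))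
      obtain ⟨i, -, hi⟩ := h1
      refine ⟨i, hi.trans ?_⟩
      rw [map_mul]
      have h2 := fin_integer_le_one v ((z1 - z2) i)
      exact mul_le_of_le_one_right (apply_nonneg _ _) h2
  · intro w l
    have h1 := hT2 l _ (hz1 l) w
    have h2 := hT2 l _ (hz2 l) w
    have h3 : w (((z1 - z2) l : 𝓞 K) : K) ≤ w (z1 l : K) + w (z2 l : K) := by
      have := AbsoluteValue.sub_le_add w.1 (z1 l : K) (z2 l : K)
      show w (algebraMap (𝓞 K) K (z1 l - z2 l)) ≤ _
      rw [map_sub]; exact this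
    have h4 : 2 * C * B w l ≤ C' * B w l := by
      apply mul_le_mul_of_nonneg_right _ (hB w l).le
      rw [hC']; nlinarith
    linarith
end mink
end MLT

set_option linter.unusedSectionVars false
namespace MLT
open NumberField Filter

/-- integers as a subring of `K` -/
def OI (K : Type*) [Field K] [NumberField K] : Subring K := (algebraMap (𝓞 K) K).range

section m1
variable {K : Type*} [Field K] [NumberField K] {𝓤 : Ultrafilter ℕ} {S : Finset (FinitePlace K)} {q : ℕ → ℝ}

lemma OI_le_OS (S : Finset (FinitePlace K)) : OI K ≤ OS S := by
  rintro _ ⟨a, rfl⟩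
  rw [mem_OS]
  intro v _
  exact fin_integer_le_one v a

lemma sz_const_le (hq : Tendsto q 𝓤 atTop) (p : Pl S) (a : GF 𝓤 K) (C c : ℝ) (hC : 0 < C)
    (h : ∀ᶠ t in 𝓤, pa p (rep a t) ≤ C * Real.exp (c * q t)) : sz q p a c := by
  intro ε hε
  have h5 : Tendsto (fun t => ε * q t) 𝓤 atTop := hq.const_mul_atTop hε
  filter_upwards [h, h5.eventually_ge_atTop (Real.log C)] with t h1 h2
  refine h1.trans ?_
  rw [add_mul, add_comm, Real.exp_add]
  apply mul_le_mul_of_nonneg_right _ (Real.exp_pos _).le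
  calc C = Real.exp (Real.log C) := (Real.exp_log hC).symm
    _ ≤ _ := Real.exp_le_exp.2 h2

set_option maxHeartbeats 1000000 in
theorem M1 (hq : Tendsto q 𝓤 atTop) {ι : Type*} [Fintype ι] [DecidableEq ι] [Nonempty ι] (x : ι → GF 𝓤 K)
    (hxS : ∀ i, x i ∈ gsub 𝓤 (OS S)) (c : Pl S → ι → ℝ) (hc : ∀ p i, sz q p (x i) (c p i)) (ip : Pl S → ι)
    (hmax : ∀ p i, c p i ≤ c p (ip p)) (b : InfinitePlace K → ι → ℝ)
    (hb : ∑ p, pw p * c p (ip p) < ∑ w : InfinitePlace K, (w.mult : ℝ) * ∑ l ∈ Finset.univ.erase (ip (Sum.inl w)), b w l) :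
    ∃ z : ι → GF 𝓤 K, z ≠ 0 ∧ (∀ l, z l ∈ gsub 𝓤 (OI K)) ∧ ∑ l, x l * z l = 0 ∧
      ∀ w l, l ≠ ip (Sum.inl w) → sz q (Sum.inl w : Pl S) (z l) (b w l) := by
  classical
  obtain ⟨C, hC, hmk⟩ := minkP K (ι := ι)
  set d := Module.finrank ℚ K with hd
  have hd0 : (0 : ℝ) < d := by exact_mod_cast Module.finrank_pos
  have hmd : ∑ w : InfinitePlace K, (w.mult : ℝ) = d := sum_inf_mult
  set hinf := ∑ w : InfinitePlace K, (w.mult : ℝ) * c (Sum.inl w) (ip (Sum.inl w)) with hhinf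
  set hfin := ∑ v : {v // v ∈ S}, c (Sum.inr v) (ip (Sum.inr v)) with hhfin
  have hsplit : ∑ p, pw p * c p (ip p) = hinf + hfin := by
    rw [Fintype.sum_sum_type]; simp [pw, hhinf, hhfin]
  set sb := ∑ w : InfinitePlace K, (w.mult : ℝ) * ∑ l ∈ Finset.univ.erase (ip (Sum.inl w)), b w l with hsb
  set k : ℝ := (Fintype.card {v // v ∈ S} : ℝ) with hk
  have hk0 : 0 ≤ k := Nat.cast_nonneg _
  rw [hsplit] at hb
  set g := sb - hinf - hfin with hg
  have hg0 : 0 < g := by rw [hg]; linarith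
  set ε := g / (2 * (k + 1 + d)) with hε
  have hε0 : 0 < ε := by positivity
  have hεg : ε * (k + 1 + d) = g / 2 := by rw [hε]; field_simp
  set s := (hfin + ε * k + ε) / d with hs
  have hsd : s * d = hfin + ε * k + ε := by rw [hs]; field_simp
  -- large radius
  obtain ⟨r, hr1, hr2⟩ : ∃ r : ℝ, (∀ w l, c (Sum.inl w) l + ε + b w l ≤ r) ∧ -s ≤ r := by
    obtain ⟨r1, h1⟩ := (Set.finite_range (fun y : InfinitePlace K × ι => c (Sum.inl y.1) y.2 + ε + b y.1 y.2)).bddAbove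
    exact ⟨max r1 (-s), fun w l => (h1 ⟨(w, l), rfl⟩).trans (le_max_left _ _), le_max_right _ _⟩
  set b' : InfinitePlace K → ι → ℝ := fun w l => if l = ip (Sum.inl w) then r - c (Sum.inl w) l - ε else b w l with hb'
  have hb'1 : ∀ w l, c (Sum.inl w) l + ε + b' w l ≤ r := by
    intro w l; simp only [hb']; split_ifs
    · linarith
    · exact hr1 w l
  have hsum' : ∑ l, ∑ w : InfinitePlace K, (w.mult : ℝ) * b' w l = sb + d * r - hinf - d * ε := by
    rw [Finset.sum_comm]
    have : ∀ w : InfinitePlace K, ∑ l, (w.mult : ℝ) * b' w l = (w.mult : ℝ) * (∑ l ∈ Finset.univ.erase (ip (Sum.inl w)), b w l) + (w.mult * r - w.mult * c (Sum.inl w) (ip (Sum.inl w)) - w.mult * ε) := by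
      intro w
      rw [← Finset.mul_sum, ← Finset.add_sum_erase _ _ (Finset.mem_univ (ip (Sum.inl w)))]
      have : ∑ l ∈ Finset.univ.erase (ip (Sum.inl w)), b' w l = ∑ l ∈ Finset.univ.erase (ip (Sum.inl w)), b w l := by
        apply Finset.sum_congr rfl; intro l hl
        simp only [hb']; rw [if_neg (Finset.ne_of_mem_erase hl)]
      rw [this]; simp only [hb', if_true]; ring
    rw [Finset.sum_congr rfl fun w _ => this w]
    rw [Finset.sum_add_distrib, Finset.sum_sub_distrib, Finset.sum_sub_distrib, ← Finset.sum_mul, ← Finset.sum_mul, hmd]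
    ring
  have hexp : d * (r + s) + g / 2 = ∑ l, ∑ w : InfinitePlace K, (w.mult : ℝ) * b' w l := by
    rw [hsum']; nlinarith
  have hlevel : ∀ᶠ t in 𝓤, ∃ z : ι → 𝓞 K, z ≠ 0 ∧ ∑ l, rep (x l) t * z l = 0 ∧
      ∀ (w : InfinitePlace K) l, w (z l) ≤ C * Real.exp (b' w l * q t) := by
    have h1 : ∀ᶠ t in 𝓤, ∀ p : Pl S, ∀ i, pa p (rep (x i) t) ≤ Real.exp ((c p i + ε) * q t) :=
      eventually_all.2 fun p => eventually_all.2 fun i => hc p i ε hε0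
    have h2 : ∀ᶠ t in 𝓤, ∀ i, rep (x i) t ∈ OS S := eventually_all.2 fun i => hxS i
    have h5 : Tendsto (fun t => g / 2 * q t) 𝓤 atTop := hq.const_mul_atTop (by linarith)
    filter_upwards [h1, h2, ev_pos hq, h5.eventually_gt_atTop (d * Real.log C)] with t h1 h2 h3 h4
    apply hmk (fun i => rep (x i) t) (fun w l => Real.exp (b' w l * q t)) (Real.exp (r * q t)) (Real.exp (-s * q t))
    · intro w l; exact Real.exp_pos _
    · exact Real.exp_pos _
    · exact Real.exp_le_exp.2 (mul_le_mul_of_nonneg_right hr2 h3.le)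
    · intro w l
      calc w (rep (x l) t) * Real.exp (b' w l * q t) ≤ Real.exp ((c (Sum.inl w) l + ε) * q t) * Real.exp (b' w l * q t) :=
            mul_le_mul_of_nonneg_right (h1 (Sum.inl w) l) (Real.exp_pos _).le
        _ ≤ Real.exp (r * q t) := by
            rw [← Real.exp_add, ← add_mul]
            exact Real.exp_le_exp.2 (mul_le_mul_of_nonneg_right (hb'1 w l) h3.le)
    · intro y hyw hyv
      by_contra hy0
      have hyS : IsSInt S y := by
        intro v hv
        obtain ⟨i, hi⟩ := hyv v
        exact hi.trans ((mem_OS _ _).1 (h2 i) v hv)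
      have h6 := sum_log_nonneg S hy0 hyS
      rw [Fintype.sum_sum_type] at h6
      have h7 : ∑ w : InfinitePlace K, pw (S := S) (Sum.inl w) * Real.log (pa (S := S) (Sum.inl w) y) ≤ ∑ w : InfinitePlace K, (w.mult : ℝ) * (-s * q t) := by
        apply Finset.sum_le_sum; intro w _
        apply mul_le_mul_of_nonneg_left _ (pw_pos (S := S) (Sum.inl w)).le
        have := Real.log_le_log ((pa (S := S) (Sum.inl w)).pos hy0) (hyw w)
        rwa [Real.log_exp] at this
      have h8 : ∑ v : {v // v ∈ S}, pw (S := S) (Sum.inr v) * Real.log (pa (S := S) (Sum.inr v) y) ≤ ∑ v : {v // v ∈ S}, (c (Sum.inr v) (ip (Sum.inr v)) + ε) * q t := by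
        apply Finset.sum_le_sum; intro v _
        have : pw (S := S) (Sum.inr v) = 1 := rfl
        rw [this, one_mul]
        obtain ⟨i, hi⟩ := hyv v.1
        have h9 := Real.log_le_log ((pa (S := S) (Sum.inr v)).pos hy0) (hi.trans (h1 (Sum.inr v) i))
        rw [Real.log_exp] at h9
        refine h9.trans (mul_le_mul_of_nonneg_right ?_ h3.le)
        linarith [hmax (Sum.inr v) i]
      rw [← Finset.sum_mul, hmd] at h7
      rw [← Finset.sum_mul, Finset.sum_add_distrib, ← hhfin, Finset.sum_const, Finset.card_univ, nsmul_eq_mul, ← hk] at h8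
      have h10 : (d : ℝ) * (-s * q t) + (hfin + k * ε) * q t = - (ε * q t) := by
        have : (d : ℝ) * (-s * q t) = - (s * d) * q t := by ring
        rw [this, hsd]; ring
      have := mul_pos hε0 h3
      linarith
    · rw [← Real.exp_sub, ← Real.exp_log hC, ← Real.exp_add, ← Real.exp_nat_mul]
      simp_rw [← Real.exp_nat_mul, ← Real.exp_sum]
      apply Real.exp_lt_exp.2
      have h6 : ∑ l, ∑ w : InfinitePlace K, (w.mult : ℝ) * (b' w l * q t) = (∑ l, ∑ w : InfinitePlace K, (w.mult : ℝ) * b' w l) * q t := by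
        rw [Finset.sum_mul]; apply Finset.sum_congr rfl; intro l _
        rw [Finset.sum_mul]; apply Finset.sum_congr rfl; intro w _; ring
      rw [h6, ← hexp]
      nlinarith
  have hch : ∀ t, ∃ z : ι → 𝓞 K, (∃ z : ι → 𝓞 K, z ≠ 0 ∧ ∑ l, rep (x l) t * z l = 0 ∧
      ∀ (w : InfinitePlace K) l, w (z l) ≤ C * Real.exp (b' w l * q t)) → z ≠ 0 ∧ ∑ l, rep (x l) t * z l = 0 ∧
      ∀ (w : InfinitePlace K) l, w (z l) ≤ C * Real.exp (b' w l * q t) := by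
    intro t
    by_cases h : ∃ z : ι → 𝓞 K, z ≠ 0 ∧ ∑ l, rep (x l) t * z l = 0 ∧
      ∀ (w : InfinitePlace K) l, w (z l) ≤ C * Real.exp (b' w l * q t)
    · obtain ⟨z, hz⟩ := h; exact ⟨z, fun _ => hz⟩
    · exact ⟨0, fun h' => absurd h' h⟩
  choose Z hZ using hch
  have hZ' := hlevel.mono fun t ht => hZ t ht
  set z : ι → GF 𝓤 K := fun l => ((fun t => ((Z t l : 𝓞 K) : K) : ℕ → K) : GF 𝓤 K) with hz
  have hzr : ∀ l, ∀ᶠ t in 𝓤, rep (z l) t = ((Z t l : 𝓞 K) : K) := fun l => rep_coe _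
  refine ⟨z, ?_, ?_, ?_, ?_⟩
  · intro h0
    have h1 : ∀ᶠ t in 𝓤, ∀ l, rep (z l) t = 0 := eventually_all.2 fun l => by
      rw [h0]; exact rep_zero
    obtain ⟨t, h1, h2, h3⟩ := (h1.and ((eventually_all.2 hzr).and hZ')).exists
    apply h3.1
    funext l
    have := (h2 l).symm.trans (h1 l)
    exact_mod_cast this
  · intro l
    filter_upwards [hzr l] with t ht
    rw [ht]; exact ⟨Z t l, rfl⟩
  · rw [rep_eq_iff]
    filter_upwards [rep_sum Finset.univ (fun l => x l * z l), eventually_all.2 fun l => rep_mul (x l) (z l), eventually_all.2 hzr, hZ', rep_zero (𝓤 := 𝓤) (K := K)] with t h1 h2 h3 h4 h5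
    rw [h1, h5, ← h4.2.1]
    apply Finset.sum_congr rfl; intro l _; rw [h2, h3]
  · intro w l hl
    apply sz_const_le hq _ _ C _ hC
    filter_upwards [hzr l, hZ'] with t h1 h2
    rw [h1]
    have := h2.2.2 w l
    simp only [hb', if_neg hl] at this
    exact this

end m1
end MLT

set_option linter.unusedSectionVars false
namespace MLT
open NumberField Filter

section flag
variable {K : Type*} [Field K] [NumberField K] {𝓤 : Ultrafilter ℕ} {S : Finset (FinitePlace K)} {q : ℕ → ℝ}

theorem flag (hq : Tendsto q 𝓤 atTop) (p : Pl S) {ι : Type*} [Fintype ι] [DecidableEq ι] [Nonempty ι] (s : ι → ℝ)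
    (W : ℕ → Submodule (GF 𝓤 K) (ι → GF 𝓤 K)) (hmono : Monotone W) (hW : ∀ j, Module.finrank (GF 𝓤 K) (W j) ≤ j) :
    ∀ (J : ℕ) (A : Finset ι), A.card = J → ∃ π : ℕ → ι, Set.BijOn π (Finset.range J) A ∧
      ∀ J' ≤ J, ∀ v ∈ W J', ∀ c : ℝ, (∀ j < J', sz q p (v (π j)) (s (π j) + c)) → ∀ l ∈ A, sz q p (v l) (s l + c) := by
  intro J
  induction J with
  | zero =>
    intro A hA
    rw [Finset.card_eq_zero] at hA
    subst hA
    obtain ⟨i⟩ := ‹Nonempty ι›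
    exact ⟨fun _ => i, by simp, by simp⟩
  | succ J ih =>
    intro A hA
    set R : (ι → GF 𝓤 K) →ₗ[GF 𝓤 K] (A → GF 𝓤 K) := LinearMap.funLeft _ _ (fun a : A => (a : ι)) with hR
    have h1 : (W J).map R < ⊤ := by
      rw [lt_top_iff_ne_top]
      intro h2
      have h3 := Submodule.finrank_map_le R (W J)
      rw [h2, finrank_top, Module.finrank_fintype_fun_eq_card, Fintype.card_coe, hA] at h3
      have := hW J
      omega
    obtain ⟨f, hf0, hf⟩ := Submodule.exists_le_ker_of_lt_top _ h1
    set α : ι → GF 𝓤 K := fun l => if h : l ∈ A then f (Pi.single ⟨l, h⟩ 1) else 0 with hα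
    have hfα : ∀ u : A → GF 𝓤 K, f u = ∑ a : A, u a * α a := by
      intro u
      conv_lhs => rw [pi_eq_sum_univ' u]
      rw [map_sum]
      apply Finset.sum_congr rfl; intro a _
      rw [map_smul, smul_eq_mul]
      simp only [hα, a.2, dif_pos]
    have hα0 : α ≠ 0 := by
      intro h0
      apply hf0
      ext u
      rw [LinearMap.comp_apply, hfα]; simp [h0]
    obtain ⟨l, hl0, hl⟩ := argmax hq p α hα0 s
    have hlA : l ∈ A := by
      by_contra h; apply hl0; simp only [hα, h, dif_neg, not_false_eq_true]
    obtain ⟨π, hπ, hπ2⟩ := ih (A.erase l) (by rw [Finset.card_erase_of_mem hlA, hA]; rfl)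
    set π' : ℕ → ι := Function.update π J l with hπ'
    have hlt : ∀ j < J, π' j = π j := fun j hj => Function.update_of_ne hj.ne _ _
    have hJ : π' J = l := Function.update_self _ _ _
    refine ⟨π', ⟨?_, ?_, ?_⟩, ?_⟩
    · intro j hj
      rw [Finset.coe_range, Set.mem_Iio] at hj
      rcases Nat.lt_succ_iff_lt_or_eq.1 hj with h | h
      · rw [hlt j h]; exact Finset.mem_of_mem_erase (hπ.mapsTo (by simpa using h))
      · rw [h, hJ]; exact hlA
    · intro j hj j' hj' hjj
      rw [Finset.coe_range, Set.mem_Iio] at hj hj'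
      rcases Nat.lt_succ_iff_lt_or_eq.1 hj with h | h <;> rcases Nat.lt_succ_iff_lt_or_eq.1 hj' with h' | h'
      · rw [hlt j h, hlt j' h'] at hjj; exact hπ.injOn (by simpa using h) (by simpa using h') hjj
      · rw [hlt j h, h', hJ] at hjj
        have := hπ.mapsTo (x := j) (by simpa using h)
        rw [hjj] at this; exact absurd this (by simp)
      · rw [hlt j' h', h, hJ] at hjj
        have := hπ.mapsTo (x := j') (by simpa using h')
        rw [← hjj] at this; exact absurd this (by simp)
      · omega
    · intro a ha
      by_cases h : a = l
      · exact ⟨J, by simp, by rw [hJ, h]⟩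
      · obtain ⟨j, hj, hj2⟩ := hπ.surjOn (show a ∈ ((A.erase l : Finset ι) : Set ι) by simpa [h] using ha)
        rw [Finset.coe_range, Set.mem_Iio] at hj
        exact ⟨j, by simp; omega, by rw [hlt j hj, hj2]⟩
    · intro J' hJ' v hv c hj
      rcases Nat.lt_succ_iff_lt_or_eq.1 (Nat.lt_succ_of_le hJ') with h | h
      · have h2 := hπ2 J' (by omega) v hv c (fun j hj' => by
          have := hj j hj'; rwa [hlt j (by omega)] at this)
        have hvl : v l = ∑ a ∈ A.erase l, -(α a / α l * v a) := by
          have h3 : f (R v) = 0 := by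
            apply hf; exact Submodule.mem_map_of_mem (hmono (by omega : J' ≤ J) hv)
          rw [hfα] at h3
          have h4 : ∑ a ∈ A, v a * α a = 0 := by
            rw [← h3, ← Finset.sum_coe_sort]; rfl
          rw [← Finset.add_sum_erase _ _ hlA] at h4
          rw [Finset.sum_neg_distrib]
          have h5 : ∑ a ∈ A.erase l, α a / α l * v a = (∑ a ∈ A.erase l, v a * α a) / α l := by
            rw [Finset.sum_div]; apply Finset.sum_congr rfl; intro a _; ring
          rw [h5, eq_neg_iff_add_eq_zero]
          field_simp
          linear_combination h4
        intro l' hl'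
        by_cases hll : l' = l
        · rw [hll, hvl]
          apply sz_sum hq
          intro a ha
          apply sz.neg
          have := (hl a).mul (h2 a ha)
          rwa [show s l - s a + (s a + c) = s l + c by ring] at this
        · exact h2 l' (Finset.mem_erase.2 ⟨hll, hl'⟩)
      · intro l' hl'
        have : ∃ j, j < J + 1 ∧ π' j = l' := by
          by_cases h : l' = l
          · exact ⟨J, by simp, by rw [hJ, h]⟩
          · obtain ⟨j, hj, hj2⟩ := hπ.surjOn (show l' ∈ ((A.erase l : Finset ι) : Set ι) by simpa [h] using hl')
            rw [Finset.coe_range, Set.mem_Iio] at hj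
            exact ⟨j, by omega, by rw [hlt j hj, hj2]⟩
        obtain ⟨j, hj1, hj2⟩ := this
        rw [← hj2]; exact hj j (by omega)

lemma flag_b {ι : Type*} {J : ℕ} {A : Finset ι} {π : ℕ → ι} (hπ : Set.BijOn π (Finset.range J) A) (β : ℕ → ℝ) :
    ∃ b : ι → ℝ, (∀ j < J, b (π j) = β j) ∧ ∑ l ∈ A, b l = ∑ j ∈ Finset.range J, β j := by
  have h1 : ∀ j < J, β (Function.invFunOn π (Finset.range J) (π j)) = β j := by
    intro j hj
    congr 1
    exact hπ.injOn.leftInvOn_invFunOn (by simpa using hj)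
  refine ⟨fun l => β (Function.invFunOn π (Finset.range J) l), h1, ?_⟩
  symm
  apply Finset.sum_bij (fun j _ => π j)
  · intro j hj; exact hπ.mapsTo hj
  · intro j hj j' hj' h; exact hπ.injOn hj hj' h
  · intro a ha; obtain ⟨j, hj, h⟩ := hπ.surjOn ha; exact ⟨j, hj, h⟩
  · intro j hj; exact (h1 j (Finset.mem_range.1 hj)).symm

lemma flag_sum {ι : Type*} {J : ℕ} {A : Finset ι} {π : ℕ → ι} (hπ : Set.BijOn π (Finset.range J) A) (b : ι → ℝ) :
    ∑ l ∈ A, b l = ∑ j ∈ Finset.range J, b (π j) := by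
  symm
  apply Finset.sum_bij (fun j _ => π j)
  · intro j hj; exact hπ.mapsTo hj
  · intro j hj j' hj' h; exact hπ.injOn hj hj' h
  · intro a ha; obtain ⟨j, hj, h⟩ := hπ.surjOn ha; exact ⟨j, hj, h⟩
  · intro j hj; rfl

lemma flag_ex {ι : Type*} {J : ℕ} {A : Finset ι} {π : ℕ → ι} (hπ : Set.BijOn π (Finset.range J) A) {l : ι} (hl : l ∈ A) :
    ∃ j < J, π j = l := by
  obtain ⟨j, hj, h⟩ := hπ.surjOn hl
  exact ⟨j, by simpa using hj, h⟩
end flag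
end MLT

set_option linter.unusedSectionVars false
namespace MLT
open NumberField Filter

section span
variable {F : Type*} [Field F] {ι : Type*} [Fintype ι]

/-- span of the first vectors -/
def VV (z : ℕ → ι → F) (j : ℕ) : Submodule F (ι → F) := Submodule.span F (z '' Set.Iio j)

lemma VV_mono (z : ℕ → ι → F) : Monotone (VV z) := fun _ _ h =>
  Submodule.span_mono (Set.image_mono (Set.Iio_subset_Iio h))

lemma VV_congr {z z' : ℕ → ι → F} {j : ℕ} (h : ∀ i < j, z i = z' i) : VV z j = VV z' j := by
  unfold VV; congr 1; exact Set.image_congr (fun i hi => h i hi)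

lemma VV_zero (z : ℕ → ι → F) : VV z 0 = ⊥ := by simp [VV]

lemma VV_finrank (z : ℕ → ι → F) (j : ℕ) : Module.finrank F (VV z j) ≤ j := by
  classical
  have h1 : VV z j = Submodule.span F (((Finset.range j).image z : Finset (ι → F)) : Set (ι → F)) := by
    unfold VV; congr 1; ext; simp
  rw [h1]
  exact (finrank_span_finset_le_card _).trans (Finset.card_image_le.trans (by simp))

lemma mem_VV (z : ℕ → ι → F) {i j : ℕ} (h : i < j) : z i ∈ VV z j := Submodule.subset_span ⟨i, h, rfl⟩

lemma VV_finrank_eq (z : ℕ → ι → F) (n : ℕ) (h : ∀ j < n, z j ∉ VV z j) : Module.finrank F (VV z n) = n := by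
  induction n with
  | zero => rw [VV_zero]; simp
  | succ n ih =>
    have h1 := ih fun j hj => h j (by omega)
    have h2 : VV z n < VV z (n+1) := lt_of_le_of_ne (VV_mono z (Nat.le_succ n)) (fun h3 => h n (by omega) (h3 ▸ mem_VV z (Nat.lt_succ_self n)))
    have h3 := Submodule.finrank_lt_finrank_of_lt h2
    have h4 := VV_finrank z (n+1)
    omega

lemma VV_level (z : ℕ → ι → F) {n k : ℕ} (v : ι → F) (h : v ∈ VV z n) (hk : v ∉ VV z k) : ∃ J, k ≤ J ∧ J < n ∧ v ∉ VV z J ∧ v ∈ VV z (J+1) := by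
  classical
  have hex : ∃ m, v ∈ VV z m := ⟨n, h⟩
  have h1 := Nat.find_spec hex
  have hk' : k < Nat.find hex := by
    by_contra hc; push Not at hc
    exact hk (VV_mono z hc h1)
  obtain ⟨J, hJ⟩ : ∃ J, Nat.find hex = J + 1 := ⟨Nat.find hex - 1, by omega⟩
  refine ⟨J, by omega, ?_, Nat.find_min hex (by omega), by rw [← hJ]; exact h1⟩
  have := Nat.find_min' hex h
  omega

lemma VV_ker {n : ℕ} (z : ℕ → Fin (n+1) → F) (x : Fin (n+1) → F) (hx : x ≠ 0) (h : ∀ j < n, z j ∉ VV z j)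
    (hz : ∀ j < n, ∑ l, x l * z j l = 0) (v : Fin (n+1) → F) (hv : ∑ l, x l * v l = 0) : v ∈ VV z n := by
  classical
  set f : (Fin (n+1) → F) →ₗ[F] F := ∑ l, x l • LinearMap.proj l with hf
  have hfa : ∀ v, f v = ∑ l, x l * v l := by intro v; simp [hf]
  have hf0 : f ≠ 0 := by
    intro h0
    apply hx; funext i
    have := hfa (Pi.single i 1)
    rw [h0] at this
    simpa [Pi.single_apply] using this.symm
  have h1 : VV z n ≤ LinearMap.ker f := by
    apply Submodule.span_le.2
    rintro _ ⟨j, hj, rfl⟩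
    show f _ = 0
    rw [hfa]; exact hz j hj
  have h2 : Module.finrank F (LinearMap.ker f) = n := by
    have := Module.Dual.finrank_ker_add_one_of_ne_zero hf0
    rw [Module.finrank_fintype_fun_eq_card, Fintype.card_fin] at this
    omega
  rw [Submodule.eq_of_le_of_finrank_eq h1 (by rw [h2, VV_finrank_eq z n h])]
  show f v = 0
  rw [hfa, hv]
end span

section dat
variable {K : Type*} [Field K] [NumberField K]

/-- data of part D -/
structure Dat (𝓤 : Ultrafilter ℕ) (S : Finset (FinitePlace K)) (q : ℕ → ℝ) (n : ℕ) where
  hq : Tendsto q 𝓤 atTop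
  x : Fin (n+1) → GF 𝓤 K
  c : Pl S → Fin (n+1) → ℝ
  ip : Pl S → Fin (n+1)
  x0 : ∀ i, x i ≠ 0
  xS : ∀ i, x i ∈ gsub 𝓤 (OS S)
  hc : ∀ p i, sz q p (x i) (c p i)
  hc' : ∀ p i, sz q p (x i)⁻¹ (-c p i)
  hmax : ∀ p i, c p i ≤ c p (ip p)
  hprod : ∀ i, ∑ p, pw p * c p i = 0
  hsum : ∑ i, x i = 0

variable {𝓤 : Ultrafilter ℕ} {S : Finset (FinitePlace K)} {q : ℕ → ℝ} {n : ℕ} (D : Dat 𝓤 S q n)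

/-- height -/
noncomputable def Dat.h : ℝ := ∑ p, pw p * D.c p (D.ip p)

/-- lattice -/
def Dat.Lam (z : Fin (n+1) → GF 𝓤 K) : Prop := (∀ l, z l ∈ gsub 𝓤 (OI K)) ∧ ∑ l, D.x l * z l = 0

/-- norm -/
def Dat.N (τ : InfinitePlace K → Fin (n+1) → ℝ) (z : Fin (n+1) → GF 𝓤 K) (lam : ℝ) : Prop :=
  ∀ w l, l ≠ D.ip (Sum.inl w) → sz q (Sum.inl w : Pl S) (z l) (τ w l + lam)

/-- index `i_w` at infinite places -/
def Dat.iw (w : InfinitePlace K) : Fin (n+1) := D.ip (Sum.inl w)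

/-- total of a weight -/
noncomputable def Dat.tot (τ : InfinitePlace K → Fin (n+1) → ℝ) : ℝ :=
  ∑ w : InfinitePlace K, (w.mult : ℝ) * ∑ l ∈ Finset.univ.erase (D.iw w), τ w l

lemma Dat.N_mono {τ : InfinitePlace K → Fin (n+1) → ℝ} {z : Fin (n+1) → GF 𝓤 K} {a b : ℝ} (h : D.N τ z a) (hab : a ≤ b) :
    D.N τ z b := fun w l hl => (h w l hl).mono D.hq (by linarith)

lemma sz_OI (hq : Tendsto q 𝓤 atTop) {a : GF 𝓤 K} (ha : a ∈ gsub 𝓤 (OI K)) (v : {v // v ∈ S}) : sz q (Sum.inr v : Pl S) a 0 := by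
  intro ε hε
  filter_upwards [ha, ev_pos hq] with t h1 h2
  obtain ⟨b, hb⟩ := h1
  rw [← hb]
  exact (fin_integer_le_one v.1 b).trans (Real.one_le_exp (by rw [zero_add]; positivity))

/-- the remaining coordinate -/
lemma Dat.N_ip {z : Fin (n+1) → GF 𝓤 K} (hz : ∑ l, D.x l * z l = 0) (p : Pl S) (T : ℝ)
    (h : ∀ l, l ≠ D.ip p → sz q p (z l) T) (l : Fin (n+1)) : sz q p (z l) T := by
  classical
  by_cases hl : l = D.ip p
  · have h1 : z (D.ip p) = ∑ l ∈ Finset.univ.erase (D.ip p), -(D.x l * (D.x (D.ip p))⁻¹ * z l) := by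
      rw [← Finset.add_sum_erase _ _ (Finset.mem_univ (D.ip p))] at hz
      have h0 := D.x0 (D.ip p)
      rw [Finset.sum_neg_distrib, eq_neg_iff_add_eq_zero]
      have h5 : ∑ l ∈ Finset.univ.erase (D.ip p), D.x l * (D.x (D.ip p))⁻¹ * z l = (∑ l ∈ Finset.univ.erase (D.ip p), D.x l * z l) / D.x (D.ip p) := by
        rw [Finset.sum_div]; apply Finset.sum_congr rfl; intro a _; ring
      rw [h5]; field_simp; linear_combination hz
    rw [hl, h1]
    apply sz_sum D.hq
    intro a ha
    apply sz.neg
    refine (((D.hc p a).mul (D.hc' p (D.ip p))).mul (h a (Finset.ne_of_mem_erase ha))).mono D.hq ?_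
    linarith [D.hmax p a]
  · exact h l hl

lemma sum_pw_split (f : Pl S → ℝ) : ∑ p, pw p * f p = ∑ w : InfinitePlace K, (w.mult : ℝ) * f (Sum.inl w) + ∑ v : {v // v ∈ S}, f (Sum.inr v) := by
  rw [Fintype.sum_sum_type]; simp [pw]

lemma pf_OI (hq : Tendsto q 𝓤 atTop) {a : GF 𝓤 K} (ha : a ∈ gsub 𝓤 (OI K)) (ha0 : a ≠ 0) (T : ℝ)
    (h : ∀ w, sz q (Sum.inl w : Pl S) a T) : 0 ≤ T := by
  have h1 := sz_pf hq ha0 (gsub_mono (OI_le_OS S) ha) (Sum.elim (fun _ => T) (fun _ => 0)) (by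
    rintro (w | v)
    · exact h w
    · exact sz_OI hq ha v)
  rw [sum_pw_split] at h1
  simp only [Sum.elim_inl, Sum.elim_inr, Finset.sum_const_zero, add_zero] at h1
  rw [← Finset.sum_mul, sum_inf_mult] at h1
  have hd0 : (0 : ℝ) < Module.finrank ℚ K := by exact_mod_cast Module.finrank_pos
  by_contra hneg
  push Not at hneg
  nlinarith

lemma Dat.pfN {τ : InfinitePlace K → Fin (n+1) → ℝ} {z : Fin (n+1) → GF 𝓤 K} {lam T : ℝ} (hz : D.Lam z) (hz0 : z ≠ 0)
    (hN : D.N τ z lam) (hT : ∀ w l, l ≠ D.ip (Sum.inl w) → τ w l ≤ T) : 0 ≤ T + lam := by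
  obtain ⟨l, hl⟩ : ∃ l, z l ≠ 0 := by
    by_contra h; push Not at h; exact hz0 (funext h)
  apply pf_OI D.hq (hz.1 l) hl (T + lam) (S := S)
  intro w
  apply D.N_ip hz.2
  intro l hl
  exact (hN w l hl).mono D.hq (by linarith [hT w l hl])

/-- approximate successive minima -/
def Dat.MinSys (τ : InfinitePlace K → Fin (n+1) → ℝ) (δ : ℝ) (z : ℕ → Fin (n+1) → GF 𝓤 K) (lam : ℕ → ℝ) (k : ℕ) : Prop :=
  ∀ j < k, D.Lam (z j) ∧ z j ∉ VV z j ∧ D.N τ (z j) (lam j) ∧ ∀ z', D.Lam z' → z' ∉ VV z j → ¬ D.N τ z' (lam j - δ)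

lemma Dat.flag (z : ℕ → Fin (n+1) → GF 𝓤 K) (s : Fin (n+1) → ℝ) (w : InfinitePlace K) :
    ∃ π : ℕ → Fin (n+1), Set.BijOn π (Finset.range n) (Finset.univ.erase (D.iw w) : Finset (Fin (n+1))) ∧
      ∀ J' ≤ n, ∀ v ∈ VV z J', ∀ c : ℝ, (∀ j < J', sz q (Sum.inl w : Pl S) (v (π j)) (s (π j) + c)) →
      ∀ l ≠ D.iw w, sz q (Sum.inl w : Pl S) (v l) (s l + c) := by
  obtain ⟨π, h1, h2⟩ := MLT.flag D.hq (Sum.inl w : Pl S) s (VV z) (VV_mono z) (VV_finrank z) n (Finset.univ.erase (D.iw w)) (by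
    rw [Finset.card_erase_of_mem (Finset.mem_univ _)]; simp)
  exact ⟨π, h1, fun J' hJ' v hv c hj l hl => h2 J' hJ' v hv c hj l (Finset.mem_erase.2 ⟨hl, Finset.mem_univ _⟩)⟩

lemma Dat.M1 (b : InfinitePlace K → Fin (n+1) → ℝ) (hb : D.h < D.tot b) :
    ∃ z, z ≠ 0 ∧ D.Lam z ∧ ∀ w l, l ≠ D.iw w → sz q (Sum.inl w : Pl S) (z l) (b w l) := by
  obtain ⟨z, h0, h1, h2, h3⟩ := MLT.M1 D.hq D.x D.xS D.c D.hc D.ip D.hmax b hb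
  exact ⟨z, h0, ⟨h1, h2⟩, h3⟩

lemma Dat.ext_nonempty (z : ℕ → Fin (n+1) → GF 𝓤 K) (k : ℕ) (hk : k < n) (τ : InfinitePlace K → Fin (n+1) → ℝ) :
    ∃ v lam, D.Lam v ∧ v ∉ VV z k ∧ D.N τ v lam := by
  classical
  choose π hπ hπ2 using fun w => D.flag z (fun _ => 0) w
  set B : ℝ := n + |D.h| + 1 with hB
  have hB0 : 0 < B := by positivity
  choose b hb1 hb2 using fun w => flag_b (hπ w) (fun j => if j < k then (-1 : ℝ) else B)
  have hsum : B - n ≤ ∑ j ∈ Finset.range n, (if j < k then (-1 : ℝ) else B) := by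
    have h1 : ∑ j ∈ Finset.range n, (if j = k then B else 0) = B := by simp [hk]
    have h2 : ∑ j ∈ Finset.range n, (-1 : ℝ) = -n := by simp
    have h3 : B - n = ∑ j ∈ Finset.range n, ((if j = k then B else 0) + -1) := by
      rw [Finset.sum_add_distrib, h1, h2]; ring
    rw [h3]
    apply Finset.sum_le_sum; intro j _
    split_ifs with h4 h5 h5
    · omega
    · linarith
    · linarith
    · linarith
  obtain ⟨v, hv0, hv1, hv2⟩ := D.M1 b (by
    unfold Dat.tot
    rw [Finset.sum_congr rfl fun w _ => by rw [hb2 w], ← Finset.sum_mul, sum_inf_mult]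
    have hd : (1 : ℝ) ≤ Module.finrank ℚ K := by exact_mod_cast Module.finrank_pos
    have h5 : 1 + |D.h| ≤ ∑ j ∈ Finset.range n, (if j < k then (-1 : ℝ) else B) := by linarith
    have h6 := abs_nonneg D.h
    have := le_abs_self D.h
    nlinarith)
  obtain ⟨M, hM⟩ := (Set.finite_range (fun y : InfinitePlace K × Fin (n+1) => b y.1 y.2 - τ y.1 y.2)).bddAbove
  refine ⟨v, M, hv1, ?_, ?_⟩
  · intro hvV
    have h1 : D.N (fun _ _ => 0) v (-1) := by
      intro w l hl
      apply hπ2 w k hk.le v hvV (-1) _ l hl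
      intro j hj
      have h2 := hv2 w (π w j) (Finset.ne_of_mem_erase ((hπ w).mapsTo (x := j) (by simp; omega)))
      rw [hb1 w j (by omega), if_pos hj] at h2
      simpa using h2
    have := D.pfN (T := 0) hv1 hv0 h1 (fun _ _ _ => le_rfl)
    linarith
  · intro w l hl
    refine (hv2 w l hl).mono D.hq ?_
    have := hM ⟨(w, l), rfl⟩
    simp only at this
    linarith

lemma Dat.ext_step (τ : InfinitePlace K → Fin (n+1) → ℝ) {δ : ℝ} (hδ : 0 < δ) (z : ℕ → Fin (n+1) → GF 𝓤 K) (lam : ℕ → ℝ) (k : ℕ) (hk : k < n)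
    (h : D.MinSys τ δ z lam k) : ∃ z' lam', (∀ j < k, z' j = z j ∧ lam' j = lam j) ∧ D.MinSys τ δ z' lam' (k+1) := by
  classical
  set L : Set ℝ := {a | ∃ v, D.Lam v ∧ v ∉ VV z k ∧ D.N τ v a} with hL
  have hne : L.Nonempty := by
    obtain ⟨v, a, h1⟩ := D.ext_nonempty z k hk τ
    exact ⟨a, v, h1⟩
  obtain ⟨T, hT⟩ := (Set.finite_range (fun y : InfinitePlace K × Fin (n+1) => τ y.1 y.2)).bddAbove
  have hbd : BddBelow L := by
    refine ⟨-T, ?_⟩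
    rintro a ⟨v, h1, h2, h3⟩
    have := D.pfN (T := T) h1 (by rintro rfl; exact h2 (Submodule.zero_mem _)) h3 (fun w l _ => hT ⟨(w, l), rfl⟩)
    linarith
  obtain ⟨a, ⟨v, h1, h2, h3⟩, ha⟩ := exists_lt_of_csInf_lt hne (show sInf L < sInf L + δ by linarith)
  have hz : ∀ j < k, Function.update z k v j = z j := fun j hj => Function.update_of_ne hj.ne _ _
  have hl : ∀ j < k, Function.update lam k a j = lam j := fun j hj => Function.update_of_ne hj.ne _ _
  refine ⟨Function.update z k v, Function.update lam k a, fun j hj => ⟨hz j hj, hl j hj⟩, ?_⟩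
  intro j hj
  have hV : VV (Function.update z k v) j = VV z j := VV_congr fun i hi => hz i (by omega)
  rw [hV]
  rcases Nat.lt_succ_iff_lt_or_eq.1 hj with h4 | h4
  · rw [hz j h4, hl j h4]; exact h j h4
  · subst h4
    rw [Function.update_self, Function.update_self]
    refine ⟨h1, h2, h3, fun z' h5 h6 h7 => ?_⟩
    have := csInf_le hbd ⟨z', h5, h6, h7⟩
    linarith

lemma Dat.ext_sys (τ : InfinitePlace K → Fin (n+1) → ℝ) {δ : ℝ} (hδ : 0 < δ) (z : ℕ → Fin (n+1) → GF 𝓤 K) (lam : ℕ → ℝ) (k : ℕ) (hk : k ≤ n)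
    (h : D.MinSys τ δ z lam k) : ∃ z' lam', (∀ j < k, z' j = z j ∧ lam' j = lam j) ∧ D.MinSys τ δ z' lam' n := by
  obtain ⟨m, rfl⟩ : ∃ m, n = k + m := ⟨n - k, by omega⟩
  have : ∀ m' ≤ m, ∃ z' lam', (∀ j < k, z' j = z j ∧ lam' j = lam j) ∧ D.MinSys τ δ z' lam' (k + m') := by
    intro m'
    induction m' with
    | zero => intro _; exact ⟨z, lam, fun _ _ => ⟨rfl, rfl⟩, h⟩
    | succ m' ih =>
      intro hm
      obtain ⟨z1, l1, h1, h2⟩ := ih (by omega)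
      obtain ⟨z2, l2, h3, h4⟩ := D.ext_step τ hδ z1 l1 (k + m') (by omega) h2
      refine ⟨z2, l2, fun j hj => ⟨(h3 j (by omega)).1.trans (h1 j hj).1, (h3 j (by omega)).2.trans (h1 j hj).2⟩, h4⟩
  exact this m le_rfl

lemma Dat.MinSys_mono {τ : InfinitePlace K → Fin (n+1) → ℝ} {δ : ℝ} {z : ℕ → Fin (n+1) → GF 𝓤 K} {lam : ℕ → ℝ} {k : ℕ}
    (h : D.MinSys τ δ z lam k) {j J : ℕ} (hj : j ≤ J) (hJ : J < k) : lam j < lam J + δ := by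
  by_contra hc
  push Not at hc
  obtain ⟨h1, h2, h3, -⟩ := h J hJ
  exact (h j (by omega)).2.2.2 (z J) h1 (fun h4 => h2 (VV_mono z hj h4)) (D.N_mono h3 (by linarith))

lemma Dat.x_ne : D.x ≠ 0 := fun h => D.x0 0 (congrFun h 0)

lemma Dat.full {τ : InfinitePlace K → Fin (n+1) → ℝ} {δ : ℝ} {z : ℕ → Fin (n+1) → GF 𝓤 K} {lam : ℕ → ℝ}
    (h : D.MinSys τ δ z lam n) {v : Fin (n+1) → GF 𝓤 K} (hv : ∑ l, D.x l * v l = 0) : v ∈ VV z n :=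
  VV_ker z D.x D.x_ne (fun j hj => (h j hj).2.1) (fun j hj => (h j hj).1.2) v hv

theorem Dat.M2 {τ : InfinitePlace K → Fin (n+1) → ℝ} {δ : ℝ} {z : ℕ → Fin (n+1) → GF 𝓤 K} {lam : ℕ → ℝ}
    (h : D.MinSys τ δ z lam n) :
    D.tot τ + Module.finrank ℚ K * (∑ j ∈ Finset.range n, lam j) - 2 * δ * Module.finrank ℚ K * n ≤ D.h := by
  classical
  by_contra hcon
  push Not at hcon
  choose π hπ hπ2 using fun w => D.flag z (τ w) w
  choose β hb1 hb2 using fun w => flag_b (hπ w) (fun j => lam j - 2 * δ)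
  obtain ⟨v, hv0, hv1, hv2⟩ := D.M1 (fun w l => τ w l + β w l) (by
    refine hcon.trans_le (le_of_eq ?_)
    unfold Dat.tot
    simp_rw [Finset.sum_add_distrib, mul_add]
    rw [Finset.sum_add_distrib]
    rw [add_sub_assoc]; congr 1
    simp_rw [hb2]
    rw [← Finset.sum_mul, sum_inf_mult, Finset.sum_sub_distrib]
    simp; ring)
  obtain ⟨J, -, hJn, hJ1, hJ2⟩ := VV_level z (k := 0) v (D.full h hv1.2) (by rw [VV_zero]; simpa using hv0)
  apply (h J hJn).2.2.2 v hv1 hJ1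
  intro w l hl
  apply hπ2 w (J+1) (by omega) v hJ2 _ _ l hl
  intro j hj
  have h3 := hv2 w (π w j) (Finset.ne_of_mem_erase ((hπ w).mapsTo (x := j) (by simp; omega)))
  rw [hb1 w j (by omega)] at h3
  refine h3.mono D.hq ?_
  have := D.MinSys_mono h (show j ≤ J by omega) hJn
  linarith
end dat
end MLT

set_option linter.unusedSectionVars false
namespace MLT
open NumberField Filter

section dat
variable {K : Type*} [Field K] [NumberField K]
variable {𝓤 : Ultrafilter ℕ} {S : Finset (FinitePlace K)} {q : ℕ → ℝ} {n : ℕ} (D : Dat 𝓤 S q n)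

/-- matrix with a unit vector on top -/
def topM {F : Type*} [Field F] {n : ℕ} (z : ℕ → Fin (n+1) → F) (l : Fin (n+1)) : Matrix (Fin (n+1)) (Fin (n+1)) F :=
  Matrix.of (Fin.cons (Pi.single l 1) (fun j : Fin n => z j))

section alg
variable {F : Type*} [Field F] {z : ℕ → Fin (n+1) → F} {x : Fin (n+1) → F}

lemma topM_zero (l : Fin (n+1)) : topM z l 0 = Pi.single l 1 := rfl
lemma topM_succ (l : Fin (n+1)) (j : Fin n) : topM z l j.succ = z j := rfl

lemma topM_mulVec (hz : ∀ j < n, ∑ i, x i * z j i = 0) (l : Fin (n+1)) : (topM z l).mulVec x = Pi.single 0 (x l) := by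
  funext a
  rw [Matrix.mulVec, dotProduct]
  refine Fin.cases ?_ (fun j => ?_) a
  · rw [topM_zero]; simp [Pi.single_apply]
  · rw [topM_succ, Pi.single_eq_of_ne (Fin.succ_ne_zero j), ← hz j j.2]
    exact Finset.sum_congr rfl fun i _ => mul_comm _ _

lemma topM_update (l i : Fin (n+1)) : (topM z l).updateRow 0 (Pi.single i 1) = topM z i := by
  funext a
  refine Fin.cases ?_ (fun j => ?_) a
  · rw [Matrix.updateRow_self]; rfl
  · rw [Matrix.updateRow_ne (Fin.succ_ne_zero j)]; rfl

lemma topM_det (hz : ∀ j < n, ∑ i, x i * z j i = 0) (l i : Fin (n+1)) : (topM z l).det * x i = (topM z i).det * x l := by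
  have h1 : (topM z l).adjugate.mulVec ((topM z l).mulVec x) = (topM z l).det • x := by
    rw [Matrix.mulVec_mulVec, Matrix.adjugate_mul, Matrix.smul_mulVec, Matrix.one_mulVec]
  rw [topM_mulVec hz l] at h1
  have h2 := congrFun h1 i
  rw [Matrix.mulVec_single, Pi.smul_apply, Pi.smul_apply, smul_eq_mul, Matrix.col_apply, Matrix.adjugate_apply, topM_update] at h2
  rw [← h2]; simp

lemma perp (hfull : ∀ v : Fin (n+1) → F, ∑ l, x l * v l = 0 → v ∈ VV z n) {v : Fin (n+1) → F} (hv : ∀ j < n, ∑ i, z j i * v i = 0) (i l : Fin (n+1)) :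
    x i * v l = x l * v i := by
  classical
  set f : (Fin (n+1) → F) →ₗ[F] F := ∑ l, v l • LinearMap.proj l with hf
  have hfa : ∀ u, f u = ∑ l, v l * u l := by intro u; simp [hf]
  have h1 : VV z n ≤ LinearMap.ker f := by
    apply Submodule.span_le.2
    rintro _ ⟨j, hj, rfl⟩
    show f _ = 0
    rw [hfa, ← hv j hj]; exact Finset.sum_congr rfl fun i _ => mul_comm _ _
  have h2 := hfull (x i • Pi.single l 1 - x l • Pi.single i 1) (by
    simp [mul_sub, Finset.sum_sub_distrib, Pi.single_apply]; ring)
  have h3 : f (x i • Pi.single l 1 - x l • Pi.single i 1) = 0 := h1 h2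
  rw [hfa] at h3
  simp [mul_sub, Finset.sum_sub_distrib, Pi.single_apply] at h3
  linear_combination h3

lemma topM_ne (hx : ∀ i, x i ≠ 0) (hfull : ∀ v : Fin (n+1) → F, ∑ l, x l * v l = 0 → v ∈ VV z n) (l : Fin (n+1)) : (topM z l).det ≠ 0 := by
  intro h
  obtain ⟨v, hv0, hv⟩ := Matrix.exists_mulVec_eq_zero_iff.2 h
  have h0 : v l = 0 := by
    have := congrFun hv 0
    rw [Matrix.mulVec, dotProduct, topM_zero] at this
    simpa [Pi.single_apply] using this
  apply hv0
  funext i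
  have h1 := perp hfull (v := v) (fun j hj => by
    have := congrFun hv (Fin.succ ⟨j, hj⟩)
    rwa [Matrix.mulVec, dotProduct, topM_succ] at this) i l
  rw [h0, mul_zero] at h1
  exact (mul_eq_zero.1 h1.symm).resolve_left (hx l)

lemma topM_mem {O : Subring F} (hz : ∀ j < n, ∀ i, z j i ∈ O) (l : Fin (n+1)) (a b : Fin (n+1)) : topM z l a b ∈ O := by
  refine Fin.cases ?_ (fun j => ?_) a
  · rw [topM_zero, Pi.single_apply]; split_ifs
    · exact O.one_mem
    · exact O.zero_mem
  · rw [topM_succ]; exact hz j j.2 b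

lemma det_mem {O : Subring F} {ι : Type*} [Fintype ι] [DecidableEq ι] (A : Matrix ι ι F) (h : ∀ a b, A a b ∈ O) : A.det ∈ O := by
  rw [Matrix.det_apply]
  apply O.sum_mem
  intro σ _
  have h1 : ∏ i, A (σ i) i ∈ O := O.prod_mem fun i _ => h _ _
  rcases Int.units_eq_one_or (Equiv.Perm.sign σ) with h2 | h2
  · rw [h2, one_smul]; exact h1
  · rw [h2, Units.neg_smul, one_smul]; exact O.neg_mem h1
end alg

lemma sz_single (hq : Tendsto q 𝓤 atTop) {ι : Type*} [DecidableEq ι] (p : Pl S) (l m : ι) : sz q p ((Pi.single l 1 : ι → GF 𝓤 K) m) 0 := by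
  rw [Pi.single_apply]; split_ifs
  · exact sz_one hq
  · exact sz_zero 0

theorem Dat.hadamard {z : ℕ → Fin (n+1) → GF 𝓤 K} {lam : ℕ → ℝ} (hz : ∀ j < n, D.Lam (z j))
    (hfull : ∀ v : Fin (n+1) → GF 𝓤 K, ∑ l, D.x l * v l = 0 → v ∈ VV z n)
    (hN : ∀ j < n, D.N (fun _ _ => 0) (z j) (lam j)) : D.h ≤ Module.finrank ℚ K * ∑ j ∈ Finset.range n, lam j := by
  have hdet : ∀ l, (topM z l).det ∈ gsub 𝓤 (OI K) := fun l => det_mem _ (topM_mem (fun j hj => (hz j hj).1) l)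
  have hw : ∀ w : InfinitePlace K, sz q (Sum.inl w : Pl S) (topM z (D.ip (Sum.inl w))).det (∑ j ∈ Finset.range n, lam j) := by
    intro w
    have := sz_det (p := (Sum.inl w : Pl S)) D.hq (topM z (D.ip (Sum.inl w))) (Fin.cons 0 (fun j : Fin n => lam j)) (fun _ => 0) (by
      intro a b
      refine Fin.cases ?_ (fun j => ?_) a
      · rw [topM_zero]; simpa using sz_single D.hq (Sum.inl w : Pl S) _ b
      · rw [topM_succ]; simp only [Fin.cons_succ, add_zero]
        apply D.N_ip (hz j j.2).2
        intro l hl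
        simpa using hN j j.2 w l hl)
    rw [Fin.sum_univ_succ] at this
    simp only [Fin.cons_zero, Fin.cons_succ, Finset.sum_const_zero, add_zero, zero_add] at this
    rwa [Finset.sum_range]
  set L := ∑ j ∈ Finset.range n, lam j
  have h0 := topM_ne (z := z) D.x0 hfull 0
  have heq : ∀ p : Pl S, (topM z 0).det = (topM z (D.ip p)).det * D.x 0 * (D.x (D.ip p))⁻¹ := by
    intro p
    have := topM_det (z := z) (x := D.x) (fun j hj => (hz j hj).2) 0 (D.ip p)
    rw [← this, mul_assoc, mul_inv_cancel₀ (D.x0 _), mul_one]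
  have := sz_pf D.hq h0 (gsub_mono (OI_le_OS S) (hdet 0)) (fun p => Sum.elim (fun _ => L) (fun _ => 0) p + D.c p 0 + -D.c p (D.ip p)) (by
    intro p
    rw [heq p]
    refine sz.mul (sz.mul ?_ (D.hc p 0)) (D.hc' p _)
    rcases p with w | v
    · exact hw w
    · exact sz_OI D.hq (hdet _) v)
  simp_rw [mul_add] at this
  rw [Finset.sum_add_distrib, Finset.sum_add_distrib, D.hprod 0, sum_pw_split] at this
  simp only [Sum.elim_inl, Sum.elim_inr, Finset.sum_const_zero, add_zero, mul_neg, Finset.sum_neg_distrib] at this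
  rw [← Finset.sum_mul, sum_inf_mult] at this
  unfold Dat.h
  linarith

lemma Dat.Lam_one : D.Lam 1 := ⟨fun l => (gsub 𝓤 (OI K)).one_mem, by simpa using D.hsum⟩

lemma VV_one_mem {F : Type*} [Field F] {ι : Type*} [Fintype ι] {z : ℕ → ι → F} (h0 : z 0 = 1) {v : ι → F} : v ∈ VV z 1 ↔ ∃ a, v = fun _ => a := by
  have h1 : VV z 1 = Submodule.span F {(1 : ι → F)} := by
    unfold VV; congr 1; ext u
    simp [h0, eq_comm]
  rw [h1, Submodule.mem_span_singleton]
  constructor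
  · rintro ⟨a, rfl⟩; exact ⟨a, by funext i; simp⟩
  · rintro ⟨a, rfl⟩; exact ⟨a, by funext i; simp⟩

set_option maxHeartbeats 1000000 in
theorem Dat.stepA (hn : 2 ≤ n) {ρ0 : ℝ} (hρ0 : 0 < ρ0)
    (hv : ∀ z, D.Lam z → (∀ w i, sz q (Sum.inl w : Pl S) (z i) ρ0) → ∃ a, z = fun _ => a) :
    ∃ (τ : InfinitePlace K → Fin (n+1) → ℝ) (z : ℕ → Fin (n+1) → GF 𝓤 K) (lam : ℕ → ℝ) (U : ℝ),
      z 0 = 1 ∧ (∀ j < n, D.Lam (z j)) ∧ (∀ v : Fin (n+1) → GF 𝓤 K, ∑ l, D.x l * v l = 0 → v ∈ VV z n) ∧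
      (∀ j < n, D.N τ (z j) (lam j)) ∧ (∀ k, 1 ≤ k → k < n → ∑ j ∈ (Finset.range n).erase k, lam j ≤ U) ∧
      n * Module.finrank ℚ K * U + (n - 1) * (D.tot τ - D.h) < 0 := by
  classical
  set d : ℝ := (Module.finrank ℚ K : ℝ) with hd
  have hd0 : 0 < d := by rw [hd]; exact_mod_cast Module.finrank_pos
  have hn2 : (2 : ℝ) ≤ n := by exact_mod_cast hn
  set δ := ρ0 / (8 * n ^ 2) with hδd
  have hδ : 0 < δ := by positivity
  have hδn : δ * (8 * n ^ 2) = ρ0 := by rw [hδd]; field_simp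
  have hδρ : 3 * δ ≤ ρ0 := by
    have h4 : (4 : ℝ) ≤ n ^ 2 := by nlinarith
    rw [← hδn]; nlinarith
  have one_ne : (1 : Fin (n+1) → GF 𝓤 K) ≠ 0 := one_ne_zero
  -- first system
  obtain ⟨z, lam, hz0, hms⟩ := D.ext_sys (fun _ _ => 0) hδ (fun _ => 1) (fun _ => 0) 1 (by omega) (by
    intro j hj
    obtain rfl : j = 0 := by omega
    rw [VV_zero]
    refine ⟨D.Lam_one, by simpa using one_ne, fun w l _ => by simpa using sz_one D.hq, fun z' h1 h2 h3 => ?_⟩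
    have := D.pfN (T := 0) h1 (by simpa using h2) h3 (fun _ _ _ => le_rfl)
    linarith)
  have hz00 : z 0 = 1 := (hz0 0 (by omega)).1
  have hl0 : lam 0 = 0 := (hz0 0 (by omega)).2
  have hl1 : ρ0 < lam 1 := by
    by_contra hc
    push Not at hc
    obtain ⟨h1, h2, h3, -⟩ := hms 1 (by omega)
    apply h2
    rw [VV_one_mem hz00]
    apply hv _ h1
    intro w i
    apply D.N_ip h1.2
    intro l hl
    exact (h3 w l hl).mono D.hq (by linarith)
  have hhad := D.hadamard (fun j hj => (hms j hj).1) (fun v hv => D.full hms hv) (fun j hj => (hms j hj).2.2.1)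
  -- twist
  choose π hπ hπ2 using fun w => D.flag z (fun _ => 0) w
  choose τ hτ1 hτ2 using fun w => flag_b (hπ w) (fun j => if j = 0 then (0 : ℝ) else lam j - lam 1)
  have htot : D.tot τ = d * (∑ j ∈ Finset.range n, lam j - (n - 1) * lam 1) := by
    have h1 : ∑ j ∈ Finset.range n, (if j = 0 then (0 : ℝ) else lam j - lam 1) = ∑ j ∈ Finset.range n, lam j - (n - 1) * lam 1 := by
      have h2 : ∀ j ∈ Finset.range n, (if j = 0 then (0 : ℝ) else lam j - lam 1) = lam j - lam 1 + (if j = 0 then lam 1 else 0) := by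
        intro j _; split_ifs with h
        · rw [h, hl0]; ring
        · ring
      rw [Finset.sum_congr rfl h2, Finset.sum_add_distrib, Finset.sum_sub_distrib, Finset.sum_ite_eq' (Finset.range n) 0, if_pos (Finset.mem_range.2 (by omega))]
      simp; ring
    unfold Dat.tot
    simp_rw [hτ2, h1]
    rw [← Finset.sum_mul, sum_inf_mult]
  have hmem : ∀ w, ∀ j < n, π w j ≠ D.ip (Sum.inl w) := fun w j hj =>
    Finset.ne_of_mem_erase ((hπ w).mapsTo (x := j) (by simpa using hj))
  have claim : ∀ v, D.Lam v → v ∉ VV z 1 → ¬ D.N τ v (lam 1 - 2 * δ) := by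
    intro v h1 h2 h3
    obtain ⟨J, hJ1, hJn, hJ2, hJ3⟩ := VV_level z (k := 1) v (D.full hms h1.2) h2
    apply (hms J hJn).2.2.2 v h1 hJ2
    intro w l hl
    apply hπ2 w (J+1) (by omega) v hJ3 _ _ l hl
    intro j hj
    have h4 := h3 w (π w j) (hmem w j (by omega))
    rw [hτ1 w j (by omega)] at h4
    refine h4.mono D.hq ?_
    have h5 := D.MinSys_mono hms hJ1 hJn
    have h6 := D.MinSys_mono hms (show j ≤ J by omega) hJn
    split_ifs <;> linarith
  obtain ⟨z', lam', hz0', hms'⟩ := D.ext_sys τ (show 0 < 2 * δ by linarith) (fun _ => 1) (fun _ => δ) 1 (by omega) (by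
    intro j hj
    obtain rfl : j = 0 := by omega
    rw [VV_zero]
    refine ⟨D.Lam_one, by simpa using one_ne, fun w l hl => ?_, fun v h1 h2 h3 => ?_⟩
    · obtain ⟨j, hj, rfl⟩ := flag_ex (hπ w) (show l ∈ Finset.univ.erase (D.iw w) from Finset.mem_erase.2 ⟨hl, Finset.mem_univ _⟩)
      rw [hτ1 w j hj]
      refine (sz_one D.hq).mono D.hq ?_
      split_ifs with h
      · linarith
      · have := D.MinSys_mono hms (show 1 ≤ j by omega) hj; linarith
    · by_cases h4 : v ∈ VV z 1
      · obtain ⟨a, rfl⟩ := (VV_one_mem hz00).1 h4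
        have ha : a ≠ 0 := by rintro rfl; exact h2 (Submodule.zero_mem _)
        have := pf_OI (S := S) D.hq (h1.1 0) ha (-δ) (fun w => by
          have h5 := h3 w (π w 0) (hmem w 0 (by omega))
          rw [hτ1 w 0 (by omega), if_pos rfl] at h5
          exact h5.mono D.hq (by linarith))
        linarith
      · exact claim v h1 h4 (D.N_mono h3 (by linarith)))
  have hz00' : z' 0 = 1 := (hz0' 0 (by omega)).1
  have hM2 := D.M2 hms'
  have hlk : ∀ k, 1 ≤ k → k < n → lam 1 - 2 * δ < lam' k := by
    intro k hk1 hk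
    by_contra hc
    push Not at hc
    obtain ⟨h1, h2, h3, -⟩ := hms' k hk
    apply claim _ h1 _ (D.N_mono h3 hc)
    intro h4
    apply h2
    apply VV_mono z' hk1
    rw [VV_one_mem hz00'] ; rwa [VV_one_mem hz00] at h4
  refine ⟨τ, z', lam', (D.h + 4 * δ * d * n - D.tot τ) / d - (lam 1 - 2 * δ), hz00', fun j hj => (hms' j hj).1,
    fun v hv => D.full hms' hv, fun j hj => (hms' j hj).2.2.1, fun k hk1 hk => ?_, ?_⟩
  · have h1 := Finset.add_sum_erase (Finset.range n) lam' (Finset.mem_range.2 hk)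
    have h2 := hlk k hk1 hk
    have h3 : ∑ j ∈ Finset.range n, lam' j ≤ (D.h + 4 * δ * d * n - D.tot τ) / d := by
      rw [le_div_iff₀ hd0]; linarith
    linarith
  · set T := D.tot τ with hT
    set Q := ∑ j ∈ Finset.range n, lam j with hQ
    set H := D.h with hH
    set a := lam 1 with ha
    have h1 : (n : ℝ) * d * ((H + 4 * δ * d * n - T) / d - (a - 2 * δ)) = n * (H + 4 * δ * d * n - T - d * (a - 2 * δ)) := by field_simp
    rw [h1, htot]
    have hhad2 : H - d * Q ≤ 0 := by rw [hH, hQ, hd]; linarith [hhad]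
    clear_value T Q H a d
    have h2 : (n : ℝ) * (H + 4 * δ * d * n - d * (Q - (n - 1) * a) - d * (a - 2 * δ)) + (n - 1) * (d * (Q - (n - 1) * a) - H)
      = (H - d * Q) - d * a + d * (4 * (δ * n ^ 2) + 2 * (δ * n)) := by ring
    rw [h2]
    have h3 : δ * n ≤ δ * n ^ 2 := by
      apply mul_le_mul_of_nonneg_left _ hδ.le; nlinarith
    have h4 : d * (4 * (δ * n ^ 2) + 2 * (δ * n)) < d * a := by
      apply mul_lt_mul_of_pos_left _ hd0
      nlinarith
    linarith
end dat
end MLT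

set_option linter.unusedSectionVars false
namespace MLT
open NumberField Filter

section dat
variable {K : Type*} [Field K] [NumberField K]
variable {𝓤 : Ultrafilter ℕ} {S : Finset (FinitePlace K)} {q : ℕ → ℝ} {n : ℕ} (D : Dat 𝓤 S q n)

section alg
variable {F : Type*} [Field F] {z : ℕ → Fin (n+1) → F} {x : Fin (n+1) → F}

lemma adj_self (l : Fin (n+1)) (k : Fin n) : (topM z l).adjugate l k.succ = 0 := by
  have h := congrFun (congrFun (Matrix.mul_adjugate (topM z l)) 0) k.succ
  rw [Matrix.mul_apply, Matrix.smul_apply, Matrix.one_apply_ne (Fin.succ_ne_zero k).symm, topM_zero] at h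
  simpa [Pi.single_apply] using h

lemma adj_dot (l : Fin (n+1)) (j k : Fin n) : ∑ i, z j i * (topM z l).adjugate i k.succ = if j = k then (topM z l).det else 0 := by
  have h := congrFun (congrFun (Matrix.mul_adjugate (topM z l)) j.succ) k.succ
  rw [Matrix.mul_apply, Matrix.smul_apply, topM_succ, Matrix.one_apply] at h
  rw [h]
  by_cases hjk : j = k
  · simp [hjk]
  · simp [hjk]

lemma adj_rel (hx : ∀ i, x i ≠ 0) (hz : ∀ j < n, ∑ i, x i * z j i = 0)
    (hfull : ∀ v : Fin (n+1) → F, ∑ l, x l * v l = 0 → v ∈ VV z n) (l i : Fin (n+1)) (k : Fin n) :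
    (topM z 0).adjugate i k.succ / (x i * x 0) - (topM z 0).adjugate l k.succ / (x l * x 0) = (topM z l).adjugate i k.succ / (x i * x l) := by
  have h := perp (x := x) hfull (v := fun m => (topM z 0).adjugate m k.succ * x l - (topM z l).adjugate m k.succ * x 0) (by
    intro j hj
    have h1 := adj_dot (z := z) 0 ⟨j, hj⟩ k
    have h2 := adj_dot (z := z) l ⟨j, hj⟩ k
    simp only [mul_sub, Finset.sum_sub_distrib, ← mul_assoc, ← Finset.sum_mul]
    simp only at h1 h2
    rw [h1, h2]
    split_ifs
    · rw [topM_det hz 0 l]; ring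
    · ring) i l
  rw [adj_self] at h
  have h1 := hx i; have h2 := hx l; have h3 := hx 0
  field_simp
  apply mul_left_cancel₀ h2
  linear_combination -h

lemma adj_span (hdet : (topM z 0).det ≠ 0) (s : Fin (n+1) → F) (hs : s 0 = 0) (i : Fin (n+1)) :
    s i = ∑ k : Fin n, ((∑ m, z k m * s m) / (topM z 0).det) * (topM z 0).adjugate i k.succ := by
  have h : (topM z 0).adjugate.mulVec ((topM z 0).mulVec s) = (topM z 0).det • s := by
    rw [Matrix.mulVec_mulVec, Matrix.adjugate_mul, Matrix.smul_mulVec, Matrix.one_mulVec]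
  have h2 := congrFun h i
  rw [Matrix.mulVec, dotProduct, Fin.sum_univ_succ] at h2
  have h3 : (topM z 0).mulVec s 0 = 0 := by
    rw [Matrix.mulVec, dotProduct, topM_zero]; simpa [Pi.single_apply] using hs
  rw [h3, mul_zero, zero_add, Pi.smul_apply, smul_eq_mul] at h2
  have h4 : s i = (∑ k : Fin n, (topM z 0).adjugate i k.succ * (topM z 0).mulVec s k.succ) / (topM z 0).det := by
    rw [h2]; field_simp
  rw [h4, Finset.sum_div]
  refine Finset.sum_congr rfl fun k _ => ?_
  rw [Matrix.mulVec, dotProduct, topM_succ]; ring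
end alg

theorem Dat.adj_sz {τ : InfinitePlace K → Fin (n+1) → ℝ} {z : ℕ → Fin (n+1) → GF 𝓤 K} {lam : ℕ → ℝ} (hz : ∀ j < n, D.Lam (z j))
    (hN : ∀ j < n, D.N τ (z j) (lam j)) (w : InfinitePlace K) (i : Fin (n+1)) (hi : i ≠ D.iw w) (k : Fin n) :
    sz q (Sum.inl w : Pl S) ((topM z (D.iw w)).adjugate i k.succ)
      (∑ j ∈ (Finset.range n).erase k, lam j + (∑ m ∈ Finset.univ.erase (D.iw w), τ w m - τ w i)) := by
  classical
  set T := ∑ m, |τ w m| with hT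
  have hTm : ∀ m, τ w m ≤ T := fun m => (le_abs_self _).trans
    (Finset.single_le_sum (f := fun m => |τ w m|) (fun m _ => abs_nonneg _) (Finset.mem_univ m))
  rw [Matrix.adjugate_apply]
  have h := sz_det (p := (Sum.inl w : Pl S)) D.hq ((topM z (D.iw w)).updateRow k.succ (Pi.single i 1))
    (Fin.cons (-T) (fun j : Fin n => if j = k then -τ w i else lam j)) (fun m => if m = D.iw w then T else τ w m) (by
    intro a m
    refine Fin.cases ?_ (fun j => ?_) a
    · rw [Matrix.updateRow_ne (Fin.succ_ne_zero k).symm, topM_zero]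
      simp only [Fin.cons_zero]
      by_cases hm : m = D.iw w
      · rw [if_pos hm]; simpa using sz_single D.hq (Sum.inl w : Pl S) _ m
      · rw [Pi.single_eq_of_ne hm]; exact sz_zero _
    · simp only [Fin.cons_succ]
      by_cases hj : j = k
      · rw [hj, Matrix.updateRow_self, if_pos rfl]
        by_cases hm : m = i
        · rw [hm, if_neg hi]; simpa using sz_single D.hq (Sum.inl w : Pl S) i i
        · rw [Pi.single_eq_of_ne hm]; exact sz_zero _
      · rw [if_neg hj, Matrix.updateRow_ne (by simpa using hj), topM_succ]
        by_cases hm : m = D.iw w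
        · rw [if_pos hm]
          apply D.N_ip (hz j j.2).2
          intro l hl
          exact (hN j j.2 w l hl).mono D.hq (by linarith [hTm l])
        · rw [if_neg hm]; exact (hN j j.2 w m hm).mono D.hq (by linarith))
  have e1 : ∑ m, (if m = D.iw w then T else τ w m) = T + ∑ m ∈ Finset.univ.erase (D.iw w), τ w m := by
    rw [← Finset.add_sum_erase _ _ (Finset.mem_univ (D.iw w)), if_pos rfl]
    congr 1
    exact Finset.sum_congr rfl fun m hm => if_neg (Finset.ne_of_mem_erase hm)
  have e2 : ∑ j : Fin n, (if j = k then -τ w i else lam j) = -τ w i + ∑ j ∈ (Finset.range n).erase k, lam j := by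
    rw [← Finset.add_sum_erase _ _ (Finset.mem_univ k), if_pos rfl]
    congr 1
    have e3 := Finset.add_sum_erase (Finset.range n) lam (Finset.mem_range.2 k.2)
    have e4 := Finset.add_sum_erase Finset.univ (fun j : Fin n => lam j) (Finset.mem_univ k)
    rw [Finset.sum_range] at e3
    rw [Finset.sum_congr rfl fun j hj => if_neg (Finset.ne_of_mem_erase hj)]
    linarith
  rw [Fin.sum_univ_succ] at h
  simp only [Fin.cons_zero, Fin.cons_succ, e1, e2] at h
  exact h.mono D.hq (by linarith)

lemma sum_succAbove_eq {n : ℕ} (f : Fin (n+1) → ℝ) (p : Fin (n+1)) : ∑ a, f (p.succAbove a) = ∑ i ∈ Finset.univ.erase p, f i := by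
  have h1 := Fin.sum_univ_succAbove f p
  have h2 := Finset.add_sum_erase Finset.univ f (Finset.mem_univ p)
  linarith

/-- The forms used. -/
def Lf (p : Fin (n+1)) : Matrix (Fin n) (Fin n) ℤ := fun a c =>
  (if p.succAbove a = c.succ then 1 else 0) - (if p = c.succ then 1 else 0)
/-- The inverse. -/
def Mf (p : Fin (n+1)) : Matrix (Fin n) (Fin n) ℤ := fun c a =>
  (if p.succAbove a = c.succ then 1 else 0) - (if p.succAbove a = 0 then 1 else 0)

lemma MfLf (p : Fin (n+1)) : Mf p * Lf p = 1 := by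
  funext c c'
  rw [Matrix.mul_apply]
  unfold Mf Lf
  have h := Fin.sum_univ_succAbove (fun i : Fin (n+1) => ((if i = c.succ then (1:ℤ) else 0) - (if i = 0 then 1 else 0)) *
    ((if i = c'.succ then 1 else 0) - (if p = c'.succ then 1 else 0))) p
  have h2 : ∑ i : Fin (n+1), ((if i = c.succ then (1:ℤ) else 0) - (if i = 0 then 1 else 0)) *
    ((if i = c'.succ then 1 else 0) - (if p = c'.succ then 1 else 0)) = if c = c' then 1 else 0 := by
    simp only [sub_mul, ite_mul, one_mul, zero_mul, Finset.sum_sub_distrib, Finset.sum_ite_eq', Finset.sum_ite_eq, Finset.mem_univ, if_true]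
    rw [if_neg (Fin.succ_ne_zero c').symm]
    simp
  rw [h2] at h
  rw [Matrix.one_apply, h]
  simp

lemma Lf_apply {F : Type*} [Field F] (p : Fin (n+1)) (ζ : Fin (n+1) → F) (h0 : ζ 0 = 0) (a : Fin n) :
    ∑ c : Fin n, ((Lf p a c : ℤ) : F) * ζ c.succ = ζ (p.succAbove a) - ζ p := by
  have h : ∀ i : Fin (n+1), ∑ c : Fin n, (if i = c.succ then (1:F) else 0) * ζ c.succ = ζ i := by
    intro i
    have := Fin.sum_univ_succ (fun j : Fin (n+1) => (if i = j then (1:F) else 0) * ζ j)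
    rw [h0, mul_zero, zero_add] at this
    rw [← this]; simp
  rw [← h (p.succAbove a), ← h p, ← Finset.sum_sub_distrib]
  refine Finset.sum_congr rfl fun c _ => ?_
  unfold Lf
  push_cast
  ring

set_option maxHeartbeats 1000000 in
theorem Dat.partD (hn : 2 ≤ n) {w0 : GF 𝓤 K} (hw0 : w0 ≠ 0) (hw0s : ∀ p : Pl S, sz q p w0 0)
    (hw0x : ∀ i, w0 / D.x i ∈ gsub 𝓤 (OS S)) {ρ0 : ℝ} (hρ0 : 0 < ρ0)
    (hv : ∀ z, D.Lam z → (∀ w i, sz q (Sum.inl w : Pl S) (z i) ρ0) → ∃ a, z = fun _ => a)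
    (i0 k0 : Fin n) (hvi : ∃ p, D.c p k0.succ ≠ D.c p i0.succ) : False := by
  classical
  obtain ⟨τ, z, lam, U, hz0, hzL, hfull, hN, hU, hneg⟩ := D.stepA hn hρ0 hv
  have hki : k0 ≠ i0 := by rintro rfl; obtain ⟨p, hp⟩ := hvi; exact hp rfl
  -- ζ
  set ζ : Fin n → Fin (n+1) → GF 𝓤 K := fun k i => if (k : ℕ) = 0 then 0 else (topM z 0).adjugate i k.succ / (D.x i * D.x 0) * w0 ^ 2 with hζ
  have hζ0 : ∀ k, ζ k 0 = 0 := by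
    intro k; simp only [hζ]; rw [adj_self]; simp
  have hζd : ∀ (k : Fin n) (i l : Fin (n+1)), (k : ℕ) ≠ 0 → ζ k i - ζ k l = (topM z l).adjugate i k.succ * (D.x i)⁻¹ * (D.x l)⁻¹ * (w0 * w0) := by
    intro k i l hk
    simp only [hζ, if_neg hk]
    have := adj_rel (z := z) D.x0 (fun j hj => (hzL j hj).2) hfull l i k
    rw [← sub_mul, this]
    have h1 := D.x0 i; have h2 := D.x0 l
    field_simp
  have hadj : ∀ l i k, (topM z l).adjugate i k ∈ gsub 𝓤 (OI K) := by
    intro l i k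
    rw [Matrix.adjugate_apply]
    apply det_mem
    intro a b
    by_cases ha : a = k
    · rw [ha, Matrix.updateRow_self, Pi.single_apply]
      split_ifs
      · exact Subring.one_mem _
      · exact Subring.zero_mem _
    · rw [Matrix.updateRow_ne ha]
      exact topM_mem (fun j hj => (hzL j hj).1) l a b
  have hζS : ∀ k i, ζ k i ∈ gsub 𝓤 (OS S) := by
    intro k i
    by_cases hk : (k : ℕ) = 0
    · simp only [hζ, if_pos hk]; exact Subring.zero_mem _
    · have h1 : ζ k i = (topM z 0).adjugate i k.succ * (w0 / D.x i) * (w0 / D.x 0) := by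
        simp only [hζ, if_neg hk]
        have h1 := D.x0 i; have h2 := D.x0 0
        field_simp
      rw [h1]
      exact Subring.mul_mem _ (Subring.mul_mem _ (gsub_mono (OI_le_OS S) (hadj _ _ _)) (hw0x i)) (hw0x 0)
  -- exponents
  set E : Pl S → Fin (n+1) → ℝ := fun p i => Sum.elim (fun w => U + (∑ m ∈ Finset.univ.erase (D.iw w), τ w m - τ w i)) (fun _ => 0) p + -D.c p i + -D.c p (D.ip p) with hE
  have hEs : ∀ p i k, i ≠ D.ip p → sz q p (ζ k i - ζ k (D.ip p)) (E p i) := by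
    intro p i k hi
    by_cases hk : (k : ℕ) = 0
    · simp only [hζ, if_pos hk, sub_zero]; exact sz_zero _
    rw [hζd k i _ hk]
    have h1 : sz q p ((topM z (D.ip p)).adjugate i k.succ) (Sum.elim (fun w => U + (∑ m ∈ Finset.univ.erase (D.iw w), τ w m - τ w i)) (fun _ => 0) p) := by
      rcases p with w | v
      · refine (D.adj_sz hzL hN w i hi k).mono D.hq ?_
        have := hU k (by omega) k.2
        simp only [Sum.elim_inl]; linarith
      · exact sz_OI D.hq (hadj _ _ _) v
    have h2 := ((h1.mul (D.hc' p i)).mul (D.hc' p (D.ip p))).mul ((hw0s p).mul (hw0s p))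
    exact h2.mono D.hq (by simp only [hE]; linarith)
  have hEsum : ∑ p, pw p * ∑ a : Fin n, E p ((D.ip p).succAbove a) = n * Module.finrank ℚ K * U + (n - 1) * (D.tot τ - D.h) := by
    have h1 : ∀ p, ∑ a : Fin n, E p ((D.ip p).succAbove a) = Sum.elim (fun w => n * U + (n - 1) * ∑ m ∈ Finset.univ.erase (D.iw w), τ w m) (fun _ => 0) p
        + (-∑ i, D.c p i) + -((n - 1) * D.c p (D.ip p)) := by
      intro p
      rw [sum_succAbove_eq (E p) (D.ip p)]
      have hcard : (((Finset.univ : Finset (Fin (n+1))).erase (D.ip p)).card : ℝ) = n := by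
        rw [Finset.card_erase_of_mem (Finset.mem_univ _)]; simp
      have h2 : ∑ i, D.c p i = D.c p (D.ip p) + ∑ i ∈ Finset.univ.erase (D.ip p), D.c p i := (Finset.add_sum_erase _ _ (Finset.mem_univ _)).symm
      simp only [hE, Finset.sum_add_distrib, Finset.sum_neg_distrib, Finset.sum_const, nsmul_eq_mul, hcard, h2]
      rcases p with w | v
      · simp only [Sum.elim_inl, Finset.sum_add_distrib, Finset.sum_sub_distrib, Finset.sum_const, nsmul_eq_mul, hcard]
        unfold Dat.iw
        ring
      · simp only [Sum.elim_inr, Finset.sum_const_zero]; ring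
    have h3 : ∑ p, pw p * ∑ i, D.c p i = 0 := by
      simp_rw [Finset.mul_sum]
      rw [Finset.sum_comm]
      exact Finset.sum_eq_zero fun i _ => D.hprod i
    simp_rw [h1, mul_add, Finset.sum_add_distrib, mul_neg, Finset.sum_neg_distrib]
    rw [h3, sum_pw_split]
    simp only [Sum.elim_inl, Sum.elim_inr, mul_add, Finset.sum_add_distrib, Finset.sum_const_zero]
    rw [← Finset.sum_mul, sum_inf_mult]
    have h4 : ∑ w : InfinitePlace K, (w.mult : ℝ) * ((n - 1) * ∑ m ∈ Finset.univ.erase (D.iw w), τ w m) = (n - 1) * D.tot τ := by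
      unfold Dat.tot; rw [Finset.mul_sum]
      exact Finset.sum_congr rfl fun w _ => by ring
    have h5 : ∑ p, pw p * ((n - 1) * D.c p (D.ip p)) = (n - 1) * D.h := by
      unfold Dat.h; rw [Finset.mul_sum]
      exact Finset.sum_congr rfl fun w _ => by ring
    rw [h4, h5]; ring
  set η := n * Module.finrank ℚ K * U + (n - 1) * (D.tot τ - D.h) with hη
  clear_value η
  set W := ∑ p : Pl S, pw p with hW
  have hW0 : 0 < W := pw_sum_pos S
  have hn0 : (0 : ℝ) < n := by exact_mod_cast (by omega : 0 < n)
  set ε := -η / (2 * n * W) with hε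
  have hε0 : 0 < ε := by rw [hε]; apply div_pos <;> [linarith; positivity]
  have hεW : ε * n * W = -η / 2 := by rw [hε]; field_simp
  -- the place
  obtain ⟨p0, hp0⟩ : ∃ p, 0 < D.c p k0.succ - D.c p i0.succ := by
    have h1 : ∑ p, pw p * (D.c p k0.succ - D.c p i0.succ) = 0 := by
      simp_rw [mul_sub, Finset.sum_sub_distrib]; rw [D.hprod, D.hprod, sub_zero]
    obtain ⟨p, hp⟩ := hvi
    obtain ⟨p', -, hp'⟩ := Finset.exists_pos_of_sum_zero_of_exists_nonzero _ h1 ⟨p, Finset.mem_univ _, mul_ne_zero (pw_pos p).ne' (sub_ne_zero.2 hp)⟩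
    exact ⟨p', (mul_pos_iff_of_pos_left (pw_pos p')).1 hp'⟩
  set γ := D.c p0 k0.succ - D.c p0 i0.succ with hγ
  -- spanning
  have hspan : ∀ᶠ t in 𝓤, ∀ u : Fin n → K, ∑ c : Fin n, rep (D.x c.succ) t * u c = 0 → ∃ b : Fin n → K, ∀ i, u i = ∑ a, b a * rep (ζ a i.succ) t := by
    by_contra hcon
    rw [← Ultrafilter.eventually_not] at hcon
    push Not at hcon
    have hch : ∀ t, ∃ u : Fin n → K, (∃ u : Fin n → K, ∑ c : Fin n, rep (D.x c.succ) t * u c = 0 ∧ ∀ b : Fin n → K, ∃ i, u i ≠ ∑ a, b a * rep (ζ a i.succ) t) →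
        ∑ c : Fin n, rep (D.x c.succ) t * u c = 0 ∧ ∀ b : Fin n → K, ∃ i, u i ≠ ∑ a, b a * rep (ζ a i.succ) t := by
      intro t
      by_cases h : ∃ u : Fin n → K, ∑ c : Fin n, rep (D.x c.succ) t * u c = 0 ∧ ∀ b : Fin n → K, ∃ i, u i ≠ ∑ a, b a * rep (ζ a i.succ) t
      · obtain ⟨u, hu⟩ := h; exact ⟨u, fun _ => hu⟩
      · exact ⟨0, fun h' => absurd h' h⟩
    choose u hu using hch
    set g : Fin n → GF 𝓤 K := fun i => ((fun t => u t i : ℕ → K) : GF 𝓤 K) with hg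
    have hrepg : ∀ᶠ t in 𝓤, ∀ i, rep (g i) t = u t i := eventually_all.2 fun i => rep_coe _
    have hgsum : ∑ c : Fin n, D.x c.succ * g c = 0 := by
      rw [rep_eq_iff]
      filter_upwards [rep_sum Finset.univ (fun c : Fin n => D.x c.succ * g c), rep_zero (𝓤 := 𝓤) (K := K), hcon, hrepg,
        eventually_all.2 fun c : Fin n => rep_mul (D.x c.succ) (g c)] with t h1 h2 h3 h4 h5
      rw [h1, h2, ← (hu t h3).1]
      exact Finset.sum_congr rfl fun c _ => by rw [h5, h4]
    set s : Fin (n+1) → GF 𝓤 K := Fin.cons 0 (fun c => D.x c.succ * g c) with hs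
    have hs0 : s 0 = 0 := rfl
    have hsz0 : ∑ m, z 0 m * s m = 0 := by
      rw [hz0, Fin.sum_univ_succ, hs0, mul_zero, zero_add]
      simpa [hs] using hgsum
    have hdet := topM_ne (z := z) D.x0 hfull 0
    have hsp := fun i => adj_span hdet s hs0 i
    set b : Fin n → GF 𝓤 K := fun k => (∑ m, z k m * s m) / (topM z 0).det * (D.x 0 / w0 ^ 2) with hb
    have hgb : ∀ i : Fin n, g i = ∑ a, b a * ζ a i.succ := by
      intro i
      have h1 := hsp i.succ
      have h2 : s i.succ = D.x i.succ * g i := rfl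
      have hx := D.x0 i.succ
      have h3 : g i = (D.x i.succ)⁻¹ * s i.succ := by rw [h2]; field_simp
      rw [h3, h1, Finset.mul_sum]
      refine Finset.sum_congr rfl fun k _ => ?_
      by_cases hk : (k : ℕ) = 0
      · simp only [hζ, if_pos hk]; rw [hk, hsz0]; simp
      · simp only [hζ, hb, if_neg hk]
        have hx0 := D.x0 0
        field_simp
    have hev : ∀ᶠ t in 𝓤, ∀ i, rep (g i) t = ∑ a, rep (b a) t * rep (ζ a i.succ) t := by
      rw [eventually_all]
      intro i
      rw [hgb i]
      filter_upwards [rep_sum Finset.univ (fun a : Fin n => b a * ζ a i.succ), eventually_all.2 fun a : Fin n => rep_mul (b a) (ζ a i.succ)] with t h1 h2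
      rw [h1]; exact Finset.sum_congr rfl fun c _ => h2 c
    obtain ⟨t, h1, h2, h3⟩ := (hcon.and (hrepg.and hev)).exists
    obtain ⟨i, hi⟩ := (hu t h1).2 (fun a => rep (b a) t)
    exact hi (by rw [← h2, h3])
  refine TR S hn (fun p a => E p ((D.ip p).succAbove a) + ε) ?_ (fun p => Lf (D.ip p)) (fun p => Mf (D.ip p)) (fun p => MfLf _)
    (pw p0 * (γ / 2)) (mul_pos (pw_pos _) (by linarith)) i0 k0 hki (ι := Fin n) ?_
  · simp_rw [← Finset.mul_sum, Finset.sum_add_distrib, mul_add, Finset.sum_add_distrib]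
    rw [hEsum, ← Finset.sum_mul]
    simp only [Finset.sum_const, Finset.card_univ, Fintype.card_fin, nsmul_eq_mul]
    rw [← hW]
    nlinarith
  · intro T
    have hsize : ∀ᶠ t in 𝓤, ∀ p (i a : Fin n), pa p (∑ i', ((Lf (D.ip p) i i' : ℤ) : K) * rep (ζ a i'.succ) t) ≤ Real.exp ((E p ((D.ip p).succAbove i) + ε) * q t) := by
      rw [eventually_all]; intro p
      rw [eventually_all]; intro i
      rw [eventually_all]; intro a
      have h1 := hEs p _ a (Fin.succAbove_ne (D.ip p) i) ε hε0
      have h0 : ∀ᶠ t in 𝓤, rep (ζ a 0) t = 0 := by rw [hζ0]; exact rep_zero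
      filter_upwards [h1, h0, rep_sub (ζ a ((D.ip p).succAbove i)) (ζ a (D.ip p))] with t h1 h2 h3
      rw [Lf_apply (D.ip p) (fun j => rep (ζ a j) t) h2 i, ← h3]
      exact h1
    have hht : sz q p0 (D.x i0.succ * (D.x k0.succ)⁻¹) (-γ) :=
      ((D.hc p0 i0.succ).mul (D.hc' p0 k0.succ)).mono D.hq (by linarith)
    obtain ⟨t, h1, h2, h3, h4, h5, h6, h7, h8, h9, h10⟩ := ((D.hq.eventually_ge_atTop T).and (hspan.and (hsize.and ((eventually_all.2 fun k => eventually_all.2 fun i => hζS k i).and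
      ((rep_ne _ (D.x0 i0.succ)).and ((rep_ne _ (D.x0 k0.succ)).and ((hht (γ/2) (by linarith)).and ((rep_mul (D.x i0.succ) (D.x k0.succ)⁻¹).and ((rep_inv (D.x k0.succ)).and (ev_pos D.hq)))))))))).exists
    refine ⟨q t, h1, fun a i => rep (ζ a i.succ) t, fun i => rep (D.x i.succ) t, fun a i => (mem_OS S _).1 (h4 a i.succ), h3, h5, h2, ?_⟩
    unfold hS
    refine le_trans ?_ (Finset.single_le_sum (f := fun p => pw p * Real.posLog (pa p _)) (fun p _ => mul_nonneg (pw_pos p).le Real.posLog_nonneg) (Finset.mem_univ p0))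
    simp only
    rw [mul_assoc]
    apply mul_le_mul_of_nonneg_left _ (pw_pos p0).le
    refine le_trans ?_ (le_max_right _ _)
    rw [h8, h9, map_mul, map_inv₀] at h7
    rw [map_div₀, AbsoluteValue.map_neg]
    have hp1 : 0 < pa p0 (rep (D.x i0.succ) t) := (pa p0).pos h5
    have hp2 : 0 < pa p0 (rep (D.x k0.succ) t) := (pa p0).pos h6
    rw [Real.le_log_iff_exp_le (by positivity), le_div_iff₀ hp1]
    rw [← div_eq_mul_inv, div_le_iff₀ hp2] at h7
    have h11 : Real.exp (γ / 2 * q t) * Real.exp ((-γ + γ/2) * q t) = 1 := by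
      rw [← Real.exp_add, ← Real.exp_zero]; congr 1; ring
    calc _ ≤ Real.exp (γ / 2 * q t) * (Real.exp ((-γ + γ/2) * q t) * pa p0 (rep (D.x k0.succ) t)) := by gcongr
      _ = _ := by rw [← mul_assoc, h11, one_mul]
end dat
end MLT

set_option linter.unusedSectionVars false
namespace MLT
open NumberField Filter

section dat
variable {K : Type*} [Field K] [NumberField K]
variable {𝓤 : Ultrafilter ℕ} {S : Finset (FinitePlace K)} {q : ℕ → ℝ} {n : ℕ} (D : Dat 𝓤 S q n)

lemma sz_one_le (hq : Tendsto q 𝓤 atTop) {p : Pl S} {c : ℝ} (h : sz q p (1 : GF 𝓤 K) c) : 0 ≤ c := by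
  by_contra hc
  push Not at hc
  obtain ⟨t, h1, h2, h3⟩ := ((h (-c/2) (by linarith)).and ((rep_one (𝓤 := 𝓤) (K := K)).and (ev_pos hq))).exists
  rw [h2, map_one] at h1
  have : Real.exp ((c + -c/2) * q t) < 1 := by
    rw [Real.exp_lt_one_iff]
    nlinarith
  linarith

lemma diag {α : Type*} [Nonempty α] (hq : Tendsto q 𝓤 atTop) (P : ℕ → ℕ → α → Prop)
    (mono : ∀ m M t z, M ≤ m → P m t z → P M t z) (h : ∀ m, ∀ᶠ t in 𝓤, ∃ z, P m t z) :
    ∃ z : ℕ → α, ∀ M, ∀ᶠ t in 𝓤, P M t (z t) := by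
  classical
  have hch : ∀ t, ∃ z, (∃ z, P (Nat.findGreatest (fun m => ∃ z, P m t z) ⌊q t⌋₊) t z) → P (Nat.findGreatest (fun m => ∃ z, P m t z) ⌊q t⌋₊) t z := by
    intro t
    by_cases h : ∃ z, P (Nat.findGreatest (fun m => ∃ z, P m t z) ⌊q t⌋₊) t z
    · obtain ⟨z, hz⟩ := h; exact ⟨z, fun _ => hz⟩
    · exact ⟨Classical.arbitrary α, fun h' => absurd h' h⟩
  choose z hz using hch
  refine ⟨z, fun M => ?_⟩
  filter_upwards [h M, hq.eventually_ge_atTop (M : ℝ)] with t h1 h2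
  have h3 : M ≤ ⌊q t⌋₊ := Nat.le_floor h2
  exact mono _ M t _ (Nat.le_findGreatest h3 h1) (hz t (Nat.findGreatest_spec (P := fun m => ∃ z, P m t z) h3 h1))

lemma Dat.rho (hv : ∀ z, D.Lam z → (∀ w i, sz q (Sum.inl w : Pl S) (z i) 0) → ∃ a, z = fun _ => a) :
    ∃ ρ0 : ℝ, 0 < ρ0 ∧ ∀ z, D.Lam z → (∀ w i, sz q (Sum.inl w : Pl S) (z i) ρ0) → ∃ a, z = fun _ => a := by
  by_contra hcon
  push Not at hcon
  obtain ⟨z, hz⟩ := diag (α := Fin (n+1) → K) D.hq (fun m t z => (∀ l, z l ∈ OI K) ∧ ∑ l, rep (D.x l) t * z l = 0 ∧ (∃ l l', z l ≠ z l') ∧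
      0 < q t ∧ ∀ (w : InfinitePlace K) i, w (z i) ≤ Real.exp ((2 / ((m:ℝ) + 1)) * q t)) (by
    rintro m M t z hM ⟨h1, h2, h3, h4, h5⟩
    refine ⟨h1, h2, h3, h4, fun w i => (h5 w i).trans (Real.exp_le_exp.2 ?_)⟩
    gcongr) (by
    intro m
    have hm : (0:ℝ) < 1 / (m + 1) := by positivity
    obtain ⟨z, hz1, hz2, hz3⟩ := hcon _ hm
    obtain ⟨l, l', hl⟩ : ∃ l l', z l ≠ z l' := by
      by_contra h; push Not at h
      exact hz3 (z 0) (funext fun i => h i 0)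
    have h1 : ∀ᶠ t in 𝓤, ∀ w : InfinitePlace K, ∀ i, w (rep (z i) t) ≤ Real.exp ((1 / ((m:ℝ) + 1) + 1 / (m + 1)) * q t) :=
      eventually_all.2 fun w => eventually_all.2 fun i => hz2 w i _ hm
    have h2 : ∀ᶠ t in 𝓤, ∑ l, rep (D.x l) t * rep (z l) t = 0 := by
      have := (rep_eq_iff _ _).1 hz1.2
      filter_upwards [this, rep_zero (𝓤 := 𝓤) (K := K), rep_sum Finset.univ (fun c => D.x c * z c),
        eventually_all.2 fun c => rep_mul (D.x c) (z c)] with t h1 h2 h3 h4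
      rw [h3, h2] at h1
      rw [← h1]; exact Finset.sum_congr rfl fun c _ => (h4 c).symm
    filter_upwards [h1, h2, eventually_all.2 hz1.1, ev_pos D.hq, rep_ne _ (sub_ne_zero.2 hl), rep_sub (z l) (z l')] with t h1 h2 h3 h4 h5 h6
    refine ⟨fun i => rep (z i) t, h3, h2, ⟨l, l', ?_⟩, h4, fun w i => ?_⟩
    · rw [h6] at h5; exact sub_ne_zero.1 h5
    · refine (h1 w i).trans (le_of_eq ?_)
      congr 2; ring)
  set g : Fin (n+1) → GF 𝓤 K := fun i => ((fun t => z t i : ℕ → K) : GF 𝓤 K) with hg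
  have hrepg : ∀ᶠ t in 𝓤, ∀ i, rep (g i) t = z t i := eventually_all.2 fun i => rep_coe _
  obtain ⟨a, ha⟩ := hv g ⟨fun l => coe_mem_gsub _ _ ((hz 0).mono fun t h => h.1 l), by
    rw [rep_eq_iff]
    filter_upwards [hz 0, rep_zero (𝓤 := 𝓤) (K := K), rep_sum Finset.univ (fun c => D.x c * g c),
        eventually_all.2 fun c => rep_mul (D.x c) (g c), hrepg] with t h1 h2 h3 h4 h5
    rw [h3, h2, ← h1.2.1]
    exact Finset.sum_congr rfl fun c _ => by rw [h4, h5]⟩ (by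
    intro w i
    apply sz_coe
    intro ε hε
    obtain ⟨M, hM⟩ := exists_nat_gt (2 / ε)
    filter_upwards [hz M] with t h
    refine (h.2.2.2.2 w i).trans (Real.exp_le_exp.2 ?_)
    apply mul_le_mul_of_nonneg_right _ h.2.2.2.1.le
    rw [zero_add, div_le_iff₀ (by positivity)]
    rw [div_lt_iff₀ hε] at hM
    nlinarith)
  obtain ⟨t, h1, h2⟩ := ((hz 0).and hrepg).exists
  obtain ⟨l, l', hl⟩ := h1.2.2.1
  apply hl
  rw [← h2, ← h2, ha]

/-- germs of subexponential size -/
def A0 (hq : Tendsto q 𝓤 atTop) : Subring (GF 𝓤 K) where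
  carrier := {a | a ∈ gsub 𝓤 (OS S) ∧ ∀ p : Pl S, sz q p a 0}
  zero_mem' := ⟨Subring.zero_mem _, fun _ => sz_zero _⟩
  one_mem' := ⟨Subring.one_mem _, fun _ => sz_one hq⟩
  add_mem' := fun h h' => ⟨Subring.add_mem _ h.1 h'.1, fun p => (h.2 p).add hq (h'.2 p)⟩
  neg_mem' := fun h => ⟨Subring.neg_mem _ h.1, fun p => (h.2 p).neg⟩
  mul_mem' := fun h h' => ⟨Subring.mul_mem _ h.1 h'.1, fun p => by simpa using (h.2 p).mul (h'.2 p)⟩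

lemma mem_A0 (hq : Tendsto q 𝓤 atTop) (a : GF 𝓤 K) : a ∈ A0 (S := S) hq ↔ a ∈ gsub 𝓤 (OS S) ∧ ∀ p : Pl S, sz q p a 0 := Iff.rfl

set_option maxHeartbeats 1000000 in
theorem coreC {ι : Type*} [Fintype ι] (hq : Tendsto q 𝓤 atTop) (u : ι → GF 𝓤 K) (c : Pl S → ι → ℝ)
    (hu0 : ∀ i, u i ≠ 0) (hu : ∀ i, u i ∈ gsub 𝓤 (OS S)) (hu' : ∀ i, (u i)⁻¹ ∈ gsub 𝓤 (OS S))
    (hc : ∀ p i, sz q p (u i) (c p i)) (hc' : ∀ p i, sz q p (u i)⁻¹ (-c p i)) (hsum : ∑ i, u i = 0)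
    (hnd : ∀ s : Finset ι, s.Nonempty → s ≠ Finset.univ → ∑ i ∈ s, u i ≠ 0)
    (i1 : ι) (hc1 : ∃ i p, c p i ≠ c p i1) : False := by
  classical
  have hprod : ∀ i, ∑ p, pw p * c p i = 0 := by
    intro i
    have h1 := sz_pf hq (hu0 i) (hu i) _ (fun p => hc p i)
    have h2 := sz_pf hq (inv_ne_zero (hu0 i)) (hu' i) _ (fun p => hc' p i)
    simp only [mul_neg, Finset.sum_neg_distrib] at h2
    linarith
  -- relations
  set R : (ι → GF 𝓤 K) → Prop := fun a => (∀ i, a i ∈ A0 (S := S) hq) ∧ ∑ i, a i * u i = 0 ∧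
    ∀ i j, a i ≠ 0 → a j ≠ 0 → (∀ p, c p i = c p j) → i = j with hR
  set supp : (ι → GF 𝓤 K) → Finset ι := fun a => Finset.univ.filter fun i => a i ≠ 0 with hsupp
  have hex : ∃ m, ∃ a, a ≠ 0 ∧ R a ∧ (supp a).card = m := by
    let st : Setoid ι := ⟨fun i j => ∀ p, c p i = c p j, fun _ _ => rfl, fun h p => (h p).symm, fun h h' p => (h p).trans (h' p)⟩
    set r : ι → ι := fun i => (Quotient.mk st i).out with hr
    have hr1 : ∀ i p, c p (r i) = c p i := fun i => Quotient.mk_out (s := st) i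
    have hr2 : ∀ i j, (∀ p, c p i = c p j) → r i = r j := fun i j h => by
      simp only [hr]; rw [show (Quotient.mk st i) = Quotient.mk st j from Quotient.sound h]
    refine ⟨_, fun j => ∑ i ∈ Finset.univ.filter (fun i => r i = j), u i * (u j)⁻¹, ?_, ⟨?_, ?_, ?_⟩, rfl⟩
    · intro h
      have h1 := congrFun h (r i1)
      simp only [Pi.zero_apply] at h1
      rw [← Finset.sum_mul, mul_eq_zero] at h1
      rcases h1 with h1 | h1
      · refine hnd _ ⟨i1, by simp⟩ ?_ h1
        intro h2
        obtain ⟨i, p, hip⟩ := hc1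
        have h3 : i ∈ Finset.univ.filter (fun i => r i = r i1) := by rw [h2]; exact Finset.mem_univ _
        rw [Finset.mem_filter] at h3
        apply hip
        rw [← hr1 i, h3.2, hr1]
      · exact inv_ne_zero (hu0 _) h1
    · intro j
      apply Subring.sum_mem
      intro i hi
      rw [Finset.mem_filter] at hi
      refine (mem_A0 hq _).2 ⟨Subring.mul_mem _ (hu i) (hu' j), fun p => ?_⟩
      refine ((hc p i).mul (hc' p j)).mono hq ?_
      rw [← hi.2, hr1]; linarith
    · rw [← hsum, ← Finset.sum_fiberwise Finset.univ r u]
      refine Finset.sum_congr rfl fun j _ => ?_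
      beta_reduce
      rw [← Finset.sum_mul, mul_assoc, inv_mul_cancel₀ (hu0 j), mul_one]
    · intro i j hi hj hp
      have key : ∀ j, (∑ i ∈ Finset.univ.filter (fun i => r i = j), u i * (u j)⁻¹) ≠ 0 → r j = j := by
        intro j hj
        obtain ⟨i, hi, -⟩ := Finset.exists_ne_zero_of_sum_ne_zero hj
        rw [Finset.mem_filter] at hi
        conv_rhs => rw [← hi.2]
        apply hr2
        intro p; rw [← hi.2, hr1]
      rw [← key i hi, ← key j hj]
      exact hr2 _ _ hp
  obtain ⟨a, ha0, ⟨haA, hasum, hapar⟩, hacard⟩ := Nat.find_spec hex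
  have hmin : ∀ a', R a' → supp a' ⊂ supp a → a' = 0 := by
    intro a' h1 h2
    by_contra h3
    have h4 := Finset.card_lt_card h2
    rw [hacard] at h4
    exact Nat.find_min hex h4 ⟨a', h3, h1, rfl⟩
  have hainv : ∀ i, a i ≠ 0 → ∀ p : Pl S, sz q p (a i)⁻¹ 0 := fun i hi p => sz_inv_of hq hi ((mem_A0 hq _).1 (haA i)).1 ((mem_A0 hq _).1 (haA i)).2 p
  set s := supp a with hs
  have hsmem : ∀ i, i ∈ s ↔ a i ≠ 0 := fun i => by simp [hs, hsupp]
  have hssum : ∑ i ∈ s, a i * u i = 0 := by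
    rw [← hasum]
    apply Finset.sum_subset (Finset.subset_univ _)
    intro i _ hi
    rw [hsmem, not_not] at hi; rw [hi, zero_mul]
  have hcard3 : 3 ≤ s.card := by
    by_contra hlt
    push Not at hlt
    have h0 : s.card ≠ 0 := by
      intro h0
      rw [Finset.card_eq_zero] at h0
      apply ha0; funext i
      by_contra h
      have := (hsmem i).2 h
      rw [h0] at this; simp at this
    have : s.card = 1 ∨ s.card = 2 := by omega
    rcases this with h1 | h2
    · obtain ⟨i, hi⟩ := Finset.card_eq_one.1 h1
      rw [hi, Finset.sum_singleton] at hssum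
      exact mul_ne_zero ((hsmem i).1 (by rw [hi]; simp)) (hu0 i) hssum
    · obtain ⟨i, j, hij, hsij⟩ := Finset.card_eq_two.1 h2
      rw [hsij, Finset.sum_pair hij] at hssum
      have hi : a i ≠ 0 := (hsmem i).1 (by rw [hsij]; simp)
      have hj : a j ≠ 0 := (hsmem j).1 (by rw [hsij]; simp)
      have key : ∀ i j, a i ≠ 0 → a i * u i + a j * u j = 0 → ∀ p, c p i ≤ c p j := by
        intro i j hi h p
        have h1 : (1 : GF 𝓤 K) = -((u i)⁻¹ * (a i)⁻¹ * a j * u j) := by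
          have := hu0 i
          field_simp
          linear_combination h
        have h2 : sz q p (1 : GF 𝓤 K) (-c p i + 0 + 0 + c p j) := by
          rw [h1]
          exact ((((hc' p i).mul (hainv i hi p)).mul (((mem_A0 hq _).1 (haA j)).2 p)).mul (hc p j)).neg
        linarith [sz_one_le hq h2]
      exact hij (hapar i j hi hj fun p => le_antisymm (key i j hi hssum p) (key j i hj (by rw [add_comm]; exact hssum) p))
  obtain ⟨n, hn⟩ : ∃ n, s.card = n + 1 := ⟨s.card - 1, by omega⟩
  let e : Fin (n+1) ≃ s := (Finset.equivFinOfCardEq hn).symm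
  have hae : ∀ i, a (e i) ≠ 0 := fun i => (hsmem _).1 (e i).2
  have hsume : ∀ f : ι → GF 𝓤 K, ∑ i, f (e i) = ∑ i ∈ s, f i := by
    intro f
    rw [← Finset.sum_coe_sort s, ← Equiv.sum_comp e]
  have hipex : ∀ p : Pl S, ∃ j : Fin (n+1), ∀ i : Fin (n+1), c p (e i) ≤ c p (e j) := fun p => Finite.exists_max _
  choose ip hip using hipex
  let D : Dat 𝓤 S q n :=
    { hq := hq
      x := fun i => a (e i) * u (e i)
      c := fun p i => c p (e i)
      ip := ip
      x0 := fun i => mul_ne_zero (hae i) (hu0 _)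
      xS := fun i => Subring.mul_mem _ ((mem_A0 hq _).1 (haA _)).1 (hu _)
      hc := fun p i => by simpa using (((mem_A0 hq _).1 (haA (e i))).2 p).mul (hc p (e i))
      hc' := fun p i => by rw [mul_inv]; simpa using (hainv _ (hae i) p).mul (hc' p (e i))
      hmax := fun p i => hip p i
      hprod := fun i => hprod _
      hsum := by rw [hsume (fun i => a i * u i)]; exact hssum }
  have hDx : ∀ i, D.x i = a (e i) * u (e i) := fun _ => rfl
  obtain ⟨ρ0, hρ0, hv⟩ := D.rho (by
    intro z hz hsz
    have hzA : ∀ l, z l ∈ A0 (S := S) hq := by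
      intro l
      refine (mem_A0 hq _).2 ⟨gsub_mono (OI_le_OS S) (hz.1 l), ?_⟩
      rintro (w | v)
      · exact hsz w l
      · exact sz_OI hq (hz.1 l) v
    refine ⟨z 0, ?_⟩
    set a' : ι → GF 𝓤 K := fun i => if h : i ∈ s then a i * (z (e.symm ⟨i, h⟩) - z 0) else 0 with ha'
    have ha'e : ∀ i, a' (e i) = a (e i) * (z i - z 0) := by
      intro i
      simp only [ha']
      rw [dif_pos (e i).2]; simp
    have ha's : ∀ i, i ∉ s → a' i = 0 := fun i hi => dif_neg hi
    have ha'a : ∀ i, a' i ≠ 0 → a i ≠ 0 := fun i hi => by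
      by_contra h
      exact hi (ha's i (fun h' => (hsmem i).1 h' h))
    have h0 := hmin a' ⟨fun i => ?_, ?_, fun i j hi hj => hapar i j (ha'a i hi) (ha'a j hj)⟩ ?_
    · funext i
      have h1 := ha'e i
      rw [h0, Pi.zero_apply, eq_comm, mul_eq_zero] at h1
      exact sub_eq_zero.1 (h1.resolve_left (hae i))
    · by_cases hi : i ∈ s
      · simp only [ha', dif_pos hi]
        exact Subring.mul_mem _ (haA i) (Subring.sub_mem _ (hzA _) (hzA _))
      · rw [ha's i hi]; exact Subring.zero_mem _
    · have h1 : ∑ i, a' i * u i = ∑ i ∈ s, a' i * u i := by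
        symm; apply Finset.sum_subset (Finset.subset_univ _)
        intro i _ hi
        rw [ha's i hi, zero_mul]
      rw [h1, ← hsume (fun i => a' i * u i)]
      have h2 : ∀ i, a' (e i) * u (e i) = D.x i * z i - D.x i * z 0 := by intro i; rw [ha'e, hDx]; ring
      simp_rw [h2]
      rw [Finset.sum_sub_distrib, hz.2, ← Finset.sum_mul, D.hsum]; ring
    · refine (Finset.ssubset_iff_of_subset ?_).2 ⟨e 0, (e 0).2, ?_⟩
      · intro i hi
        simp only [hsupp, Finset.mem_filter] at hi
        exact (hsmem i).2 (ha'a i hi.2)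
      · simp only [hsupp, Finset.mem_filter, not_and, not_not]
        intro _; rw [ha'e]; simp)
  have hn2 : 2 ≤ n := by omega
  refine D.partD hn2 (w0 := ∏ i, a (e i)) (Finset.prod_ne_zero_iff.2 fun i _ => hae i) ?_ ?_ hρ0 hv ⟨0, by omega⟩ ⟨1, by omega⟩ ?_
  · intro p
    have := sz_prod hq Finset.univ (fun i => a (e i)) (fun _ => 0) (p := p) (fun i _ => ((mem_A0 hq _).1 (haA _)).2 p)
    simpa using this
  · intro i
    have h1 : (∏ i, a (e i)) / D.x i = (∏ j ∈ Finset.univ.erase i, a (e j)) * (u (e i))⁻¹ := by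
      rw [hDx, ← Finset.mul_prod_erase _ _ (Finset.mem_univ i)]
      have := hae i; have := hu0 (e i)
      field_simp
    rw [h1]
    exact Subring.mul_mem _ (Subring.prod_mem _ fun j _ => ((mem_A0 hq _).1 (haA _)).1) (hu' _)
  · by_contra h
    push Not at h
    have h2 := hapar _ _ (hae _) (hae _) h
    have h3 := e.injective (Subtype.ext h2)
    simp [Fin.ext_iff] at h3
end dat
end MLT

set_option linter.unusedSectionVars false
namespace MLT
open NumberField Filter Topology

/-- normalised nondegenerate solutions of the unit equation -/
def NSol {G : Type*} [Field G] (Γ : Subgroup Gˣ) {ι : Type*} [Fintype ι] (i1 : ι) : Set (ι → Gˣ) :=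
  {x | x i1 = 1 ∧ (∀ i, x i ∈ Γ) ∧ ∑ i, (x i : G) = 0 ∧ ∀ s : Finset ι, s.Nonempty → s ≠ Finset.univ → ∑ i ∈ s, (x i : G) ≠ 0}

section dat
variable {K : Type*} [Field K] [NumberField K]
variable {𝓤 : Ultrafilter ℕ} {S : Finset (FinitePlace K)} {q : ℕ → ℝ}

lemma lim_sz (hq : Tendsto q 𝓤 atTop) (p : Pl S) (f : ℕ → K) (hf : ∀ t, f t ≠ 0) (C : ℝ)
    (h : ∀ᶠ t in 𝓤, |Real.log (pa p (f t))| ≤ C * q t) :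
    ∃ c, Tendsto (fun t => Real.log (pa p (f t)) / q t) 𝓤 (𝓝 c) ∧ sz q p (f : GF 𝓤 K) c ∧ sz q p ((f : GF 𝓤 K))⁻¹ (-c) := by
  obtain ⟨c, -, hc⟩ := (isCompact_Icc (a := -C) (b := C)).ultrafilter_le_nhds (𝓤.map (fun t => Real.log (pa p (f t)) / q t)) (by
    rw [Filter.le_principal_iff]
    show ∀ᶠ t in (𝓤 : Filter ℕ), Real.log (pa p (f t)) / q t ∈ Set.Icc (-C) C
    filter_upwards [h, ev_pos hq] with t h1 h2
    rw [Set.mem_Icc, ← abs_le, abs_div, abs_of_pos h2, div_le_iff₀ h2]; exact h1)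
  have hc : Tendsto (fun t => Real.log (pa p (f t)) / q t) 𝓤 (𝓝 c) := hc
  refine ⟨c, hc, ?_, ?_⟩
  · apply sz_coe
    intro ε hε
    filter_upwards [hc.eventually (gt_mem_nhds (show c < c + ε by linarith)), ev_pos hq] with t h1 h2
    rw [div_lt_iff₀ h2] at h1
    rw [← Real.log_le_iff_le_exp ((pa p).pos (hf t))]; exact h1.le
  · rw [← Germ.coe_inv]
    apply sz_coe
    intro ε hε
    filter_upwards [hc.eventually (lt_mem_nhds (show c - ε < c by linarith)), ev_pos hq] with t h1 h2
    rw [lt_div_iff₀ h2] at h1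
    rw [Pi.inv_apply, map_inv₀, ← Real.log_le_iff_le_exp (inv_pos.2 ((pa p).pos (hf t))), Real.log_inv]
    linarith

lemma exists_S (Γ : Subgroup Kˣ) (hΓ : Γ.FG) : ∃ S : Finset (FinitePlace K), ∀ g ∈ Γ, ∀ v ∉ S, v (g : K) = 1 := by
  classical
  obtain ⟨T, rfl⟩ := hΓ
  have hfin : ∀ g : Kˣ, (Function.mulSupport fun v : FinitePlace K => v (g : K)).Finite := fun g => FinitePlace.hasFiniteMulSupport g.ne_zero
  refine ⟨T.biUnion fun g => (hfin g).toFinset, fun g hg v hv => ?_⟩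
  induction hg using Subgroup.closure_induction with
  | mem g hg =>
    by_contra h
    exact hv (Finset.mem_biUnion.2 ⟨g, hg, by simpa using h⟩)
  | one => simp
  | mul a b _ _ h1 h2 => rw [Units.val_mul, map_mul, h1, h2, one_mul]
  | inv a _ h1 => rw [Units.val_inv_eq_inv_val, map_inv₀, h1, inv_one]

lemma height_le (y : K) (hy : ∀ v ∉ S, v y ≤ 1) : Height.logHeight₁ y ≤ hS S y := by
  classical
  rw [NumberField.logHeight₁_eq]
  unfold hS
  rw [sum_pw_split, finsum_eq_sum_of_support_subset (s := S)]
  · rw [Finset.sum_coe_sort S (fun v => Real.posLog (v y)) |>.symm]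
    rfl
  · intro v hv
    by_contra h
    apply hv
    simp only
    exact (Real.posLog_eq_zero_iff _).2 (by rw [abs_of_nonneg (apply_nonneg v y)]; exact hy v h)

set_option maxHeartbeats 1000000 in
theorem UK (Γ : Subgroup Kˣ) (hΓ : Γ.FG) {ι : Type*} [Fintype ι] (i1 : ι) : (NSol Γ i1).Finite := by
  classical
  by_contra hinf
  have hinf : (NSol Γ i1).Infinite := hinf
  set X : ℕ ↪ NSol Γ i1 := hinf.natEmbedding with hX
  obtain ⟨S, hS1⟩ := exists_S Γ hΓ
  set x : ι → ℕ → K := fun i t => (((X t : ι → Kˣ) i : Kˣ) : K) with hx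
  have hxne : ∀ i t, x i t ≠ 0 := fun i t => Units.ne_zero _
  have hx1 : ∀ t, x i1 t = 1 := fun t => by simp only [hx]; rw [(X t).2.1]; rfl
  have hxS : ∀ i t, ∀ v ∉ S, v (x i t) = 1 := fun i t v hv => hS1 _ ((X t).2.2.1 i) v hv
  set q : ℕ → ℝ := fun t => ∑ p : Pl S, ∑ i, pw p * |Real.log (pa p (x i t))| with hq
  have hterm : ∀ (p : Pl S) i t, pw p * |Real.log (pa p (x i t))| ≤ q t := by
    intro p i t
    refine le_trans ?_ (Finset.single_le_sum (f := fun p : Pl S => ∑ i, pw p * |Real.log (pa p (x i t))|)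
      (fun p _ => Finset.sum_nonneg fun i _ => mul_nonneg (pw_pos p).le (abs_nonneg _)) (Finset.mem_univ p))
    exact Finset.single_le_sum (f := fun i => pw p * |Real.log (pa p (x i t))|) (fun i _ => mul_nonneg (pw_pos p).le (abs_nonneg _)) (Finset.mem_univ i)
  have hht : ∀ i t, Height.logHeight₁ (x i t) ≤ q t := by
    intro i t
    refine (height_le (S := S) _ fun v hv => (hxS i t v hv).le).trans ?_
    unfold hS
    apply Finset.sum_le_sum
    intro p _
    refine le_trans ?_ (Finset.single_le_sum (f := fun i => pw p * |Real.log (pa p (x i t))|) (fun i _ => mul_nonneg (pw_pos p).le (abs_nonneg _)) (Finset.mem_univ i))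
    exact mul_le_mul_of_nonneg_left (max_le (abs_nonneg _) (le_abs_self _)) (pw_pos p).le
  have hqc : Tendsto q cofinite atTop := by
    rw [tendsto_atTop]
    intro B
    rw [eventually_cofinite]
    have hfin : (Set.pi Set.univ fun _ : ι => {y : K | Height.logHeight₁ y ≤ B}).Finite :=
      Set.Finite.pi fun _ => NumberField.finite_setOfPred_logHeight₁_le K B
    have hinj : Function.Injective (fun t i => x i t) := by
      intro t t' h
      apply X.injective
      apply Subtype.ext
      funext i
      exact Units.ext (congrFun h i)
    refine (hfin.preimage hinj.injOn).subset ?_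
    intro t ht i _
    simp only [not_le, Set.mem_setOf_eq] at ht
    exact (hht i t).trans ht.le
  set 𝓤 : Ultrafilter ℕ := hyperfilter ℕ with h𝓤
  have hqt : Tendsto q 𝓤 atTop := hqc.mono_left (hyperfilter_le_cofinite (α := ℕ))
  have hch : ∀ (p : Pl S) (i : ι), ∃ c, Tendsto (fun t => Real.log (pa p (x i t)) / q t) 𝓤 (𝓝 c) ∧ sz q p (x i : GF 𝓤 K) c ∧ sz q p ((x i : GF 𝓤 K))⁻¹ (-c) := by
    intro p i
    apply lim_sz hqt p (x i) (hxne i) (pw p)⁻¹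
    refine Eventually.of_forall fun t => ?_
    rw [← div_eq_inv_mul, le_div_iff₀ (pw_pos p), mul_comm]
    exact hterm p i t
  choose c hc1 hc2 hc3 using hch
  have hcsum : ∑ p : Pl S, ∑ i, pw p * |c p i| = 1 := by
    have h1 : Tendsto (fun t => ∑ p : Pl S, ∑ i, pw p * |Real.log (pa p (x i t)) / q t|) 𝓤 (𝓝 (∑ p : Pl S, ∑ i, pw p * |c p i|)) :=
      tendsto_finset_sum _ fun p _ => tendsto_finset_sum _ fun i _ => ((hc1 p i).abs).const_mul _
    refine tendsto_nhds_unique h1 (tendsto_const_nhds.congr' ?_)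
    filter_upwards [ev_pos hqt] with t ht
    have h2 : ∀ (p : Pl S) i, pw p * |Real.log (pa p (x i t)) / q t| = pw p * |Real.log (pa p (x i t))| / q t := by
      intro p i; rw [abs_div, abs_of_pos ht]; ring
    simp_rw [h2, ← Finset.sum_div]
    exact (div_self ht.ne').symm
  have hci1 : ∀ p, c p i1 = 0 := by
    intro p
    refine tendsto_nhds_unique (hc1 p i1) (tendsto_const_nhds.congr fun t => ?_)
    rw [hx1]; simp
  have hsumc : ∀ s : Finset ι, ∑ i ∈ s, (x i : GF 𝓤 K) = ((fun t => ∑ i ∈ s, x i t : ℕ → K) : GF 𝓤 K) := by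
    intro s
    induction s using Finset.induction_on with
    | empty => simp; rfl
    | insert a s ha ih =>
      rw [Finset.sum_insert ha, ih, ← Germ.coe_add]
      congr 1; funext t; simp [Finset.sum_insert ha]
  refine coreC hqt (fun i => (x i : GF 𝓤 K)) c ?_ ?_ ?_ hc2 hc3 ?_ ?_ i1 ?_
  · intro i h
    have : ∀ᶠ t in 𝓤, x i t = 0 := Germ.coe_eq.1 h
    obtain ⟨t, ht⟩ := this.exists
    exact hxne i t ht
  · intro i
    exact coe_mem_gsub _ _ (Eventually.of_forall fun t => (mem_OS S _).2 fun v hv => (hxS i t v hv).le)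
  · intro i
    rw [← Germ.coe_inv]
    exact coe_mem_gsub _ _ (Eventually.of_forall fun t => (mem_OS S _).2 fun v hv => by
      rw [Pi.inv_apply, map_inv₀, hxS i t v hv, inv_one])
  · rw [hsumc]
    have : (fun t => ∑ i, x i t) = (0 : ℕ → K) := funext fun t => (X t).2.2.2.1
    rw [this]; rfl
  · intro s hs hs' h
    rw [hsumc] at h
    have : ∀ᶠ t in 𝓤, ∑ i ∈ s, x i t = 0 := Germ.coe_eq.1 h
    obtain ⟨t, ht⟩ := this.exists
    exact (X t).2.2.2.2 s hs hs' ht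
  · by_contra h
    push Not at h
    simp_rw [h, hci1] at hcsum
    simp at hcsum
end dat
end MLT

set_option linter.unusedSectionVars false
namespace MLT
open NumberField Filter Topology

lemma ult_const {β α : Type*} (𝓤 : Ultrafilter β) (f : β → α) (F : Set α) (hF : F.Finite)
    (h : ∀ᶠ t in 𝓤, f t ∈ F) : ∃ u ∈ F, ∀ᶠ t in 𝓤, f t = u := by
  obtain ⟨u, hu, h1⟩ := Ultrafilter.eq_pure_of_finite_mem (f := 𝓤.map f) hF h
  refine ⟨u, hu, ?_⟩
  have : ({u} : Set α) ∈ 𝓤.map f := by rw [h1]; exact rfl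
  exact this

lemma exists_min_vanish {G : Type*} [Field G] {ι : Type*} [Fintype ι] [Nonempty ι] (y : ι → Gˣ)
    (h : ∑ i, (y i : G) = 0) : ∃ s : Finset ι, s.Nonempty ∧ ∑ i ∈ s, (y i : G) = 0 ∧
      ∀ s' ⊆ s, s'.Nonempty → s' ≠ s → ∑ i ∈ s', (y i : G) ≠ 0 := by
  classical
  let P : Finset ι → Prop := fun s => s.Nonempty ∧ ∑ i ∈ s, (y i : G) = 0
  obtain ⟨s, hs⟩ := (Set.toFinite {s | P s}).exists_minimal ⟨Finset.univ, Finset.univ_nonempty, h⟩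
  refine ⟨s, hs.prop.1, hs.prop.2, fun s' h1 h2 h3 h4 => h3 ?_⟩
  exact le_antisymm h1 (hs.le_of_le (y := s') ⟨h2, h4⟩ h1)

/-- normalising a minimal vanishing block gives an element of `NSol` -/
lemma block_mem {G : Type*} [Field G] (Γ : Subgroup Gˣ) {ι : Type*} [Fintype ι] (y : ι → Gˣ) (hy : ∀ i, y i ∈ Γ)
    (s : Finset ι) (h0 : ∑ i ∈ s, (y i : G) = 0)
    (hm : ∀ s' ⊆ s, s'.Nonempty → s' ≠ s → ∑ i ∈ s', (y i : G) ≠ 0) (a : s) :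
    (fun i : s => y i / y a) ∈ NSol Γ a := by
  classical
  have key : ∀ s' : Finset s, ∑ i ∈ s', ((y i / y a : Gˣ) : G) = (∑ i ∈ s'.map (Function.Embedding.subtype _), (y i : G)) / y a := by
    intro s'
    rw [Finset.sum_map, Finset.sum_div]
    refine Finset.sum_congr rfl fun i _ => by simp
  refine ⟨div_self' _, fun i => div_mem (hy _) (hy _), ?_, ?_⟩
  · rw [key, div_eq_zero_iff]; left
    rw [← h0]; refine Finset.sum_congr ?_ fun _ _ => rfl
    ext i; simp
  · intro s' h1 h2 h3
    rw [key, div_eq_zero_iff] at h3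
    refine hm _ ?_ ?_ ?_ (h3.resolve_right (Units.ne_zero _))
    · intro i hi; simp at hi; exact hi.1
    · simpa using h1
    · intro h4; apply h2
      ext i; simp
      have h5 : (i : ι) ∈ s'.map (Function.Embedding.subtype _) := h4.symm ▸ i.2
      simpa using h5

lemma pairK {K : Type*} [Field K] [NumberField K] (Δ : Subgroup Kˣ) (hΔ : Δ.FG) {β : Type*} (𝓤 : Ultrafilter β)
    {ι : Type*} [Fintype ι] [Nonempty ι] (y : β → ι → Kˣ) (hy : ∀ t i, y t i ∈ Δ)
    (h0 : ∀ t, ∑ i, (y t i : K) = 0) : ∃ i i' : ι, i ≠ i' ∧ ∃ u, ∀ᶠ t in 𝓤, y t i' / y t i = u := by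
  classical
  choose s hs1 hs2 hs3 using fun t => exists_min_vanish (y t) (h0 t)
  obtain ⟨s0, -, hs0⟩ := ult_const 𝓤 s Set.univ (Set.toFinite _) (by simp)
  obtain ⟨t0, ht0⟩ := hs0.exists
  have hn : s0.Nonempty := ht0 ▸ hs1 t0
  obtain ⟨a, ha⟩ := hn
  have h2 : ∃ b ∈ s0, a ≠ b := by
    by_contra h
    push Not at h
    have : s0 = {a} := by
      ext i; simp; exact ⟨fun hi => (h i hi).symm, fun hi => hi ▸ ha⟩
    have h3 := hs2 t0
    rw [ht0, this] at h3
    simp at h3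
  obtain ⟨b, hb, hab⟩ := h2
  refine ⟨a, b, hab, ?_⟩
  have hfin := UK Δ hΔ (⟨a, ha⟩ : s0)
  obtain ⟨u, -, hu⟩ := ult_const 𝓤 (fun t => fun i : s0 => y t i / y t a) _ hfin (by
    filter_upwards [hs0] with t ht
    subst ht
    exact block_mem Δ (y t) (hy t) _ (hs2 t) (hs3 t) ⟨a, ha⟩)
  refine ⟨u ⟨b, hb⟩, ?_⟩
  filter_upwards [hu] with t ht
  exact congrFun ht ⟨b, hb⟩

lemma root_bound {K : Type*} [Field K] [NumberField K] {N : ℕ} (hN : Module.finrank ℚ K ≤ N) (ζ : Kˣ)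
    (h : IsOfFinOrder ζ) : ζ ^ (2 * N).factorial = 1 := by
  rw [← orderOf_dvd_iff_pow_eq_one, Nat.dvd_iff_prime_pow_dvd_dvd]
  intro p k hp hk
  rcases Nat.eq_zero_or_pos k with rfl | hk0
  · simp
  apply Nat.dvd_factorial (pow_pos hp.pos _)
  obtain ⟨m, hm⟩ := hk
  have hpos := h.orderOf_pos
  have h1 : IsPrimitiveRoot ζ (orderOf ζ) := IsPrimitiveRoot.orderOf ζ
  have h2 : IsPrimitiveRoot (ζ ^ m) (p ^ k) := h1.pow hpos (by rw [hm, mul_comm])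
  have h3 : IsPrimitiveRoot ((ζ ^ m : Kˣ) : K) (p ^ k) := h2.map_of_injective (f := Units.coeHom K) Units.val_injective
  have h4 := h3.totient_le_degree_minpoly
  have h5 : (minpoly ℤ ((ζ ^ m : Kˣ) : K)).natDegree ≤ N := by
    have hintg : IsIntegral ℤ ((ζ ^ m : Kˣ) : K) := h3.isIntegral (pow_pos hp.pos _)
    have := minpoly.isIntegrallyClosed_eq_field_fractions' ℚ hintg
    have h6 := minpoly.natDegree_le (A := ℚ) ((ζ ^ m : Kˣ) : K)
    rw [this, Polynomial.natDegree_map_eq_of_injective (algebraMap ℤ ℚ).injective_int] at h6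
    exact h6.trans hN
  have h6 : Nat.totient (p ^ k) ≤ N := h4.trans h5
  rw [Nat.totient_prime_pow hp hk0] at h6
  obtain ⟨j, rfl⟩ := Nat.exists_eq_succ_of_ne_zero hk0.ne'
  simp at h6
  have := hp.two_le
  calc p ^ (j + 1) = p ^ j * p := pow_succ _ _
    _ ≤ p ^ j * (2 * (p - 1)) := Nat.mul_le_mul_left _ (by omega)
    _ = 2 * (p ^ j * (p - 1)) := by ring
    _ ≤ 2 * N := by omega

/-- specialisation of f.g. domains over ℚ -/
lemma SP (A : Type*) [CommRing A] [IsDomain A] [Algebra ℚ A] [Algebra.FiniteType ℚ A] :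
    ∃ N : ℕ, ∀ f : A, f ≠ 0 → ∃ (Q : Ideal A) (_ : Q.IsMaximal), 
      Module.Finite ℚ (A ⧸ Q) ∧ Module.finrank ℚ (A ⧸ Q) ≤ N ∧ f ∉ Q := by
  classical
  obtain ⟨s, g, hg, hintg⟩ := exists_integral_inj_algHom_of_fg ℚ A
  let B := MvPolynomial (Fin s) ℚ
  letI : Algebra B A := g.toRingHom.toAlgebra
  haveI : IsScalarTower ℚ B A := IsScalarTower.of_algebraMap_eq fun q => (g.commutes q).symm
  haveI : Algebra.IsIntegral B A := ⟨hintg⟩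
  haveI : Algebra.FiniteType B A := Algebra.FiniteType.of_restrictScalars_finiteType ℚ B A
  haveI : Module.Finite B A := Algebra.IsIntegral.finite
  obtain ⟨T, hT⟩ := Module.finite_def.1 (inferInstance : Module.Finite B A)
  refine ⟨T.card, fun f hf => ?_⟩
  obtain ⟨b, hb, hb0⟩ : ∃ b ∈ Ideal.comap (algebraMap B A) (Ideal.span {f}), b ≠ 0 := by
    have := Ideal.comap_ne_bot_of_integral_mem (R := B) hf (Ideal.mem_span_singleton_self f) (Algebra.IsIntegral.isIntegral f)
    exact Submodule.exists_mem_ne_zero_of_ne_bot this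
  obtain ⟨a, ha⟩ : ∃ a : Fin s → ℚ, MvPolynomial.eval a b ≠ 0 := by
    by_contra h
    push Not at h
    exact hb0 (MvPolynomial.funext fun a => by simpa using h a)
  let P : Ideal B := RingHom.ker (MvPolynomial.eval a)
  have hsurj : Function.Surjective (MvPolynomial.eval a) := fun q => ⟨MvPolynomial.C q, by simp⟩
  haveI hP : P.IsMaximal := RingHom.ker_isMaximal_of_surjective _ hsurj
  obtain ⟨Q, hQ, hQP⟩ := Ideal.exists_ideal_over_maximal_of_isIntegral (S := A) P (by
    intro x hx
    have : x = 0 := hg (by rw [map_zero]; exact hx)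
    rw [this]; exact zero_mem _)
  have hspan : Submodule.span ℚ ((T.image (Ideal.Quotient.mk Q) : Finset (A ⧸ Q)) : Set (A ⧸ Q)) = ⊤ := by
    rw [eq_top_iff]
    rintro x -
    obtain ⟨x, rfl⟩ := Ideal.Quotient.mk_surjective x
    have hx : x ∈ Submodule.span B (T : Set A) := hT ▸ Submodule.mem_top
    induction hx using Submodule.span_induction with
    | mem x hx => exact Submodule.subset_span (by simpa using ⟨x, hx, rfl⟩)
    | zero => simp
    | add x y _ _ h1 h2 => rw [map_add]; exact add_mem h1 h2
    | smul c x _ h1 => 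
      have h2 : c - MvPolynomial.C (MvPolynomial.eval a c) ∈ P := by
        rw [RingHom.mem_ker, map_sub]; erw [MvPolynomial.eval_C]; exact sub_self _
      rw [← hQP] at h2
      have h3 : Ideal.Quotient.mk Q (c • x) = (MvPolynomial.eval a c) • Ideal.Quotient.mk Q x := by
        have h4 := Ideal.Quotient.eq_zero_iff_mem.2 (Ideal.mem_comap.1 h2)
        rw [map_sub, map_sub, sub_eq_zero] at h4
        rw [Algebra.smul_def, map_mul, h4, Algebra.smul_def, IsScalarTower.algebraMap_apply ℚ A (A ⧸ Q), IsScalarTower.algebraMap_apply ℚ B A]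
        rfl
      rw [h3]; exact Submodule.smul_mem _ _ h1
  refine ⟨Q, hQ, Module.finite_def.2 ⟨_, hspan⟩, ?_, ?_⟩
  · rw [← finrank_top, ← hspan]
    exact (finrank_span_finset_le_card _).trans Finset.card_image_le
  · intro hfQ
    apply ha
    have : b ∈ P := by
      rw [← hQP]
      rw [Ideal.mem_comap] at hb ⊢
      exact (Ideal.span_singleton_le_iff_mem _).2 hfQ hb
    exact this
end MLT

set_option linter.unusedSectionVars false
namespace MLT
open NumberField Filter Topology

lemma ker_fin {A : Type*} [AddCommGroup A] [Module.Finite ℤ A] {V : Type*} (H : V → Type*)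
    [∀ b, AddCommGroup (H b)] (ψ : ∀ b, A →ₗ[ℤ] H b) (e : ℕ) (he : 0 < e)
    (hH : ∀ b (h : H b) (n : ℤ), n ≠ 0 → n • h = 0 → (e : ℤ) • h = 0)
    (hker : ∀ a, (∀ b, ψ b a = 0) → a = 0) : ∃ T : Finset V, {a | ∀ b ∈ T, ψ b a = 0}.Finite := by
  classical
  let M : Finset V → Submodule ℤ A := fun T => ⨅ b ∈ T, LinearMap.ker (ψ b)
  have hM : ∀ T a, a ∈ M T ↔ ∀ b ∈ T, ψ b a = 0 := by
    intro T a; simp [M, Submodule.mem_iInf]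
  let r : Finset V → ℕ := fun T => Module.finrank ℤ (M T)
  let T := Function.argmin r
  have hT : ∀ T', r T ≤ r T' := fun T' => Function.argmin_le r T'
  refine ⟨T, ?_⟩
  have key : ∀ a ∈ M T, (e : ℤ) • a = 0 := by
    intro a ha
    apply hker
    intro b
    let θ : M T →ₗ[ℤ] H b := (ψ b).comp (M T).subtype
    have h1 : (LinearMap.ker θ).map (M T).subtype = M (insert b T) := by
      ext z
      rw [hM, Submodule.mem_map]
      constructor
      · rintro ⟨w, hw, rfl⟩ c hc
        rcases Finset.mem_insert.1 hc with rfl | hc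
        · exact hw
        · exact (hM T _).1 w.2 c hc
      · intro hz
        exact ⟨⟨z, (hM T _).2 fun c hc => hz c (Finset.mem_insert_of_mem hc)⟩, hz b (Finset.mem_insert_self _ _), rfl⟩
    have h2 := hT (insert b T)
    have h3 : r (insert b T) = Module.finrank ℤ (LinearMap.ker θ) := by
      rw [← Submodule.finrank_map_subtype_eq, h1]
    have h4 := Submodule.finrank_quotient_add_finrank (LinearMap.ker θ)
    have h5 : Module.finrank ℤ (M T ⧸ LinearMap.ker θ) = 0 := by
      have : r T = Module.finrank ℤ (M T) := rfl
      omega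
    obtain ⟨n, hn, h6⟩ := Module.finrank_eq_zero_iff.1 h5 (Submodule.Quotient.mk ⟨a, ha⟩)
    rw [← Submodule.Quotient.mk_smul, Submodule.Quotient.mk_eq_zero] at h6
    have h7 : n • ψ b a = 0 := by rw [← map_smul]; exact h6
    rw [map_smul]
    exact hH b _ n hn h7
  have h1 : Finite (M T) := by
    apply Module.finite_of_fg_torsion
    intro a
    refine ⟨⟨(e : ℤ), mem_nonZeroDivisors_of_ne_zero (by exact_mod_cast he.ne')⟩, ?_⟩
    ext
    exact key a a.2
  have : {a | ∀ b ∈ T, ψ b a = 0} = (M T : Set A) := by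
    ext a; exact (hM T a).symm
  rw [this]
  exact Set.toFinite _

universe u
lemma nf_of_alg (N : ℕ) (R : Type u) [Field R] [CharZero R] (inst : Algebra ℚ R)
    (h : @Module.Finite ℚ R _ _ inst.toModule ∧ @Module.finrank ℚ R _ _ inst.toModule ≤ N) :
    NumberField R ∧ @Module.finrank ℚ R _ _ (DivisionRing.toRatAlgebra : Algebra ℚ R).toModule ≤ N := by
  obtain rfl : inst = DivisionRing.toRatAlgebra := Subsingleton.elim _ _
  exact ⟨@NumberField.mk _ _ _ h.1, h.2⟩

lemma spec {G : Type u} [Field G] [CharZero G] (Γ : Subgroup Gˣ) (hΓ : Γ.FG) :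
    ∃ (A : Subalgebra ℚ G) (N : ℕ), (∀ γ ∈ Γ, (γ : G) ∈ A) ∧ ∀ f : A, f ≠ 0 →
      ∃ (K : Type u) (_ : Field K) (_ : NumberField K) (φ : A →+* K), Module.finrank ℚ K ≤ N ∧ φ f ≠ 0 := by
  classical
  obtain ⟨T, hT⟩ := hΓ
  let S : Finset G := T.image (fun γ : Gˣ => (γ : G)) ∪ T.image (fun γ : Gˣ => ((γ⁻¹ : Gˣ) : G))
  let A := Algebra.adjoin ℚ (S : Set G)
  haveI : Algebra.FiniteType ℚ A := (Subalgebra.fg_iff_finiteType _).1 (Subalgebra.fg_adjoin_finset S)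
  obtain ⟨N, hN⟩ := SP A
  refine ⟨A, N, ?_, ?_⟩
  · have : ∀ γ ∈ Γ, (γ : G) ∈ A ∧ ((γ⁻¹ : Gˣ) : G) ∈ A := by
      intro γ hγ
      rw [← hT] at hγ
      induction hγ using Subgroup.closure_induction with
      | mem x hx =>
        exact ⟨Algebra.subset_adjoin (by simp only [S, Finset.coe_union, Finset.coe_image]; exact Or.inl ⟨x, hx, rfl⟩),
          Algebra.subset_adjoin (by simp only [S, Finset.coe_union, Finset.coe_image]; exact Or.inr ⟨x, hx, rfl⟩)⟩
      | one => simp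
      | mul x y _ _ h1 h2 =>
        rw [mul_inv, Units.val_mul, Units.val_mul]
        exact ⟨mul_mem h1.1 h2.1, mul_mem h1.2 h2.2⟩
      | inv x _ h => rw [inv_inv]; exact h.symm
    exact fun γ hγ => (this γ hγ).1
  · intro f hf
    obtain ⟨Q, hQ, h1, h2, h3⟩ := hN f hf
    letI : Field (A ⧸ Q) := Ideal.Quotient.field Q
    haveI : CharZero (A ⧸ Q) := algebraRat.charZero (A ⧸ Q)
    obtain ⟨h4, h5⟩ := nf_of_alg N (A ⧸ Q) (Ideal.instAlgebraQuotient ℚ Q) ⟨h1, h2⟩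
    refine ⟨A ⧸ Q, inferInstance, h4, Ideal.Quotient.mk Q, h5, ?_⟩
    · rwa [Ne, Ideal.Quotient.eq_zero_iff_mem]

set_option maxHeartbeats 1000000 in
lemma pairG {G : Type u} [Field G] [CharZero G] (Γ : Subgroup Gˣ) (hΓ : Γ.FG) {β : Type*} (𝓤 : Ultrafilter β)
    {ι : Type*} [Fintype ι] [Nonempty ι] (x : β → ι → Gˣ) (hx : ∀ t i, x t i ∈ Γ)
    (h0 : ∀ t, ∑ i, (x t i : G) = 0) : ∃ i i' : ι, i ≠ i' ∧ ∃ u, ∀ᶠ t in 𝓤, x t i' / x t i = u := by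
  classical
  obtain ⟨A, N, hA, hK⟩ := spec Γ hΓ
  let I := {f : A // f ≠ 0}
  have hK' : ∀ f : I, ∃ (K : Type u) (_ : Field K) (_ : NumberField K) (φ : A →+* K), Module.finrank ℚ K ≤ N ∧ φ f ≠ 0 :=
    fun f => hK f.1 f.2
  choose K fK nK φ hN hφ using hK'
  let incl : Γ →* A := { toFun := fun γ => ⟨((γ : Gˣ) : G), hA _ γ.2⟩, map_one' := rfl, map_mul' := fun _ _ => rfl }
  let ψ : ∀ f : I, Γ →* (K f)ˣ := fun f => MonoidHom.toHomUnits ((φ f).toMonoidHom.comp incl)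
  have hψ : ∀ f γ, ((ψ f γ : (K f)ˣ) : K f) = φ f (incl γ) := fun f γ => rfl
  haveI hFG : Group.FG Γ := (Group.fg_iff_subgroup_fg Γ).2 hΓ
  have hp : ∀ f : I, ∃ p : ι × ι, p.1 ≠ p.2 ∧ ∃ u, ∀ᶠ t in 𝓤, ψ f (⟨x t p.2, hx t _⟩ / ⟨x t p.1, hx t _⟩) = u := by
    intro f
    obtain ⟨i, i', h1, u, h2⟩ := pairK (ψ f).range (by rw [← Group.fg_iff_subgroup_fg]; exact Group.fg_range _) 𝓤
      (fun t i => ψ f ⟨x t i, hx t i⟩) (fun t i => ⟨_, rfl⟩) (by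
        intro t
        simp_rw [hψ]
        rw [← map_sum]
        have : ∑ i, incl ⟨x t i, hx t i⟩ = 0 := by
          ext
          rw [AddSubmonoidClass.coe_finset_sum]
          exact h0 t
        rw [this, map_zero])
    refine ⟨(i, i'), h1, u, ?_⟩
    filter_upwards [h2] with t ht
    rw [map_div]; exact ht
  choose p hp1 hp2 using hp
  have hV : ∃ q : ι × ι, ∀ g : A, g ≠ 0 → ∃ f : I, p f = q ∧ φ f g ≠ 0 := by
    by_contra h
    push Not at h
    choose g hg0 hg using h
    let P : I := ⟨∏ q, g q, Finset.prod_ne_zero_iff.2 fun q _ => hg0 q⟩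
    apply hφ P
    rw [map_prod]
    exact Finset.prod_eq_zero (Finset.mem_univ (p P)) (hg _ P rfl)
  obtain ⟨q, hq⟩ := hV
  let V := {f : I // p f = q}
  haveI : Module.Finite ℤ (Additive Γ) := Module.Finite.iff_addGroup_fg.2 inferInstance
  obtain ⟨T, hT⟩ := ker_fin (A := Additive Γ) (V := V) (fun f => Additive (K f.1)ˣ)
    (fun f => (MonoidHom.toAdditive (ψ f.1)).toIntLinearMap) (2 * N).factorial (Nat.factorial_pos _) (by
      intro f h n hn h1
      have h2 : IsOfFinOrder (Additive.toMul h) := by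
        rw [isOfFinOrder_iff_zpow_eq_one]
        exact ⟨n, hn, h1⟩
      have := root_bound (hN f.1) _ h2
      rw [natCast_zsmul]
      exact this) (by
      intro a ha
      by_contra hne
      have h1 : incl (Additive.toMul a) - 1 ≠ 0 := by
        intro h2
        apply hne
        rw [sub_eq_zero] at h2
        have h3 := congrArg Subtype.val h2
        have h4 : (Additive.toMul a) = 1 := by
          ext; exact h3
        exact h4
      obtain ⟨f, hf, hf2⟩ := hq _ h1
      apply hf2
      have h3 : ψ f (Additive.toMul a) = 1 := ha ⟨f, hf⟩
      rw [map_sub, map_one, ← hψ, h3, Units.val_one, sub_self])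
  have hqne : q.1 ≠ q.2 := by
    obtain ⟨f, hf, -⟩ := hq 1 one_ne_zero
    rw [← hf]; exact hp1 f
  refine ⟨q.1, q.2, hqne, ?_⟩
  let ρ : β → Γ := fun t => ⟨x t q.2, hx t _⟩ / ⟨x t q.1, hx t _⟩
  have hu : ∀ f : V, ∃ u, ∀ᶠ t in 𝓤, ψ f.1 (ρ t) = u := by
    rintro ⟨f, rfl⟩
    exact hp2 f
  choose u hu using hu
  have hall : ∀ᶠ t in 𝓤, ∀ f ∈ T, ψ f.1 (ρ t) = u f := (Filter.eventually_all_finset T).2 fun f _ => hu f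
  obtain ⟨t0, ht0⟩ := hall.exists
  obtain ⟨w, -, hw⟩ := ult_const 𝓤 (fun t => Additive.ofMul (ρ t / ρ t0)) _ hT (by
    filter_upwards [hall] with t ht f hf
    change ψ f.1 (ρ t / ρ t0) = 1
    rw [map_div, ht f hf, ht0 f hf, div_self'])
  refine ⟨((Additive.toMul w : Γ) : Gˣ) * (ρ t0 : Gˣ), ?_⟩
  filter_upwards [hw] with t ht
  rw [← ht]
  simp [ρ]
end MLT

set_option linter.unusedSectionVars false
namespace MLT
open Filter

lemma pairG_ev {G : Type*} [Field G] [CharZero G] (Γ : Subgroup Gˣ) (hΓ : Γ.FG) {β : Type*} (𝓤 : Ultrafilter β)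
    {ι : Type*} [Fintype ι] [Nonempty ι] (x : β → ι → Gˣ) (hx : ∀ t i, x t i ∈ Γ)
    (h0 : ∀ᶠ t in 𝓤, ∑ i, (x t i : G) = 0) : ∃ i i' : ι, i ≠ i' ∧ ∃ u, ∀ᶠ t in 𝓤, x t i' / x t i = u := by
  classical
  obtain ⟨t0, ht0⟩ := h0.exists
  obtain ⟨i, i', h1, u, h2⟩ := pairG Γ hΓ 𝓤 (fun t => if ∑ i, (x t i : G) = 0 then x t else x t0)
    (fun t i => by split_ifs <;> exact hx _ _) (fun t => by
      split_ifs with h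
      · exact h
      · exact ht0)
  refine ⟨i, i', h1, u, ?_⟩
  filter_upwards [h2, h0] with t ht ht'
  simpa [ht'] using ht

lemma classes_vanish {G : Type*} [Field G] [CharZero G] (Γ : Subgroup Gˣ) (hΓ : Γ.FG) {β : Type*} (𝓤 : Ultrafilter β)
    {ι : Type*} [Fintype ι] (y : β → ι → Gˣ) (hy : ∀ t i, y t i ∈ Γ)
    (h0 : ∀ t, ∑ i, (y t i : G) = 0) {Q : Type*} [DecidableEq Q] (π : ι → Q)
    (hπ : ∀ m m', π m = π m' ↔ ∃ u, ∀ᶠ t in 𝓤, y t m / y t m' = u) (κ : Q) :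
    ∀ᶠ t in 𝓤, ∑ m with π m = κ, (y t m : G) = 0 := by
  classical
  let J := {κ // κ ∈ Finset.univ.image π}
  haveI : Fintype J := inferInstanceAs (Fintype {κ // κ ∈ Finset.univ.image π})
  have hr : ∀ κ : J, ∃ r, π r = κ := by
    rintro ⟨κ, hκ⟩
    obtain ⟨r, -, h⟩ := Finset.mem_image.1 hκ
    exact ⟨r, h⟩
  choose r hr using hr
  have hs : ∀ κ : J, ∃ s : G, ∀ᶠ t in 𝓤, ∑ m with π m = κ, (y t m : G) = s * y t (r κ) := by
    intro κ
    have h1 : ∀ m, ∃ u : Gˣ, π m = κ → ∀ᶠ t in 𝓤, y t m / y t (r κ) = u := by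
      intro m
      by_cases h : π m = κ
      · obtain ⟨u, hu⟩ := (hπ m (r κ)).1 (h.trans (hr κ).symm)
        exact ⟨u, fun _ => hu⟩
      · exact ⟨1, fun h' => absurd h' h⟩
    choose u hu using h1
    refine ⟨∑ m with π m = κ, (u m : G), ?_⟩
    have h2 : ∀ᶠ t in 𝓤, ∀ m, π m = κ → y t m / y t (r κ) = u m := by
      rw [eventually_all]
      intro m
      by_cases h : π m = κ
      · filter_upwards [hu m h] with t ht _ using ht
      · exact Eventually.of_forall fun t h' => absurd h' h
    filter_upwards [h2] with t ht
    rw [Finset.sum_mul]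
    refine Finset.sum_congr rfl fun m hm => ?_
    rw [← ht m (Finset.mem_filter.1 hm).2]
    simp
  choose s hs using hs
  have hs0 : ∀ κ, s κ = 0 := by
    by_contra hne
    push Not at hne
    let I := {κ : J // s κ ≠ 0}
    haveI : Fintype I := inferInstanceAs (Fintype {κ : J // s κ ≠ 0})
    haveI : Nonempty I := ⟨⟨hne.choose, hne.choose_spec⟩⟩
    let v : I → Gˣ := fun κ => Units.mk0 (s κ.1) κ.2
    obtain ⟨a, b, hab, u, hu⟩ := pairG_ev (Γ ⊔ Subgroup.closure (Set.range v))
      (hΓ.sup ((Subgroup.fg_iff _).2 ⟨_, rfl, Set.finite_range v⟩)) 𝓤 (fun t κ => v κ * y t (r κ.1))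
      (fun t κ => mul_mem (le_sup_right (a := Γ) (Subgroup.subset_closure ⟨κ, rfl⟩)) (le_sup_left (b := Subgroup.closure (Set.range v)) (hy t _))) (by
        filter_upwards [eventually_all.2 hs] with t ht
        have h1 : ∑ κ : I, ((v κ * y t (r κ.1) : Gˣ) : G) = ∑ κ : J, s κ * y t (r κ) := by
          have h2 : ∑ κ : J, s κ * (y t (r κ) : G) = ∑ κ : J with s κ ≠ 0, s κ * (y t (r κ) : G) := by
            rw [Finset.sum_filter]
            refine Finset.sum_congr rfl fun κ _ => ?_
            split_ifs with h
            · rfl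
            · rw [not_not.1 h, zero_mul]
          rw [h2, ← Finset.sum_subtype_eq_sum_filter]
          refine Finset.sum_bij (fun κ _ => κ) ?_ ?_ ?_ ?_
          · simp
          · intro a _ b _ h; exact h
          · intro b _; exact ⟨b, Finset.mem_univ _, rfl⟩
          · intro a _; simp [v]
        rw [h1]
        simp_rw [← ht]
        rw [← h0 t, ← Finset.sum_fiberwise_of_maps_to (s := Finset.univ) (t := Finset.univ.image π) (g := π)
          (fun i _ => Finset.mem_image_of_mem _ (Finset.mem_univ _))]
        convert Finset.sum_coe_sort (Finset.univ.image π) (fun κ => ∑ m with π m = κ, (y t m : G)))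
    apply hab
    apply Subtype.ext
    apply Subtype.ext
    rw [← hr a.1, ← hr b.1]
    symm
    rw [hπ]
    refine ⟨u * v a / v b, ?_⟩
    filter_upwards [hu] with t ht
    rw [← ht]
    ext; simp; field_simp
  by_cases hκ : κ ∈ Finset.univ.image π
  · filter_upwards [hs ⟨κ, hκ⟩] with t ht
    rw [hs0, zero_mul] at ht
    exact ht
  · refine Eventually.of_forall fun t => ?_
    apply Finset.sum_eq_zero
    intro m hm
    exact absurd (Finset.mem_image.2 ⟨m, Finset.mem_univ _, (Finset.mem_filter.1 hm).2⟩) hκ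

lemma root_const {G : Type*} [Field G] {β : Type*} (𝓤 : Ultrafilter β) (w : β → Gˣ) (N : ℤ) (hN : N ≠ 0) (u : Gˣ)
    (h : ∀ᶠ t in 𝓤, w t ^ N = u) : ∃ u', ∀ᶠ t in 𝓤, w t = u' := by
  classical
  have hpos : 0 < N.natAbs := Int.natAbs_pos.2 hN
  have key : ∃ v : Gˣ, ∀ᶠ t in 𝓤, w t ^ N.natAbs = v := by
    rcases Int.natAbs_eq N with h1 | h1
    · refine ⟨u, ?_⟩
      filter_upwards [h] with t ht
      rw [h1, zpow_natCast] at ht; exact ht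
    · refine ⟨u⁻¹, ?_⟩
      filter_upwards [h] with t ht
      rw [h1, zpow_neg, zpow_natCast] at ht; rw [← ht, inv_inv]
  obtain ⟨v, hv⟩ := key
  have hfin : {z : Gˣ | z ^ N.natAbs = v}.Finite := by
    refine Set.Finite.of_finite_image (f := fun z : Gˣ => (z : G)) ?_ Units.val_injective.injOn
    refine (Polynomial.nthRoots N.natAbs (v : G)).toFinset.finite_toSet.subset ?_
    rintro _ ⟨z, hz, rfl⟩
    simp only [Finset.mem_coe, Multiset.mem_toFinset, Polynomial.mem_nthRoots hpos]
    rw [← hz]; simp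
  obtain ⟨u', -, h'⟩ := ult_const 𝓤 w _ hfin hv
  exact ⟨u', h'⟩

/-- monomials in units -/
def mon {G : Type*} [Field G] {n : ℕ} (x : Fin n → Gˣ) (v : Fin n → ℤ) : Gˣ := ∏ i, x i ^ v i

lemma mon_add {G : Type*} [Field G] {n : ℕ} (x : Fin n → Gˣ) (v w : Fin n → ℤ) : mon x (v + w) = mon x v * mon x w := by
  simp [mon, zpow_add, Finset.prod_mul_distrib]
lemma mon_sub {G : Type*} [Field G] {n : ℕ} (x : Fin n → Gˣ) (v w : Fin n → ℤ) : mon x (v - w) = mon x v / mon x w := by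
  simp [mon, zpow_sub, Finset.prod_div_distrib, div_eq_mul_inv, Finset.prod_mul_distrib]
lemma mon_smul {G : Type*} [Field G] {n : ℕ} (x : Fin n → Gˣ) (N : ℤ) (v : Fin n → ℤ) : mon x (N • v) = mon x v ^ N := by
  simp [mon, ← Finset.prod_zpow, mul_comm N, zpow_mul]
lemma mon_single {G : Type*} [Field G] {n : ℕ} (x : Fin n → Gˣ) (i : Fin n) : mon x (Pi.single i 1) = x i := by
  classical
  rw [mon, Finset.prod_eq_single i]
  · simp
  · intro j _ hj; simp [hj]
  · simp

/-- exponents of eventually constant monomials -/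
def constExp {G : Type*} [Field G] {β : Type*} (𝓤 : Ultrafilter β) {n : ℕ} (x : β → Fin n → Gˣ) : Submodule ℤ (Fin n → ℤ) where
  carrier := {v | ∃ u, ∀ᶠ t in 𝓤, mon (x t) v = u}
  zero_mem' := ⟨1, Eventually.of_forall fun t => by simp [mon]⟩
  add_mem' := by
    rintro v w ⟨a, ha⟩ ⟨b, hb⟩
    refine ⟨a * b, ?_⟩
    filter_upwards [ha, hb] with t h1 h2
    rw [mon_add, h1, h2]
  smul_mem' := by
    rintro N v ⟨a, ha⟩
    refine ⟨a ^ N, ?_⟩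
    filter_upwards [ha] with t h1
    rw [mon_smul, h1]

theorem main (G : Type*) [Field G] [CharZero G] (Γ : Subgroup Gˣ) (hΓ : Γ.FG)
    (n : ℕ) (f : MvPolynomial (Fin n) G) :
    {x : Fin n → Gˣ | (∀ i, x i ∈ Γ) ∧
      MvPolynomial.eval (fun i => (x i : G)) f = 0 ∧
      ¬ IsDegenerate f x}.Finite := by
  classical
  by_contra hinf
  let X := Set.Infinite.natEmbedding _ hinf
  let x : ℕ → Fin n → Gˣ := fun t => (X t).1
  have hxinj : Function.Injective x := fun a b h => X.injective (Subtype.ext h)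
  have hxΓ : ∀ t i, x t i ∈ Γ := fun t => (X t).2.1
  have hx0 : ∀ t, MvPolynomial.eval (fun i => (x t i : G)) f = 0 := fun t => (X t).2.2.1
  have hxd : ∀ t, ¬ IsDegenerate f (x t) := fun t => (X t).2.2.2
  let 𝓤 := hyperfilter ℕ
  let W := constExp 𝓤 x
  have hW : ∀ v, v ∈ W ↔ ∃ u, ∀ᶠ t in 𝓤, mon (x t) v = u := fun v => Iff.rfl
  have hWtop : W ≠ ⊤ := by
    intro h
    have h1 : ∀ i, ∃ u, ∀ᶠ t in 𝓤, x t i = u := by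
      intro i
      obtain ⟨u, hu⟩ := (hW (Pi.single i 1)).1 (h ▸ Submodule.mem_top)
      simp_rw [mon_single] at hu
      exact ⟨u, hu⟩
    choose u hu using h1
    have h2 : {t | x t = u} ∈ 𝓤 := by
      filter_upwards [eventually_all.2 hu] with t ht using funext ht
    refine Set.Finite.notMem_hyperfilter ?_ h2
    apply Set.Subsingleton.finite
    intro a ha b hb
    exact hxinj (ha.trans hb.symm)
  haveI : Module.IsTorsionFree ℤ ((Fin n → ℤ) ⧸ W) := by
    rw [Module.isTorsionFree_iff_smul_eq_zero]
    intro N q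
    obtain ⟨v, rfl⟩ := Submodule.Quotient.mk_surjective W q
    intro h
    by_cases hN : N = 0
    · exact Or.inl hN
    · right
      rw [← Submodule.Quotient.mk_smul, Submodule.Quotient.mk_eq_zero, hW] at h
      rw [Submodule.Quotient.mk_eq_zero, hW]
      obtain ⟨u, hu⟩ := h
      simp_rw [mon_smul] at hu
      exact root_const 𝓤 _ N hN u hu
  haveI : Module.Free ℤ ((Fin n → ℤ) ⧸ W) := Module.free_of_finite_type_torsion_free'
  obtain ⟨φ, q, hφ⟩ : ∃ (φ : Module.Dual ℤ ((Fin n → ℤ) ⧸ W)) (q : (Fin n → ℤ) ⧸ W), φ q ≠ 0 := by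
    by_contra h
    push Not at h
    apply hWtop
    rw [eq_top_iff]
    rintro v -
    rw [← Submodule.Quotient.mk_eq_zero, ← Module.forall_dual_apply_eq_zero_iff ℤ]
    exact fun φ => h φ _
  let c : Fin n → ℤ := fun i => φ (W.mkQ (Pi.single i 1))
  have hc : ∀ v : Fin n → ℤ, φ (W.mkQ v) = ∑ i, v i * c i := by
    intro v
    conv_lhs => rw [pi_eq_sum_univ' v]
    rw [map_sum, map_sum]
    refine Finset.sum_congr rfl fun i _ => ?_
    rw [map_smul, map_smul, smul_eq_mul]
  have hc0 : c ≠ 0 := by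
    intro h
    obtain ⟨v, rfl⟩ := Submodule.Quotient.mk_surjective W q
    apply hφ
    have := hc v
    rw [h] at this
    simpa using this
  let e : f.support → Fin n → ℤ := fun m i => (m.1 i : ℤ)
  let co : f.support → Gˣ := fun m => Units.mk0 (f.coeff m.1) (MvPolynomial.mem_support_iff.1 m.2)
  let y : ℕ → f.support → Gˣ := fun t m => co m * mon (x t) (e m)
  let π : f.support → (Fin n → ℤ) ⧸ W := fun m => W.mkQ (e m)
  have hyv : ∀ t (m : f.support), (y t m : G) = f.coeff m.1 * ∏ i, (x t i : G) ^ (m.1 i) := by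
    intro t m
    simp [y, co, mon, e]
  have hvan := classes_vanish (Γ ⊔ Subgroup.closure (Set.range co))
      (hΓ.sup ((Subgroup.fg_iff _).2 ⟨_, rfl, Set.finite_range co⟩)) 𝓤 y
      (fun t m => mul_mem (le_sup_right (a := Γ) (Subgroup.subset_closure ⟨m, rfl⟩))
        (le_sup_left (b := Subgroup.closure (Set.range co)) (prod_mem fun i _ => zpow_mem (hxΓ t i) _)))
      (by
        intro t
        rw [← hx0 t, MvPolynomial.eval_eq']
        simp_rw [hyv]
        exact Finset.sum_coe_sort f.support (fun d => f.coeff d * ∏ i, (x t i : G) ^ d i)) π (by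
        intro m m'
        rw [← sub_eq_zero, ← map_sub]
        change Submodule.Quotient.mk _ = 0 ↔ _
        rw [Submodule.Quotient.mk_eq_zero, hW]
        simp_rw [mon_sub]
        constructor
        · rintro ⟨u, hu⟩
          refine ⟨co m / co m' * u, ?_⟩
          filter_upwards [hu] with t ht
          rw [← ht]; exact mul_div_mul_comm _ _ _ _
        · rintro ⟨u, hu⟩
          refine ⟨u / (co m / co m'), ?_⟩
          filter_upwards [hu] with t ht
          rw [← ht]
          simp only [y]
          rw [mul_div_mul_comm, mul_div_cancel_left])
  have hall : ∀ᶠ t in 𝓤, ∀ m0, ∑ m with π m = π m0, (y t m : G) = 0 := eventually_all.2 fun m0 => hvan (π m0)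
  obtain ⟨t, ht⟩ := hall.exists
  apply hxd t
  refine ⟨c, hc0, ?_⟩
  rw [MvPolynomial.eval₂_eq']
  have h1 : ∀ m : f.support, LaurentPolynomial.C (f.coeff m.1) * ∏ i, (LaurentPolynomial.C (x t i : G) * LaurentPolynomial.T (c i)) ^ m.1 i
      = LaurentPolynomial.C (y t m : G) * LaurentPolynomial.T (φ (π m)) := by
    intro m
    have h2 : ∀ s : Finset (Fin n), ∏ i ∈ s, (LaurentPolynomial.T (c i) : LaurentPolynomial G) ^ m.1 i = LaurentPolynomial.T (∑ i ∈ s, e m i * c i) := by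
      intro s
      induction s using Finset.induction_on with
      | empty => simp
      | insert a s ha ih => rw [Finset.prod_insert ha, Finset.sum_insert ha, ih, LaurentPolynomial.T_add, LaurentPolynomial.T_pow]
    simp_rw [mul_pow]
    rw [Finset.prod_mul_distrib, h2, hc, hyv, map_mul, map_prod]
    simp_rw [map_pow]
    ring
  rw [← Finset.sum_coe_sort]
  rw [Finset.sum_congr rfl (fun m _ => h1 m)]
  rw [← Finset.sum_fiberwise_of_maps_to (s := Finset.univ) (t := Finset.univ.image π) (g := π)
          (fun i _ => Finset.mem_image_of_mem _ (Finset.mem_univ _))]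
  apply Finset.sum_eq_zero
  intro κ hκ
  obtain ⟨m0, -, rfl⟩ := Finset.mem_image.1 hκ
  have h3 : ∑ m with π m = π m0, LaurentPolynomial.C (y t m : G) * LaurentPolynomial.T (φ (π m))
      = LaurentPolynomial.C (∑ m with π m = π m0, (y t m : G)) * LaurentPolynomial.T (φ (π m0)) := by
    rw [map_sum, Finset.sum_mul]
    refine Finset.sum_congr rfl fun m hm => ?_
    rw [(Finset.mem_filter.1 hm).2]
  rw [h3, ht m0, map_zero, zero_mul]
end MLT

/-- Let `G` be a field of characteristic 0, `Γ` a finitely generated subgroup of `G*`,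
and `f` a nonzero polynomial in `G[X1, …, Xn]`. Then the equation `f(x1, …, xn) = 0`
has only finitely many non-degenerate solutions `(x1, …, xn) ∈ Γⁿ`. -/
theorem nondegenerate_solutions_finite
    (G : Type*) [Field G] [CharZero G] (Γ : Subgroup Gˣ) (hΓ : Γ.FG)
    (n : ℕ) (f : MvPolynomial (Fin n) G) (hf : f ≠ 0) :
    {x : Fin n → Gˣ | (∀ i, x i ∈ Γ) ∧
      MvPolynomial.eval (fun i => (x i : G)) f = 0 ∧
      ¬ IsDegenerate f x}.Finite := by
  exact MLT.main G Γ hΓ n f
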